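/- Let Q satisfy Assumption (A). There exists δ > 0 such that: for every sequence (f_n) in E_rad which is bounded in L∞(ℝ⁶) and satisfies |∇φ_{f_n} − ∇φ_Q|_{L²(ℝ³)} < δ for all n, lim sup_{n→∞} H(f_n) ≤ H(Q), and f_n^* → Q^* in L¹((0,∞)×(0,∞)) as n → ∞, one has f_n → Q in L¹(ℝ⁶) and |v|² f_n → |v|² Q in L¹(ℝ⁶). -/

import Mathlib

noncomputable section

open MeasureTheory Real Filter Set Topology
open scoped ENNReal NNReal

abbrev E3 : Type := EuclideanSpace ℝ (Fin 3)
abbrev Phase : Type := E3 × E3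

/-- Spherical symmetry: invariance under all rotations of `ℝ³` acting jointly on `x` and `v`. -/
def SphSym (f : Phase → ℝ) : Prop :=
  ∀ R : E3 ≃ₗᵢ[ℝ] E3, LinearMap.det (R.toLinearEquiv : E3 →ₗ[ℝ] E3) = 1 →
    ∀ z : Phase, f (R z.1, R z.2) = f z

/-- `|x × v|²`, via the Lagrange identity. -/
def ellOf (z : Phase) : ℝ := ‖z.1‖ ^ 2 * ‖z.2‖ ^ 2 - (inner ℝ z.1 z.2 : ℝ) ^ 2

/-- Spatial density. -/
def rhoF (f : Phase → ℝ) (x : E3) : ℝ := ∫ v : E3, f (x, v)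

/-- Poisson field. -/
def phiF (f : Phase → ℝ) (x : E3) : ℝ := - ∫ y : E3, rhoF f y / (4 * π * ‖x - y‖)

/-- Radial representation of the Poisson field. -/
def phiRad (f : Phase → ℝ) (r : ℝ) : ℝ :=
  phiF f (r • (EuclideanSpace.single (0 : Fin 3) (1:ℝ)))

def mass (f : Phase → ℝ) : ℝ := ∫ z : Phase, f z

def kineticE (f : Phase → ℝ) : ℝ := ∫ z : Phase, ‖z.2‖ ^ 2 * f z

def gradPhi (f : Phase → ℝ) (x : E3) : E3 := gradient (phiF f) x

def fieldSq (f : Phase → ℝ) : ℝ := ∫ x : E3, ‖gradPhi f x‖ ^ 2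

/-- `L²` distance between the force fields of `f` and `g`. -/
def fieldDist (f g : Phase → ℝ) : ℝ :=
  Real.sqrt (∫ x : E3, ‖gradPhi f x - gradPhi g x‖ ^ 2)

/-- The Hamiltonian. -/
def Ham (f : Phase → ℝ) : ℝ := kineticE f / 2 - fieldSq f / 2

/-- The norm of the energy space. -/
def eNormE (f : Phase → ℝ) : ℝ≥0∞ :=
  eLpNorm f 1 volume + eLpNorm f ⊤ volume +
    ∫⁻ z : Phase, (‖z.2‖₊ : ℝ≥0∞) ^ 2 * (‖f z‖₊ : ℝ≥0∞)

def memE (f : Phase → ℝ) : Prop := Measurable f ∧ (∀ z, 0 ≤ f z) ∧ eNormE f < ⊤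

def memErad (f : Phase → ℝ) : Prop := memE f ∧ SphSym f

/-- Density of the measure `ν_ℓ`. -/
def nuDens (ℓ : ℝ) (p : ℝ × ℝ) : ℝ≥0∞ :=
  if 0 < p.1 ∧ ℓ < p.1 ^ 2 * p.2 ^ 2 then
    ENNReal.ofReal (4 * π ^ 2 * p.1 * |p.2| / Real.sqrt (p.1 ^ 2 * p.2 ^ 2 - ℓ))
  else 0

def nuMeas (ℓ : ℝ) : Measure (ℝ × ℝ) := volume.withDensity (nuDens ℓ)

/-- Representative phase point with `|x| = r`, `|v| = |u|`, `|x×v|² = ℓ` and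
`x·v = sign u · √(r²u²-ℓ)`. -/
def radPoint (r u ℓ : ℝ) : Phase :=
  (r • (EuclideanSpace.single (0 : Fin 3) (1:ℝ)),
   (Real.sign u * Real.sqrt (r ^ 2 * u ^ 2 - ℓ) / r) • (EuclideanSpace.single (0 : Fin 3) (1:ℝ))
     + (Real.sqrt ℓ / r) • (EuclideanSpace.single (1 : Fin 3) (1:ℝ)))

/-- Distribution function of `f` at kinetic momentum `ℓ`. -/
def muDist (f : Phase → ℝ) (s ℓ : ℝ) : ℝ≥0∞ :=
  nuMeas ℓ {p : ℝ × ℝ | s < f (radPoint p.1 p.2 ℓ)}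

/-- `g ∈ Eq(f)` : `g` is nonnegative, spherically symmetric and equimeasurable to `f`
at (almost) every kinetic momentum `ℓ`. -/
def EqMeas (f g : Phase → ℝ) : Prop :=
  (∀ z, 0 ≤ g z) ∧ SphSym g ∧
    ∀ s : ℝ, 0 < s →
      ∀ᵐ ℓ ∂(volume.restrict (Ioi (0:ℝ))), muDist g s ℓ = muDist f s ℓ

/-- Schwarz symmetrization of `f` at fixed `ℓ`. -/
def schwarz (f : Phase → ℝ) (t ℓ : ℝ) : ℝ :=
  if ENNReal.ofReal t < muDist f 0 ℓ then
    sSup {s : ℝ | 0 ≤ s ∧ ENNReal.ofReal t < muDist f s ℓ}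
  else 0

/-- Effective potential. -/
def psiPot (φ : ℝ → ℝ) (ℓ r : ℝ) : ℝ := φ r + ℓ / (2 * r ^ 2)

def eMinPot (φ : ℝ → ℝ) (ℓ : ℝ) : ℝ := sInf (psiPot φ ℓ '' Ioi 0)

def r1Pot (φ : ℝ → ℝ) (e ℓ : ℝ) : ℝ := sInf {r : ℝ | 0 < r ∧ psiPot φ ℓ r < e}

def r2Pot (φ : ℝ → ℝ) (e ℓ : ℝ) : ℝ := sSup {r : ℝ | 0 < r ∧ psiPot φ ℓ r < e}

/-- The Jacobian `a_φ(e, ℓ)` (meaningful for `e < 0`). -/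
def aPot (φ : ℝ → ℝ) (e ℓ : ℝ) : ℝ :=
  8 * π ^ 2 * Real.sqrt 2 * ∫ r in Ioi (0:ℝ), Real.sqrt (max (e - psiPot φ ℓ r) 0)

/-- Inverse of the bijection `e ↦ a_φ(e,ℓ)` from `(e_{φ,ℓ},0)` onto `(0,∞)`. -/
def aPotInv (φ : ℝ → ℝ) (s ℓ : ℝ) : ℝ :=
  sSup {e : ℝ | eMinPot φ ℓ < e ∧ e < 0 ∧ aPot φ e ℓ < s}

/-- Microscopic energy w.r.t. the Poisson field of `g`. -/
def microE (g : Phase → ℝ) (z : Phase) : ℝ := ‖z.2‖ ^ 2 / 2 + phiF g z.1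

/-- Rearrangement of `f` with respect to the microscopic energy of the field of `g`. -/
def rearr (f g : Phase → ℝ) (z : Phase) : ℝ :=
  if microE g z < 0 then
    schwarz f (aPot (phiRad g) (microE g z) (ellOf z)) (ellOf z)
  else 0

/-- Assumption (A). -/
structure AssumptionA (Q : Phase → ℝ) (F : ℝ → ℝ → ℝ) (e₀ : ℝ) : Prop where
  contQ : Continuous Q
  nonneg : ∀ z, 0 ≤ Q z
  nonzero : Q ≠ 0
  cpt : HasCompactSupport Q
  sph : SphSym Q
  eqF : ∀ z : Phase, Q z = F (microE Q z) (ellOf z)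
  Fnonneg : ∀ e ℓ, 0 ≤ ℓ → 0 ≤ F e ℓ
  Fcont : ContinuousOn (fun p : ℝ × ℝ => F p.1 p.2) {p : ℝ × ℝ | 0 ≤ p.2}
  e₀neg : e₀ < 0
  Fsupp : ∀ e ℓ, 0 ≤ ℓ → 0 < F e ℓ → e < e₀
  FC1 : ContDiffOn ℝ 1 (fun p : ℝ × ℝ => F p.1 p.2) {p : ℝ × ℝ | 0 ≤ p.2 ∧ 0 < F p.1 p.2}
  FeNeg : ∀ e ℓ, 0 ≤ ℓ → 0 < F e ℓ → deriv (fun e' => F e' ℓ) e < 0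

/-- The reduced functional `J_{f^*}(φ_g) = H(f^{*φ_g}) + ½|∇φ_g − ∇φ_{f^{*φ_g}}|²`. -/
def Jred (f g : Phase → ℝ) : ℝ :=
  Ham (rearr f g) + (∫ x : E3, ‖gradPhi g x - gradPhi (rearr f g) x‖ ^ 2) / 2

def distL1 (f g : Phase → ℝ) : ℝ := ∫ z : Phase, |f z - g z|

def distL1v (f g : Phase → ℝ) : ℝ := ∫ z : Phase, ‖z.2‖ ^ 2 * |f z - g z|

open ENNReal (ofReal ofReal_mul ofReal_ne_top ofReal_le_ofReal ofReal_add ofReal_lt_top ofReal_coe_nnreal ofReal_toReal toReal_ofReal ofReal_of_nonpos ofReal_le_ofReal_iff)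

local notation "T2" => ℝ × ℝ
local notation "T3" => ℝ × (ℝ × ℝ)
local notation "T4" => (ℝ × ℝ) × (ℝ × ℝ)

lemma lcmul {α : Type*} [MeasurableSpace α] {μ : Measure α} {r : ℝ} {f : α → ℝ≥0∞} :
    ∫⁻ a, ofReal r * f a ∂μ = ofReal r * ∫⁻ a, f a ∂μ := lintegral_const_mul' _ _ ofReal_ne_top

lemma slcongr {a : ℝ} {f g : ℝ → ℝ≥0∞} (h : EqOn f g (Ioi a)) :
    ∫⁻ x in Ioi a, f x = ∫⁻ x in Ioi a, g x := setLIntegral_congr_fun measurableSet_Ioi h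




lemma lint_sq (g : ℝ → ℝ≥0∞) :
    ∫⁻ r in Ioi (0:ℝ), ofReal (2 * r) * g (r ^ 2) = ∫⁻ τ in Ioi (0:ℝ), g τ := by
  have himg : (fun r : ℝ => r ^ 2) '' Ioi 0 = Ioi 0 := by
    ext y
    simp only [mem_image, mem_Ioi]
    constructor
    · rintro ⟨x, hx, rfl⟩; positivity
    · intro hy; exact ⟨√y, Real.sqrt_pos.2 hy, Real.sq_sqrt hy.le⟩
  have h := lintegral_image_eq_lintegral_abs_deriv_mul (s := Ioi (0:ℝ)) (f := fun r : ℝ => r ^ 2)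
    (f' := fun r => 2 * r) measurableSet_Ioi
    (fun x _ => by simpa using (hasDerivAt_pow 2 x).hasDerivWithinAt)
    (fun a ha b hb hab => by
      have := (sq_eq_sq₀ (le_of_lt ha) (le_of_lt hb)).1 hab
      exact this) g
  rw [himg] at h
  rw [h]
  refine slcongr (fun r hr => ?_)
  have : (0:ℝ) < r := hr
  simp only [abs_of_pos (show (0:ℝ) < 2 * r by positivity)]

lemma lint_plane (g : ℝ → ℝ≥0∞) (hg : Measurable g) :
    ∫⁻ p : T2, g (p.1 ^ 2 + p.2 ^ 2) = ofReal π * ∫⁻ τ in Ioi (0:ℝ), g τ := by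
  rw [← lintegral_comp_polarCoord_symm]
  have h1 : ∀ p : T2, ofReal p.1 • g ((polarCoord.symm p).1 ^ 2 + (polarCoord.symm p).2 ^ 2)
      = ofReal p.1 * g (p.1 ^ 2) := by
    intro p
    have : (polarCoord.symm p).1 ^ 2 + (polarCoord.symm p).2 ^ 2 = p.1 ^ 2 := by
      simp only [polarCoord_symm_apply]
      nlinarith [Real.sin_sq_add_cos_sq p.2]
    rw [this, smul_eq_mul]
  simp_rw [h1]
  rw [polarCoord_target, Measure.volume_eq_prod, ← Measure.prod_restrict,
    lintegral_prod _ (by fun_prop)]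
  simp_rw [setLIntegral_const, Real.volume_Ioo]
  rw [← lint_sq g, ← lintegral_const_mul _ (by fun_prop)]
  refine slcongr (fun r hr => ?_)
  have hr : (0:ℝ) < r := hr
  rw [mul_comm, ← mul_assoc, ← ofReal_mul (by linarith [Real.pi_pos]), ← mul_assoc,
    ← ofReal_mul (by linarith [Real.pi_pos])]
  congr 2; ring

lemma lint_E3 (H : ℝ → ℝ → ℝ≥0∞) (hH : Measurable (fun p : T2 => H p.1 p.2)) :
    ∫⁻ y : E3, H (y 0) (‖y‖ ^ 2 - (y 0) ^ 2) =
      ofReal π * ∫⁻ w, ∫⁻ τ in Ioi (0:ℝ), H w τ := by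
  have hn : ∀ y : E3, H (y 0) (‖y‖ ^ 2 - (y 0) ^ 2) =
      (fun c : Fin 3 → ℝ => H (c 0) (c 1 ^ 2 + c 2 ^ 2)) (WithLp.ofLp y) := by
    intro y
    have : ‖y‖ ^ 2 - (y 0) ^ 2 = y 1 ^ 2 + y 2 ^ 2 := by
      rw [EuclideanSpace.norm_sq_eq]; simp [Fin.sum_univ_three]; ring
    rw [this]
  rw [lintegral_congr hn, (PiLp.volume_preserving_ofLp (Fin 3)).lintegral_comp
    (f := fun c : Fin 3 → ℝ => H (c 0) (c 1 ^ 2 + c 2 ^ 2))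
    (hH.comp (f := fun c : Fin 3 → ℝ => (c 0, c 1 ^ 2 + c 2 ^ 2)) (by fun_prop))]
  have e1 := (volume_preserving_piFinSuccAbove (fun _ : Fin 3 => ℝ) 0).lintegral_comp
    (f := fun c : ℝ × (Fin 2 → ℝ) => H c.1 (c.2 0 ^ 2 + c.2 1 ^ 2))
    (hH.comp (f := fun c : ℝ × (Fin 2 → ℝ) => (c.1, c.2 0 ^ 2 + c.2 1 ^ 2)) (by fun_prop))
  have e2 : ∀ c : Fin 3 → ℝ, (fun c : ℝ × (Fin 2 → ℝ) => H c.1 (c.2 0 ^ 2 + c.2 1 ^ 2))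
      (MeasurableEquiv.piFinSuccAbove (fun _ : Fin 3 => ℝ) 0 c) = H (c 0) (c 1 ^ 2 + c 2 ^ 2) := by
    intro c; rfl
  rw [← lintegral_congr (fun c => (e2 c)), e1, Measure.volume_eq_prod, lintegral_prod
    (fun c : ℝ × (Fin 2 → ℝ) => H c.1 (c.2 0 ^ 2 + c.2 1 ^ 2)) (hH.comp (f := fun c : ℝ × (Fin 2 → ℝ) => (c.1, c.2 0 ^ 2 + c.2 1 ^ 2)) (by fun_prop)).aemeasurable]
  have hm : Measurable fun w => ∫⁻ τ in Ioi (0:ℝ), H w τ := by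
    exact Measurable.lintegral_prod_right' (ν := volume.restrict (Ioi 0)) hH
  rw [← lintegral_const_mul _ hm]
  refine lintegral_congr (fun w => ?_)
  rw [← lint_plane (H w) (hH.comp (f := fun t : ℝ => (w, t)) (by fun_prop))]
  exact (volume_preserving_finTwoArrow ℝ).lintegral_comp
    (f := fun p : T2 => H w (p.1 ^ 2 + p.2 ^ 2))
    (hH.comp (f := fun p : T2 => (w, p.1 ^ 2 + p.2 ^ 2)) (by fun_prop))

lemma exists_basis1 (u : E3) (hu : ‖u‖ = 1) : ∃ b : OrthonormalBasis (Fin 3) ℝ E3, b 0 = u := by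
  have ho : Orthonormal ℝ (({0} : Set (Fin 3)).domRestrict (fun _ => u)) := by
    refine ⟨fun i => hu, fun i j hij => ?_⟩
    exact absurd (Subsingleton.elim i j) hij
  obtain ⟨b, hb⟩ := ho.exists_orthonormalBasis_extension_of_card_eq (by simp)
  exact ⟨b, hb 0 rfl⟩

lemma cyl (u : E3) (hu : ‖u‖ = 1) (H : ℝ → ℝ → ℝ≥0∞)
    (hH : Measurable (fun p : T2 => H p.1 p.2)) :
    ∫⁻ y : E3, H (inner ℝ u y) (‖y‖ ^ 2 - (inner ℝ u y) ^ 2) =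
      ofReal π * ∫⁻ w, ∫⁻ τ in Ioi (0:ℝ), H w τ := by
  obtain ⟨b, rfl⟩ := exists_basis1 u hu
  rw [← lint_E3 H hH, ← (b.measurePreserving_repr).lintegral_comp
    (f := fun y : E3 => H (y 0) (‖y‖ ^ 2 - (y 0) ^ 2)) (hH.comp (f := fun y : E3 => (y 0, ‖y‖ ^ 2 - (y 0) ^ 2)) (by fun_prop))]
  simp [b.repr_apply_apply]


lemma lint_inv (g : ℝ → ℝ≥0∞) :
    ∫⁻ r in Ioi (0:ℝ), g r = ∫⁻ s in Ioi (0:ℝ), ofReal (s ^ 2)⁻¹ * g s⁻¹ := by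
  have himg : (fun r : ℝ => r⁻¹) '' Ioi 0 = Ioi 0 := by
    ext y
    simp only [mem_image, mem_Ioi]
    constructor
    · rintro ⟨x, hx, rfl⟩; positivity
    · intro hy; exact ⟨y⁻¹, by positivity, inv_inv y⟩
  have h := lintegral_image_eq_lintegral_abs_deriv_mul (s := Ioi (0:ℝ)) (f := fun r : ℝ => r⁻¹)
    (f' := fun r => -(r ^ 2)⁻¹) measurableSet_Ioi
    (fun x hx => (hasDerivAt_inv (ne_of_gt hx)).hasDerivWithinAt)
    (fun a ha b hb hab => inv_injective hab) g
  rw [himg] at h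
  rw [h]
  refine slcongr (fun r hr => ?_)
  simp only [abs_neg, abs_of_nonneg (show (0:ℝ) ≤ (r ^ 2)⁻¹ by positivity)]

lemma lint_shift (g : ℝ → ℝ≥0∞) (w : ℝ) :
    ∫⁻ τ in Ioi (0:ℝ), g (√(w ^ 2 + τ)) = ∫⁻ R in Ioi |w|, ofReal (2 * R) * g R := by
  have himg : (fun r : ℝ => r ^ 2 - w ^ 2) '' Ioi |w| = Ioi 0 := by
    ext y
    simp only [mem_image, mem_Ioi]
    constructor
    · rintro ⟨x, hx, rfl⟩
      have := (sq_lt_sq₀ (abs_nonneg w) (by linarith [abs_nonneg w])).2 hx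
      rw [sq_abs] at this; linarith
    · intro hy
      refine ⟨√(w ^ 2 + y), ?_, ?_⟩
      · rw [← Real.sqrt_sq_eq_abs]; exact Real.sqrt_lt_sqrt (by positivity) (by linarith)
      · rw [Real.sq_sqrt (by positivity)]; ring
  have h := lintegral_image_eq_lintegral_abs_deriv_mul (s := Ioi |w|)
    (f := fun r : ℝ => r ^ 2 - w ^ 2)
    (f' := fun r => 2 * r) measurableSet_Ioi
    (fun x _ => by simpa using ((hasDerivAt_pow 2 x).sub_const (w ^ 2)).hasDerivWithinAt)
    (fun a ha b hb hab => by
      have h1 : (0:ℝ) ≤ a := (abs_nonneg w).trans (le_of_lt ha)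
      have h2 : (0:ℝ) ≤ b := (abs_nonneg w).trans (le_of_lt hb)
      exact (sq_eq_sq₀ h1 h2).1 (by simpa using hab)) (fun τ => g (√(w ^ 2 + τ)))
  rw [himg] at h
  rw [h]
  refine slcongr (fun r hr => ?_)
  have h1 : (0:ℝ) ≤ r := (abs_nonneg w).trans (le_of_lt hr)
  simp only [abs_of_nonneg (show (0:ℝ) ≤ 2 * r by positivity)]
  rw [show w ^ 2 + (r ^ 2 - w ^ 2) = r ^ 2 by ring, Real.sqrt_sq h1]

lemma shell (u : E3) (hu : ‖u‖ = 1) (g : ℝ → ℝ → ℝ≥0∞)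
    (hg : Measurable (fun p : T2 => g p.1 p.2)) :
    ∫⁻ y : E3, g (inner ℝ u y) ‖y‖ =
      ofReal (2 * π) * ∫⁻ R in Ioi (0:ℝ), ofReal R * ∫⁻ a in Ioo (-R) R, g a R := by
  have h0 : ∀ y : E3, g (inner ℝ u y) ‖y‖ = (fun w τ => g w (√(w ^ 2 + τ))) (inner ℝ u y)
      (‖y‖ ^ 2 - (inner ℝ u y) ^ 2) := by
    intro y
    simp only [add_sub_cancel, Real.sqrt_sq (norm_nonneg y)]
  rw [lintegral_congr h0, cyl u hu (fun w τ => g w (√(w ^ 2 + τ)))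
    (hg.comp (f := fun p : T2 => (p.1, √(p.1 ^ 2 + p.2))) (by fun_prop))]
  have h1 : ∀ w, ∫⁻ τ in Ioi (0:ℝ), g w (√(w ^ 2 + τ)) =
      ∫⁻ R in Ioi (0:ℝ), (Ioo (-R) R).indicator (fun w => ofReal (2 * R) * g w R) w := by
    intro w
    rw [lint_shift (g w) w, ← lintegral_indicator measurableSet_Ioi,
      ← lintegral_indicator measurableSet_Ioi]
    refine lintegral_congr (fun R => ?_)
    by_cases h : |w| < R
    · have hR : (0:ℝ) < R := lt_of_le_of_lt (abs_nonneg w) h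
      rw [indicator_of_mem (by exact h), indicator_of_mem (by exact hR),
        indicator_of_mem (by exact abs_lt.1 h)]
    · rw [indicator_of_notMem (by exact h), indicator_apply]
      split_ifs
      · rw [indicator_of_notMem (s := Ioo (-R) R) (fun hh => h (abs_lt.2 hh))]
      · rfl
  simp_rw [h1]
  have hm : Measurable (fun p : T2 =>
      (Ioo (-p.2) p.2).indicator (fun w => ofReal (2 * p.2) * g w p.2) p.1) := by
    have : (fun p : T2 => (Ioo (-p.2) p.2).indicator (fun w => ofReal (2 * p.2) * g w p.2) p.1)
      = {p : T2 | -p.2 < p.1 ∧ p.1 < p.2}.indicator (fun p => ofReal (2 * p.2) * g p.1 p.2) := by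
      ext p; simp only [indicator_apply, mem_Ioo, mem_ofPred_eq]
    rw [this]
    refine Measurable.indicator (by fun_prop) ?_
    exact (measurableSet_lt measurable_snd.neg measurable_fst).inter
      (measurableSet_lt measurable_fst measurable_snd)
  rw [lintegral_lintegral_swap (by exact hm.aemeasurable)]
  have h2 : ∀ R ∈ Ioi (0:ℝ), ∫⁻ w, (Ioo (-R) R).indicator (fun w => ofReal (2 * R) * g w R) w
      = ofReal 2 * (ofReal R * ∫⁻ a in Ioo (-R) R, g a R) := by
    intro R hR
    rw [lintegral_indicator measurableSet_Ioo, lcmul, ← mul_assoc,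
      ofReal_mul (by norm_num)]
  rw [slcongr h2, lcmul,
    ← mul_assoc, ← ofReal_mul Real.pi_nonneg, mul_comm π]

def e1 : E3 := EuclideanSpace.single (0 : Fin 3) (1:ℝ)
def e2 : E3 := EuclideanSpace.single (1 : Fin 3) (1:ℝ)
lemma e1n : ‖e1‖ = 1 := by simp [e1]
lemma e2n : ‖e2‖ = 1 := by simp [e2]
lemma e12 : (inner ℝ e1 e2 : ℝ) = 0 := by simp [e1, e2, EuclideanSpace.inner_single_left]

lemma lint_radial (g : ℝ → ℝ≥0∞) (hg : Measurable g) :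
    ∫⁻ y : E3, g ‖y‖ = ∫⁻ r in Ioi (0:ℝ), ofReal (4 * π * r ^ 2) * g r := by
  rw [shell e1 e1n (fun _ r => g r) (by fun_prop), ← lcmul]
  refine slcongr (fun r hr => ?_)
  have hr : (0:ℝ) < r := hr
  simp only [setLIntegral_const, Real.volume_Ioo]
  rw [mul_comm (g r), ← mul_assoc, ← mul_assoc, ← ofReal_mul (by positivity),
    ← ofReal_mul (by positivity)]
  congr 2; ring

def PM : Measure (T2) :=
  ((volume.restrict (Ioi (0:ℝ))).withDensity (fun s => ofReal (4 * π ^ 2 / s ^ 2))).prod volume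
def KM : Measure (T3) := (volume.restrict (Ioi (0:ℝ))).prod PM
def Psi (z : Phase) : T3 := (ellOf z, (‖z.1‖⁻¹, ‖z.1‖⁻¹ * inner ℝ z.1 z.2))
def zc (s w l : ℝ) : Phase := (s⁻¹ • e1, w • e1 + (√l * s) • e2)

instance : SFinite PM := by unfold PM; infer_instance
instance : SigmaFinite PM := by
  have : SigmaFinite ((volume.restrict (Ioi (0:ℝ))).withDensity (fun s => ofReal (4 * π ^ 2 / s ^ 2))) :=
    SigmaFinite.withDensity_ofReal _
  unfold PM; infer_instance
instance : SigmaFinite KM := by unfold KM; infer_instance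

lemma lint_PM (g : T2 → ℝ≥0∞) (hg : Measurable g) :
    ∫⁻ q, g q ∂PM = ∫⁻ s in Ioi (0:ℝ), ofReal (4 * π ^ 2 / s ^ 2) * ∫⁻ w, g (s, w) := by
  rw [PM, lintegral_prod _ hg.aemeasurable, lintegral_withDensity_eq_lintegral_mul _ (by fun_prop)
    hg.lintegral_prod_right']
  rfl

lemma lint_KM (g : T3 → ℝ≥0∞) (hg : Measurable g) :
    ∫⁻ q, g q ∂KM = ∫⁻ s in Ioi (0:ℝ), ofReal (4 * π ^ 2 / s ^ 2) *
      ∫⁻ w, ∫⁻ l in Ioi (0:ℝ), g (l, (s, w)) := by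
  rw [KM, lintegral_prod_symm _ hg.aemeasurable, lint_PM]
  exact (hg.comp measurable_swap).lintegral_prod_right'

lemma measurable_ellOf : Measurable ellOf := by unfold ellOf; fun_prop
lemma measurable_Psi : Measurable Psi :=
  measurable_ellOf.prodMk (by fun_prop)

lemma lint_scale (g : ℝ → ℝ≥0∞) (c : ℝ) (hc : 0 < c) :
    ∫⁻ τ in Ioi (0:ℝ), g (c * τ) = ofReal c⁻¹ * ∫⁻ l in Ioi (0:ℝ), g l := by
  have himg : (fun r : ℝ => c * r) '' Ioi 0 = Ioi 0 := by
    rw [Set.image_mul_left_Ioi hc, mul_zero]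
  have h := lintegral_image_eq_lintegral_abs_deriv_mul (s := Ioi (0:ℝ)) (f := fun r : ℝ => c * r)
    (f' := fun r => c) measurableSet_Ioi
    (fun x hx => by simpa using ((hasDerivAt_id x).const_mul c).hasDerivWithinAt)
    (fun a ha b hb hab => mul_left_cancel₀ hc.ne' hab) g
  rw [himg, lcmul, abs_of_pos hc] at h
  rw [h, ← mul_assoc, ← ofReal_mul (by positivity), inv_mul_cancel₀ hc.ne']
  simp

lemma ae_ne0 : ∀ᵐ z : Phase, z.1 ≠ 0 := by
  have : ∀ᵐ x : E3, x ≠ 0 := by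
    simp [ae_iff]
  exact Measure.quasiMeasurePreserving_fst.ae this

lemma lint_v (G : T3 → ℝ≥0∞) (hG : Measurable G) {x : E3} (hx : x ≠ 0) :
    ∫⁻ v : E3, G (Psi (x, v)) = ofReal (π * (‖x‖ ^ 2)⁻¹) *
      ∫⁻ w, ∫⁻ l in Ioi (0:ℝ), G (l, (‖x‖⁻¹, w)) := by
  have hxn : 0 < ‖x‖ := norm_pos_iff.2 hx
  have hv : ∀ v : E3, G (Psi (x, v)) = (fun w τ => G (‖x‖ ^ 2 * τ, (‖x‖⁻¹, w)))
      (inner ℝ (‖x‖⁻¹ • x) v) (‖v‖ ^ 2 - (inner ℝ (‖x‖⁻¹ • x) v) ^ 2) := by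
    intro v
    simp only [Psi, ellOf, real_inner_smul_left]
    congr 2
    field_simp
  rw [lintegral_congr hv, cyl (‖x‖⁻¹ • x) (by rw [norm_smul, norm_inv, norm_norm, inv_mul_cancel₀ hxn.ne'])
    (fun w τ => G (‖x‖ ^ 2 * τ, (‖x‖⁻¹, w))) (hG.comp (by fun_prop)),
    lintegral_congr (fun w => lint_scale (fun l => G (l, (‖x‖⁻¹, w))) (‖x‖ ^ 2) (by positivity)),
    lcmul, ← mul_assoc, ← ofReal_mul Real.pi_nonneg]

lemma meas_I (G : T3 → ℝ≥0∞) (hG : Measurable G) :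
    Measurable (fun s => ∫⁻ w, ∫⁻ l in Ioi (0:ℝ), G (l, (s, w))) := by
  have hm3 : Measurable (fun p : (T2) × ℝ => G (p.2, (p.1.1, p.1.2))) :=
    hG.comp (by fun_prop)
  have hm2 : Measurable (fun p : T2 => ∫⁻ l in Ioi (0:ℝ), G (l, (p.1, p.2))) :=
    hm3.lintegral_prod_right' (ν := volume.restrict (Ioi 0))
  exact hm2.lintegral_prod_right'

lemma ae_ne0' : ∀ᵐ x : E3, x ≠ 0 := by simp [ae_iff]

lemma lint_Psi (G : T3 → ℝ≥0∞) (hG : Measurable G) :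
    ∫⁻ z : Phase, G (Psi z) = ∫⁻ q, G q ∂KM := by
  rw [lint_KM G hG, Measure.volume_eq_prod, lintegral_prod (fun z => G (Psi z)) (hG.comp measurable_Psi).aemeasurable]
  have hIm := meas_I G hG
  rw [lintegral_congr_ae (ae_ne0'.mono fun x hx => lint_v G hG hx), lint_radial
    (fun r => ofReal (π * (r ^ 2)⁻¹) * ∫⁻ w, ∫⁻ l in Ioi (0:ℝ), G (l, (r⁻¹, w)))
    ((by fun_prop : Measurable fun r : ℝ => ofReal (π * (r ^ 2)⁻¹)).mul
      (hIm.comp measurable_inv)), lint_inv]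
  refine slcongr (fun s hs => ?_)
  have hs : (0:ℝ) < s := hs
  simp only [inv_inv]
  rw [← mul_assoc, ← mul_assoc, ← ofReal_mul (by positivity), ← ofReal_mul (by positivity)]
  congr 2; field_simp

lemma mp_Psi : MeasurePreserving Psi volume KM :=
  ⟨measurable_Psi, Measure.ext_of_lintegral _ (fun G hG => by
    rw [lintegral_map hG measurable_Psi, lint_Psi G hG])⟩


lemma exists_rot (u n : E3) (hu : ‖u‖ = 1) (hn : ‖n‖ = 1) (hun : (inner ℝ u n : ℝ) = 0) :
    ∃ R : E3 ≃ₗᵢ[ℝ] E3, LinearMap.det (R.toLinearEquiv : E3 →ₗ[ℝ] E3) = 1 ∧ R e1 = u ∧ R e2 = n := by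
  have ho : Orthonormal ℝ (({0, 1} : Set (Fin 3)).domRestrict ![u, n, 0]) := by
    constructor
    · rintro ⟨i, hi⟩
      rcases hi with rfl | rfl <;> simp [Set.domRestrict, hu, hn]
    · rintro ⟨i, hi⟩ ⟨j, hj⟩ hij
      rcases hi with rfl | rfl <;> rcases hj with rfl | rfl <;>
        simp_all [Set.domRestrict, real_inner_comm]
  obtain ⟨b, hb⟩ := ho.exists_orthonormalBasis_extension_of_card_eq (by simp)
  have hb0 : b 0 = u := hb 0 (by simp)
  have hb1 : b 1 = n := hb 1 (by simp)
  have hR1 : b.repr.symm e1 = u := by rw [← hb0, ← b.repr_symm_single]; rfl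
  have hR2 : b.repr.symm e2 = n := by rw [← hb1, ← b.repr_symm_single]; rfl
  set R : E3 ≃ₗᵢ[ℝ] E3 := b.repr.symm with hR
  have hdet : |LinearMap.det (R.toLinearEquiv : E3 →ₗ[ℝ] E3)| = 1 := by
    rw [← LinearMap.normDet_eq_abs_det]
    exact R.toLinearIsometry.normDet_eq_one
  rcases abs_eq (by norm_num : (0:ℝ) ≤ 1) |>.1 hdet with h | h
  · exact ⟨R, h, hR1, hR2⟩
  · set e3 : E3 := EuclideanSpace.single (2 : Fin 3) (1:ℝ) with he3
    have he30 : e3 ≠ 0 := by simp [he3]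
    set S := (ℝ ∙ e3)ᗮ.reflection with hS
    have hm1 : e1 ∈ (ℝ ∙ e3)ᗮ := by
      rw [Submodule.mem_orthogonal_singleton_iff_inner_right]
      simp [e1, he3, EuclideanSpace.inner_single_left]
    have hm2 : e2 ∈ (ℝ ∙ e3)ᗮ := by
      rw [Submodule.mem_orthogonal_singleton_iff_inner_right]
      simp [e2, he3, EuclideanSpace.inner_single_left]
    refine ⟨S.trans R, ?_, ?_, ?_⟩
    · have hd : LinearMap.det (S.toLinearEquiv : E3 →ₗ[ℝ] E3) = -1 := by
        have := (ℝ ∙ e3)ᗮ.det_reflection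
        rw [Submodule.orthogonal_orthogonal, finrank_span_singleton he30, pow_one] at this
        exact this
      have : ((S.trans R).toLinearEquiv : E3 →ₗ[ℝ] E3) =
          (R.toLinearEquiv : E3 →ₗ[ℝ] E3) ∘ₗ (S.toLinearEquiv : E3 →ₗ[ℝ] E3) := rfl
      rw [this, LinearMap.det_comp, h, hd]; norm_num
    · simp [hS, Submodule.reflection_mem_subspace_eq_self hm1, hR1]
    · simp [hS, Submodule.reflection_mem_subspace_eq_self hm2, hR2]

def red (f : Phase → ℝ) (q : T3) : ℝ := f (zc q.2.1 q.2.2 q.1)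

lemma ellOf_nonneg (z : Phase) : 0 ≤ ellOf z := by
  unfold ellOf
  have := abs_real_inner_le_norm z.1 z.2
  rw [← mul_pow, ← sq_abs (inner ℝ z.1 z.2), sub_nonneg]
  gcongr

lemma sph_red {f : Phase → ℝ} (hf : SphSym f) {z : Phase} (hz : z.1 ≠ 0) : f z = red f (Psi z) := by
  obtain ⟨x, v⟩ := z
  simp only at hz
  have hx : 0 < ‖x‖ := norm_pos_iff.2 hz
  set u := ‖x‖⁻¹ • x with hu
  have hun : ‖u‖ = 1 := by rw [hu, norm_smul, norm_inv, norm_norm, inv_mul_cancel₀ hx.ne']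
  set w := ‖x‖⁻¹ * (inner ℝ x v : ℝ) with hw
  have hwu : (inner ℝ u v : ℝ) = w := by rw [hu, real_inner_smul_left]
  set p := v - w • u with hp
  have hup : (inner ℝ u p : ℝ) = 0 := by
    rw [hp, inner_sub_right, real_inner_smul_right, hwu, real_inner_self_eq_norm_sq, hun]; ring
  have hpn : ‖p‖ = √(ellOf (x, v)) * ‖x‖⁻¹ := by
    have h1 : ‖p‖ ^ 2 = ‖v‖ ^ 2 - w ^ 2 := by
      rw [hp, norm_sub_sq_real, real_inner_smul_right, real_inner_comm, hwu, norm_smul, hun]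
      simp; ring
    have h2 : ‖p‖ = √(‖v‖ ^ 2 - w ^ 2) := by rw [← h1, Real.sqrt_sq (norm_nonneg _)]
    rw [h2, ← Real.sqrt_sq (inv_nonneg.2 hx.le), ← Real.sqrt_mul (ellOf_nonneg _)]
    congr 1
    simp only [ellOf, hw]; field_simp
  obtain ⟨n, hn, hun', hpn'⟩ : ∃ n : E3, ‖n‖ = 1 ∧ (inner ℝ u n : ℝ) = 0 ∧ p = ‖p‖ • n := by
    by_cases h0 : p = 0
    · obtain ⟨b, hb⟩ := exists_basis1 u hun
      refine ⟨b 1, b.norm_eq_one 1, ?_, by simp [h0]⟩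
      rw [← hb, b.inner_eq_zero (by decide)]
    · have : 0 < ‖p‖ := norm_pos_iff.2 h0
      refine ⟨‖p‖⁻¹ • p, by rw [norm_smul, norm_inv, norm_norm, inv_mul_cancel₀ this.ne'], ?_, ?_⟩
      · rw [real_inner_smul_right, hup, mul_zero]
      · rw [smul_smul, mul_inv_cancel₀ this.ne', one_smul]
  obtain ⟨R, hd, h1, h2⟩ := exists_rot u n hun hn hun'
  rw [red, ← hf R hd (zc _ _ _)]
  congr 1
  simp only [Psi, zc, map_smul, map_add, h1, h2, inv_inv]
  refine Prod.ext ?_ ?_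
  · simp [hu, smul_smul, mul_inv_cancel₀ hx.ne']
  · simp only
    rw [← hw, ← hpn, ← hpn', hp]; abel

lemma zc_v {s w l : ℝ} (hl : 0 ≤ l) : ‖(zc s w l).2‖ ^ 2 = w ^ 2 + l * s ^ 2 := by
  simp only [zc]
  rw [norm_add_sq_real, real_inner_smul_left, real_inner_smul_right, e12]
  simp [norm_smul, e1n, e2n, mul_pow, Real.sq_sqrt hl]

lemma Psi_zc {s w l : ℝ} (hs : 0 < s) (hl : 0 ≤ l) : Psi (zc s w l) = (l, (s, w)) := by
  have h1 : ‖(zc s w l).1‖ = s⁻¹ := by simp [zc, norm_smul, e1n, abs_of_pos hs]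
  have h2 : (inner ℝ (zc s w l).1 (zc s w l).2 : ℝ) = s⁻¹ * w := by
    simp [zc, inner_add_right, real_inner_smul_left, real_inner_smul_right, e12, e1n, mul_comm]
  simp only [Psi, ellOf, h1, h2, zc_v hl, inv_inv, Prod.mk.injEq, true_and]
  constructor <;> field_simp
  ring

lemma sph_red_ae {f : Phase → ℝ} (hf : SphSym f) : ∀ᵐ z : Phase, f z = red f (Psi z) :=
  ae_ne0.mono fun _ hz => sph_red hf hz

def kin (q : T3) : ℝ := q.2.2 ^ 2 + q.1 * q.2.1 ^ 2

lemma kin_Psi {z : Phase} (hz : z.1 ≠ 0) : kin (Psi z) = ‖z.2‖ ^ 2 := by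
  have hx : 0 < ‖z.1‖ := norm_pos_iff.2 hz
  simp only [kin, Psi, ellOf]; field_simp; ring

lemma measurable_red {f : Phase → ℝ} (hf : Measurable f) : Measurable (red f) := by
  unfold red zc; exact hf.comp (by fun_prop)


lemma newton_int (X R : ℝ) (hX : 0 < X) (hR : 0 < R) :
    ∫⁻ a in Ioo (-R) R, ofReal (√(X ^ 2 - 2 * X * a + R ^ 2))⁻¹ =
      ∫⁻ _a in Ioo (-R) R, ofReal (max X R)⁻¹ := by
  set Fn : ℝ → ℝ := fun a => -√(X ^ 2 - 2 * X * a + R ^ 2) / X with hFn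
  have hpos : ∀ a ∈ Ioo (-R) R, 0 < X ^ 2 - 2 * X * a + R ^ 2 := by
    intro a ha
    nlinarith [sq_nonneg (X - R), mul_pos hX (sub_pos.2 ha.2)]
  have hd : ∀ a ∈ Ioo (-R) R, HasDerivAt Fn ((√(X ^ 2 - 2 * X * a + R ^ 2))⁻¹) a := by
    intro a ha
    have h1 : HasDerivAt (fun a : ℝ => X ^ 2 - 2 * X * a + R ^ 2) (-(2 * X)) a := by
      simpa using (((hasDerivAt_id a).const_mul (2 * X)).const_sub (X ^ 2)).add_const (R ^ 2)
    have h2 := ((h1.sqrt (hpos a ha).ne').neg).div_const X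
    have h3 := Real.sqrt_pos.2 (hpos a ha)
    refine h2.congr_deriv ?_
    field_simp
  have hc : ContinuousOn Fn (Icc (-R) R) := by
    apply Continuous.continuousOn; simp only [hFn]; fun_prop
  have hint := intervalIntegral.integrableOn_deriv_of_nonneg hc hd (fun a _ => by positivity)
  have hval := intervalIntegral.integral_eq_sub_of_hasDerivAt_of_le (by linarith) hc hd
    ((intervalIntegrable_iff_integrableOn_Ioc_of_le (by linarith)).2 hint)
  rw [intervalIntegral.integral_of_le (by linarith), integral_Ioc_eq_integral_Ioo] at hval
  rw [← ofReal_integral_eq_lintegral_ofReal (hint.mono_set Ioo_subset_Ioc_self)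
    (Eventually.of_forall fun a => by positivity), hval, setLIntegral_const, Real.volume_Ioo,
    ← ofReal_mul (by positivity)]
  congr 1
  simp only [hFn]
  rw [show X ^ 2 - 2 * X * R + R ^ 2 = (X - R) ^ 2 by ring,
    show X ^ 2 - 2 * X * -R + R ^ 2 = (X + R) ^ 2 by ring, Real.sqrt_sq_eq_abs,
    Real.sqrt_sq (by positivity)]
  rcases le_total X R with h | h
  · rw [abs_of_nonpos (by linarith), max_eq_right h]; field_simp; ring
  · rw [abs_of_nonneg (by linarith), max_eq_left h]; field_simp; ring

lemma newton (g : ℝ → ℝ≥0∞) (hg : Measurable g) {x : E3} (hx : x ≠ 0) :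
    ∫⁻ y : E3, g ‖y‖ * ofReal ‖x - y‖⁻¹ =
      ∫⁻ y : E3, g ‖y‖ * ofReal (max ‖x‖ ‖y‖)⁻¹ := by
  have hxn : 0 < ‖x‖ := norm_pos_iff.2 hx
  have hu : ‖‖x‖⁻¹ • x‖ = 1 := by rw [norm_smul, norm_inv, norm_norm, inv_mul_cancel₀ hxn.ne']
  have h1 : ∀ y : E3, g ‖y‖ * ofReal ‖x - y‖⁻¹ =
      (fun a R => g R * ofReal (√(‖x‖ ^ 2 - 2 * ‖x‖ * a + R ^ 2))⁻¹)
        (inner ℝ (‖x‖⁻¹ • x) y) ‖y‖ := by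
    intro y
    simp only
    rw [real_inner_smul_left]
    have : ‖x‖ ^ 2 - 2 * ‖x‖ * (‖x‖⁻¹ * inner ℝ x y) + ‖y‖ ^ 2 = ‖x - y‖ ^ 2 := by
      rw [norm_sub_sq_real]; field_simp
    rw [this, Real.sqrt_sq (norm_nonneg _)]
  rw [lintegral_congr h1, shell (‖x‖⁻¹ • x) hu (fun a R => g R *
      ofReal (√(‖x‖ ^ 2 - 2 * ‖x‖ * a + R ^ 2))⁻¹) (by fun_prop),
    shell (‖x‖⁻¹ • x) hu (fun _ R => g R * ofReal (max ‖x‖ R)⁻¹) (by fun_prop)]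
  congr 1
  refine slcongr (fun R hR => ?_)
  rw [lintegral_const_mul _ (by fun_prop), newton_int _ _ hxn hR, lintegral_const_mul _ (by fun_prop)]

def pF (g : T3 → ℝ) (t : ℝ) : ℝ := (4 * π)⁻¹ * ∫ q in {q | t < q.2.1}, g q ∂KM

structure RF (g : T3 → ℝ) : Prop where
  meas : Measurable g
  nonneg : ∀ q, 0 ≤ g q
  int : Integrable g KM
  kint : Integrable (fun q => kin q * g q) KM

lemma kin_nonneg {q : T3} (h : 0 < q.1) : 0 ≤ kin q := by unfold kin; positivity
lemma measurable_kin : Measurable kin := by unfold kin; fun_prop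

lemma memErad_int {f : Phase → ℝ} (hf : memErad f) : Integrable f ∧
    Integrable (fun z : Phase => ‖z.2‖ ^ 2 * f z) := by
  obtain ⟨⟨hm, hn, hE⟩, hs⟩ := hf
  unfold eNormE at hE
  have h1 : eLpNorm f 1 volume < ⊤ := lt_of_le_of_lt (le_self_add.trans le_self_add) hE
  have h2 := lt_of_le_of_lt le_add_self hE
  refine ⟨memLp_one_iff_integrable.1 ⟨hm.aestronglyMeasurable, h1⟩, ?_⟩
  refine ⟨by fun_prop, ?_⟩
  refine lt_of_le_of_lt (le_of_eq ?_) h2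
  refine lintegral_congr fun z => ?_
  rw [enorm_mul, enorm_pow, enorm_norm]; rfl

lemma int_Psi {G : T3 → ℝ} (hG : Measurable G) :
    Integrable (fun z => G (Psi z)) ↔ Integrable G KM :=
  mp_Psi.integrable_comp hG.aestronglyMeasurable

lemma integral_Psi {G : T3 → ℝ} (hG : Measurable G) :
    ∫ z : Phase, G (Psi z) = ∫ q, G q ∂KM := by
  rw [← mp_Psi.map_eq, integral_map mp_Psi.measurable.aemeasurable hG.aestronglyMeasurable]

lemma kin_red_ae {f : Phase → ℝ} (hf : SphSym f) :
    ∀ᵐ z : Phase, ‖z.2‖ ^ 2 * f z = kin (Psi z) * red f (Psi z) :=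
  ae_ne0.mono fun z hz => by rw [← sph_red hf hz, kin_Psi hz]

lemma rf_red {f : Phase → ℝ} (hf : memErad f) : RF (red f) where
  meas := measurable_red hf.1.1
  nonneg := fun _ => hf.1.2.1 _
  int := (int_Psi (measurable_red hf.1.1)).1 ((memErad_int hf).1.congr (sph_red_ae hf.2))
  kint := (int_Psi (measurable_kin.mul (measurable_red hf.1.1))).1
    ((memErad_int hf).2.congr (kin_red_ae hf.2))

lemma kin_eq {f : Phase → ℝ} (hf : memErad f) : kineticE f = ∫ q, kin q * red f q ∂KM := by
  rw [kineticE, integral_congr_ae (kin_red_ae hf.2)]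
  exact integral_Psi (measurable_kin.mul (measurable_red hf.1.1))

lemma meas_half (t : ℝ) : MeasurableSet {q : T3 | t < q.2.1} :=
  measurableSet_lt measurable_const (by fun_prop)

lemma pF_ofReal {g} (hg : RF g) (t : ℝ) : ofReal (pF g t) =
    ofReal (4 * π)⁻¹ * ∫⁻ q, {q : T3 | t < q.2.1}.indicator
      (fun q => ofReal (g q)) q ∂KM := by
  rw [pF, ofReal_mul (by positivity), ofReal_integral_eq_lintegral_ofReal
    hg.int.integrableOn (Eventually.of_forall hg.nonneg), lintegral_indicator (meas_half t)]

lemma pF_nonneg {g} (hg : RF g) (t : ℝ) : 0 ≤ pF g t :=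
  mul_nonneg (by positivity) (integral_nonneg hg.nonneg)

lemma pF_anti {g} (hg : RF g) : Antitone (pF g) := by
  intro a b hab
  refine mul_le_mul_of_nonneg_left ?_ (by positivity)
  exact setIntegral_mono_set hg.int.integrableOn (Eventually.of_forall hg.nonneg)
    (Eventually.of_forall fun q hq => lt_of_le_of_lt hab hq)

lemma KM_slice (t : ℝ) : ∀ᵐ q ∂KM, q.2.1 ≠ t := by
  have h1 : ∀ᵐ s ∂((volume.restrict (Ioi (0:ℝ))).withDensity (fun s => ofReal (4 * π ^ 2 / s ^ 2))), s ≠ t := by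
    refine (withDensity_absolutelyContinuous _ _).ae_le ?_
    exact ae_restrict_of_ae (by simp [ae_iff])
  have h2 : ∀ᵐ q ∂PM, q.1 ≠ t := Measure.quasiMeasurePreserving_fst.ae h1
  exact Measure.quasiMeasurePreserving_snd.ae h2

lemma KM_pos : ∀ᵐ q ∂KM, 0 < q.1 ∧ 0 < q.2.1 := by
  have h1 : ∀ᵐ s ∂((volume.restrict (Ioi (0:ℝ))).withDensity (fun s => ofReal (4 * π ^ 2 / s ^ 2))), 0 < s := by
    refine (withDensity_absolutelyContinuous _ _).ae_le ?_
    exact ae_restrict_mem measurableSet_Ioi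
  have h2 : ∀ᵐ q ∂PM, 0 < q.1 := Measure.quasiMeasurePreserving_fst.ae h1
  have h3 : ∀ᵐ l ∂(volume.restrict (Ioi (0:ℝ))), 0 < l := ae_restrict_mem measurableSet_Ioi
  exact (Measure.quasiMeasurePreserving_fst.ae h3).and (Measure.quasiMeasurePreserving_snd.ae h2)

lemma pF_cont {g} (hg : RF g) : Continuous (pF g) := by
  have : pF g = fun t => (4 * π)⁻¹ * ∫ q, {q : T3 | t < q.2.1}.indicator g q ∂KM := by
    ext t; rw [pF, integral_indicator (meas_half t)]
  rw [this]
  refine continuous_const.mul (continuous_iff_continuousAt.2 fun t0 => ?_)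
  refine tendsto_integral_filter_of_dominated_convergence (fun q => g q)
    (Eventually.of_forall fun t => (hg.meas.indicator (meas_half t)).aestronglyMeasurable)
    (Eventually.of_forall fun t => Eventually.of_forall fun q => ?_) hg.int ?_
  · rw [Real.norm_of_nonneg (indicator_nonneg (fun q _ => hg.nonneg q) q)]
    exact indicator_le_self' (fun q _ => hg.nonneg q) q
  · filter_upwards [KM_slice t0] with q hq
    rcases lt_or_gt_of_ne hq with h | h
    · refine tendsto_const_nhds.congr' ?_
      filter_upwards [Ioi_mem_nhds h] with t ht
      rw [indicator_of_notMem (by exact not_lt.2 h.le), indicator_of_notMem (by exact not_lt.2 (le_of_lt (mem_Ioi.1 ht)))]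
    · refine tendsto_const_nhds.congr' ?_
      filter_upwards [Iio_mem_nhds h] with t ht
      rw [indicator_of_mem (by exact h), indicator_of_mem (by exact ht)]


lemma rho_ae {f : Phase → ℝ} (hf : memErad f) : ∀ᵐ y : E3, y ≠ 0 ∧ ofReal (rhoF f y) =
    ∫⁻ v : E3, ofReal (red f (Psi (y, v))) := by
  have h1 := (memErad_int hf).1
  rw [Measure.volume_eq_prod] at h1
  filter_upwards [h1.prod_right_ae, ae_ne0'] with y hy hy0
  refine ⟨hy0, ?_⟩
  rw [rhoF, ofReal_integral_eq_lintegral_ofReal hy (Eventually.of_forall fun v => hf.1.2.1 _)]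
  exact lintegral_congr fun v => by rw [sph_red hf.2 (z := (y, v)) hy0]

lemma pF_lint {g} (hg : RF g) {a : ℝ} (ha : 0 < a) :
    ∫⁻ q, ofReal (g q) * ofReal (min a q.2.1) ∂KM =
      ofReal (4 * π) * ofReal (∫ t in (0:ℝ)..a, pF g t) := by
  have h1 : ∀ᵐ q ∂KM, ofReal (g q) * ofReal (min a q.2.1) =
      ∫⁻ t in Ioc (0:ℝ) a, {q : T3 | t < q.2.1}.indicator (fun q => ofReal (g q)) q := by
    filter_upwards [KM_pos] with q hq
    have : ∀ t, {q : T3 | t < q.2.1}.indicator (fun q => ofReal (g q)) q =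
      (Iio q.2.1).indicator (fun _ => ofReal (g q)) t := by
      intro t; simp only [indicator_apply, mem_ofPred_eq, mem_Iio]
    rw [lintegral_congr this, lintegral_indicator measurableSet_Iio, Measure.restrict_restrict measurableSet_Iio,
      setLIntegral_const]
    congr 1
    rcases le_total a q.2.1 with h | h
    · rw [min_eq_left h]
      have : (Ioo 0 a : Set ℝ) ⊆ Iio q.2.1 ∩ Ioc 0 a := fun t ht =>
        ⟨lt_of_lt_of_le ht.2 h, ht.1, ht.2.le⟩
      apply le_antisymm
      · calc _ = volume (Ioo 0 a) := by rw [Real.volume_Ioo, sub_zero]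
          _ ≤ _ := measure_mono this
      · calc _ ≤ volume (Ioc 0 a) := measure_mono inter_subset_right
          _ = _ := by rw [Real.volume_Ioc, sub_zero]
    · rw [min_eq_right h]
      have : Iio q.2.1 ∩ Ioc 0 a = Ioo 0 q.2.1 := by
        ext t; simp only [mem_inter_iff, mem_Iio, mem_Ioc, mem_Ioo]
        exact ⟨fun ⟨x, y, z⟩ => ⟨y, x⟩, fun ⟨x, y⟩ => ⟨y, x, by linarith⟩⟩
      rw [this, Real.volume_Ioo, sub_zero]
  have hm : Measurable (fun p : (T3) × ℝ =>
      {q : T3 | p.2 < q.2.1}.indicator (fun q => ofReal (g q)) p.1) := by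
    have := ((hg.meas.comp measurable_fst).ennreal_ofReal).indicator
      (s := {p : (T3) × ℝ | p.2 < p.1.2.1}) (measurableSet_lt (by fun_prop) (by fun_prop))
    have e : (fun p : (T3) × ℝ =>
      {q : T3 | p.2 < q.2.1}.indicator (fun q => ofReal (g q)) p.1) =
      {p : (T3) × ℝ | p.2 < p.1.2.1}.indicator
        (fun x => ofReal ((g ∘ Prod.fst) x)) := by
      ext p; simp only [indicator_apply, mem_ofPred_eq, Function.comp]
    rw [e]; exact this
  rw [lintegral_congr_ae h1, lintegral_lintegral_swap hm.aemeasurable]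
  rw [intervalIntegral.integral_of_le ha.le, ofReal_integral_eq_lintegral_ofReal
    ((pF_cont hg).integrableOn_Icc.mono_set Ioc_subset_Icc_self)
    (Eventually.of_forall (pF_nonneg hg)), ← lcmul]
  refine lintegral_congr fun t => ?_
  rw [pF_ofReal hg, ← mul_assoc, ← ofReal_mul (by positivity), mul_inv_cancel₀ (by positivity)]
  simp

lemma phi_eq {f : Phase → ℝ} (hf : memErad f) {x : E3} (hx : x ≠ 0) :
    phiF f x = -∫ t in (0:ℝ)..‖x‖⁻¹, pF (red f) t := by
  have hg := rf_red hf
  have hxn : 0 < ‖x‖ := norm_pos_iff.2 hx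
  have hGm : Measurable (fun q => ofReal (red f q)) := hg.meas.ennreal_ofReal
  have hrm : Measurable (rhoF f) := by
    have : StronglyMeasurable (Function.uncurry fun x v => f (x, v)) := hf.1.1.stronglyMeasurable
    exact (this.integral_prod_right (ν := volume)).measurable
  have hr0 : ∀ y, 0 ≤ rhoF f y := fun y => integral_nonneg fun v => hf.1.2.1 _
  have key : ∫⁻ y, ofReal (rhoF f y / (4 * π * ‖x - y‖)) =
      ofReal (∫ t in (0:ℝ)..‖x‖⁻¹, pF (red f) t) := by
    set ϱ : ℝ → ℝ≥0∞ := fun r => ofReal (π * (r ^ 2)⁻¹) *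
      ∫⁻ w, ∫⁻ l in Ioi (0:ℝ), ofReal (red f (l, (r⁻¹, w))) with hϱ
    have hϱm : Measurable ϱ := (by fun_prop : Measurable fun r : ℝ => ofReal (π * (r ^ 2)⁻¹)).mul
      ((meas_I _ hGm).comp measurable_inv)
    have e1 : ∀ᵐ y : E3, ofReal (rhoF f y / (4 * π * ‖x - y‖)) =
        ofReal (4 * π)⁻¹ * (ϱ ‖y‖ * ofReal ‖x - y‖⁻¹) := by
      filter_upwards [rho_ae hf] with y hy
      have : ϱ ‖y‖ = ofReal (rhoF f y) := by
        rw [hy.2, lint_v _ hGm hy.1]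
      rw [this, ← ofReal_mul (hr0 y), ← ofReal_mul (by positivity)]
      congr 1; rw [div_eq_mul_inv, mul_inv]; ring
    have e2 : ∀ᵐ y : E3, ϱ ‖y‖ * ofReal (max ‖x‖ ‖y‖)⁻¹ =
        ∫⁻ v : E3, (fun q => ofReal (red f q) * ofReal (min ‖x‖⁻¹ q.2.1)) (Psi (y, v)) := by
      filter_upwards [ae_ne0'] with y hy
      have hyn : 0 < ‖y‖ := norm_pos_iff.2 hy
      have : (max ‖x‖ ‖y‖)⁻¹ = min ‖x‖⁻¹ ‖y‖⁻¹ := by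
        rcases le_total ‖x‖ ‖y‖ with h | h
        · rw [max_eq_right h, min_eq_right (by gcongr)]
        · rw [max_eq_left h, min_eq_left (by gcongr)]
      rw [this]
      simp only [Psi]
      rw [lintegral_mul_const' _ _ ofReal_ne_top]
      congr 1
      exact (lint_v _ hGm hy).symm
    rw [lintegral_congr_ae e1, lcmul, newton ϱ hϱm hx,
      lintegral_congr_ae e2, ← lintegral_prod (fun z : Phase => (fun q => ofReal (red f q) *
        ofReal (min ‖x‖⁻¹ q.2.1)) (Psi z)), ← Measure.volume_eq_prod, lint_Psi (fun q => ofReal (red f q) *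
        ofReal (min ‖x‖⁻¹ q.2.1)) (by fun_prop),
      pF_lint hg (by positivity), ← mul_assoc, ← ofReal_mul (by positivity),
      inv_mul_cancel₀ (by positivity)]
    · simp
    · exact (Measurable.comp (g := fun q => ofReal (red f q) *
        ofReal (min ‖x‖⁻¹ q.2.1)) (by fun_prop) measurable_Psi).aemeasurable
  rw [phiF, integral_eq_lintegral_of_nonneg_ae (Eventually.of_forall fun y => div_nonneg (hr0 y) (by positivity))
    (hrm.div (by fun_prop)).aestronglyMeasurable, key, toReal_ofReal]
  exact intervalIntegral.integral_nonneg (by positivity) fun t _ => pF_nonneg hg t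

lemma grad_eq {f : Phase → ℝ} (hf : memErad f) {x : E3} (hx : x ≠ 0) :
    gradPhi f x = (pF (red f) ‖x‖⁻¹ * (‖x‖ ^ 3)⁻¹) • x := by
  have hg := rf_red hf
  have hxn : 0 < ‖x‖ := norm_pos_iff.2 hx
  have h1 : HasDerivAt (fun s => -∫ t in (0:ℝ)..s, pF (red f) t) (-pF (red f) ‖x‖⁻¹) ‖x‖⁻¹ :=
    ((pF_cont hg).integral_hasStrictDerivAt 0 _).hasDerivAt.neg
  have h2 : HasFDerivAt (fun y : E3 => ‖y‖⁻¹) ((-(‖x‖ ^ 2)⁻¹) • (‖x‖⁻¹ • innerSL ℝ x)) x := by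
    have h3 := (hasStrictFDerivAt_norm_sq x).hasFDerivAt
    have h4 : HasFDerivAt (fun y : E3 => √(‖y‖ ^ 2)) _ x := h3.sqrt (by positivity)
    have h5 : HasFDerivAt (fun y : E3 => ‖y‖) (‖x‖⁻¹ • innerSL ℝ x) x := by
      have e : (fun y : E3 => √(‖y‖ ^ 2)) = fun y => ‖y‖ := by
        ext y; rw [Real.sqrt_sq (norm_nonneg _)]
      rw [e] at h4
      refine h4.congr_fderiv ?_
      rw [Real.sqrt_sq hxn.le]
      ext v; simp; field_simp
    exact (hasDerivAt_inv hxn.ne').comp_hasFDerivAt x h5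
  have h3 : HasFDerivAt (fun y : E3 => -∫ t in (0:ℝ)..‖y‖⁻¹, pF (red f) t) _ x :=
    HasDerivAt.comp_hasFDerivAt (h₂ := fun s => -∫ t in (0:ℝ)..s, pF (red f) t) x h1 h2
  have h4 : HasFDerivAt (phiF f) _ x := h3.congr_of_eventuallyEq (by
    filter_upwards [isOpen_ne.mem_nhds hx] with y hy
    exact phi_eq hf hy)
  rw [gradPhi]
  refine HasGradientAt.gradient ?_
  rw [hasGradientAt_iff_hasFDerivAt]
  refine h4.congr_fderiv ?_
  ext v; simp [real_inner_smul_left]; field_simp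

lemma field_int {f g : Phase → ℝ} (hf : memErad f) (hg : memErad g) :
    ∫ x : E3, ‖gradPhi f x - gradPhi g x‖ ^ 2 =
      (∫⁻ s in Ioi (0:ℝ), ofReal (4 * π * (pF (red f) s - pF (red g) s) ^ 2)).toReal ∧
    ∫ x : E3, ‖gradPhi f x‖ ^ 2 =
      (∫⁻ s in Ioi (0:ℝ), ofReal (4 * π * (pF (red f) s) ^ 2)).toReal := by
  have hcf := pF_cont (rf_red hf)
  have hcg := pF_cont (rf_red hg)
  have main : ∀ (p : ℝ → ℝ) (hp : Continuous p) (G : E3 → E3)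
      (hG : ∀ x, x ≠ 0 → G x = (p ‖x‖⁻¹ * (‖x‖ ^ 3)⁻¹) • x),
      ∫ x : E3, ‖G x‖ ^ 2 = (∫⁻ s in Ioi (0:ℝ), ofReal (4 * π * (p s) ^ 2)).toReal := by
    intro p hp G hG
    have h1 : ∀ᵐ x : E3, ‖G x‖ ^ 2 = (fun r => (p r⁻¹) ^ 2 * (r ^ 4)⁻¹) ‖x‖ := by
      filter_upwards [ae_ne0'] with x hx
      have hxn : 0 < ‖x‖ := norm_pos_iff.2 hx
      rw [hG x hx, norm_smul, mul_pow, Real.norm_eq_abs, sq_abs]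
      field_simp
    have hm : Measurable (fun r : ℝ => (p r⁻¹) ^ 2 * (r ^ 4)⁻¹) := by
      have := hp.measurable.comp measurable_inv
      exact (this.pow_const 2).mul (by fun_prop)
    rw [integral_congr_ae h1, integral_eq_lintegral_of_nonneg_ae
      (f := fun x : E3 => (fun r => (p r⁻¹) ^ 2 * (r ^ 4)⁻¹) ‖x‖)
      (Eventually.of_forall fun x => by positivity) (hm.comp measurable_norm).aestronglyMeasurable,
      lint_radial (fun r => ofReal ((p r⁻¹) ^ 2 * (r ^ 4)⁻¹)) hm.ennreal_ofReal, lint_inv]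
    congr 1
    refine slcongr (fun s hs => ?_)
    have hs : (0:ℝ) < s := hs
    simp only [inv_inv]
    rw [← ofReal_mul (by positivity), ← ofReal_mul (by positivity)]
    congr 1; field_simp
  refine ⟨main (fun s => pF (red f) s - pF (red g) s) (hcf.sub hcg) _ fun x hx => ?_, main _ hcf _ fun x hx => grad_eq hf hx⟩
  rw [grad_eq hf hx, grad_eq hg hx, ← sub_smul, ← sub_mul]


lemma lint_inv_sq {S : ℝ} (hS : 0 < S) : ∫⁻ s in Ioi S, ofReal (s ^ 2)⁻¹ = ofReal S⁻¹ := by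
  have h := lint_inv (Iio S⁻¹ |>.indicator 1)
  rw [lintegral_indicator_one measurableSet_Iio, Measure.restrict_apply measurableSet_Iio, inter_comm,
    Ioi_inter_Iio, Real.volume_Ioo, sub_zero] at h
  rw [h]
  have : Ioi S = Ioi S ∩ Ioi 0 := by rw [Ioi_inter_Ioi, max_eq_left hS.le]
  rw [this, ← setLIntegral_indicator measurableSet_Ioi]
  refine slcongr fun s hs => ?_
  have hs : 0 < s := hs
  by_cases h : S < s
  · rw [indicator_of_mem (by exact h), indicator_of_mem (by rw [mem_Iio]; gcongr)]; simp
  · rw [indicator_of_notMem (by exact h), indicator_of_notMem]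
    · simp
    · rw [mem_Iio, not_lt]; push Not at h; gcongr

lemma KM_box {S : ℝ} (hS : 0 < S) : ∫⁻ q, {q : T3 | S < q.2.1 ∧ kin q ≤ q.2.1}.indicator
    (fun q => ofReal √q.2.1) q ∂KM ≤ ofReal (8 * π ^ 2 / S) := by
  have hms : MeasurableSet {q : T3 | S < q.2.1 ∧ kin q ≤ q.2.1} :=
    (meas_half S).inter (measurableSet_le measurable_kin (by fun_prop))
  rw [lint_KM _ (Measurable.indicator (by fun_prop) hms)]
  calc _ ≤ ∫⁻ s in Ioi (0:ℝ), (Ioi S).indicator (fun s => ofReal (8 * π ^ 2) * ofReal (s ^ 2)⁻¹) s := ?_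
    _ = _ := by
      rw [setLIntegral_indicator measurableSet_Ioi, Ioi_inter_Ioi, max_eq_left hS.le,
        lcmul, lint_inv_sq hS, ← ofReal_mul (by positivity),
        div_eq_mul_inv]
  refine setLIntegral_mono' measurableSet_Ioi fun s hs => ?_
  have hs : 0 < s := hs
  by_cases h : S < s
  · rw [indicator_of_mem (by exact h)]
    calc _ ≤ ofReal (4 * π ^ 2 / s ^ 2) * ∫⁻ w, (Icc (-√s) √s).indicator
          (fun _ => ∫⁻ l in Ioi (0:ℝ), (Iic s⁻¹).indicator (fun _ => ofReal √s) l) w := by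
          gcongr with w
          by_cases hw : w ∈ Icc (-√s) √s
          · rw [indicator_of_mem hw]
            refine setLIntegral_mono' measurableSet_Ioi fun l hl => ?_
            have hl : 0 < l := hl
            by_cases h2 : kin (l, (s, w)) ≤ s
            · rw [indicator_of_mem (by exact ⟨h, h2⟩), indicator_of_mem]
              rw [mem_Iic, le_inv_comm₀ hl hs]
              unfold kin at h2; simp only at h2
              rw [le_inv_comm₀ hs hl, ← one_div, le_div_iff₀ hs]
              nlinarith [sq_nonneg w]
            · rw [indicator_of_notMem (by exact fun h => h2 h.2)]; exact zero_le
          · rw [indicator_of_notMem hw, nonpos_iff_eq_zero]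
            refine setLIntegral_eq_zero measurableSet_Ioi fun l hl => ?_
            have hl : 0 < l := hl
            refine indicator_of_notMem (fun h2 => hw ?_) _
            have h2 := h2.2
            unfold kin at h2; simp only at h2
            exact abs_le.1 (Real.abs_le_sqrt (by nlinarith [sq_nonneg s, mul_pos hl (pow_pos hs 2)]))
      _ = _ := by
          rw [lintegral_indicator measurableSet_Icc, setLIntegral_const, Real.volume_Icc,
            setLIntegral_indicator measurableSet_Iic, inter_comm, Ioi_inter_Iic, setLIntegral_const, Real.volume_Ioc,
            ← ofReal_mul (by positivity), ← ofReal_mul (mul_nonneg (by positivity) (by rw [sub_zero]; positivity)),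
            ← ofReal_mul (by positivity), ← ofReal_mul (by positivity)]
          congr 1
          have := Real.mul_self_sqrt hs.le
          field_simp
          linear_combination 8 * this
  · rw [indicator_of_notMem (by exact h), nonpos_iff_eq_zero, mul_eq_zero]
    right
    refine (lintegral_congr fun w => ?_).trans lintegral_zero
    exact (lintegral_congr fun l => indicator_of_notMem (fun h2 => h h2.1) _).trans lintegral_zero

structure RM (g : T3 → ℝ) (M : ℝ) : Prop extends RF g where
  M0 : 0 ≤ M
  le : ∀ᵐ q ∂KM, g q ≤ M

lemma tail_lint {g M} (hg : RM g M) {S : ℝ} (hS : 0 < S) :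
    ∫⁻ q, {q : T3 | S < q.2.1}.indicator (fun q => ofReal (√q.2.1 * g q)) q ∂KM ≤
      ofReal (8 * π ^ 2 * M / S + (∫ q, kin q * g q ∂KM) / √S) := by
  have hms : MeasurableSet {q : T3 | S < q.2.1 ∧ kin q ≤ q.2.1} :=
    (meas_half S).inter (measurableSet_le measurable_kin (by fun_prop))
  have hk0 : 0 ≤ᵐ[KM] fun q => kin q * g q := by
    filter_upwards [KM_pos] with q hq using mul_nonneg (kin_nonneg hq.1) (hg.nonneg q)
  calc _ ≤ ∫⁻ q, (ofReal M * {q : T3 | S < q.2.1 ∧ kin q ≤ q.2.1}.indicator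
        (fun q => ofReal √q.2.1) q + ofReal (√S)⁻¹ * ofReal (kin q * g q)) ∂KM := by
        refine lintegral_mono_ae ?_
        filter_upwards [KM_pos, hg.le] with q hq hM
        by_cases h : S < q.2.1
        · rw [indicator_of_mem (by exact h)]
          by_cases h2 : kin q ≤ q.2.1
          · rw [indicator_of_mem (by exact ⟨h, h2⟩), mul_comm √_, ofReal_mul (hg.nonneg q)]
            exact le_add_right (by gcongr)
          · refine le_add_left ?_
            rw [← ofReal_mul (by positivity)]
            refine ofReal_le_ofReal ?_
            rw [← mul_assoc]
            refine mul_le_mul_of_nonneg_right ?_ (hg.nonneg q)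
            have h3 : √S ≤ √q.2.1 := Real.sqrt_le_sqrt h.le
            have h4 := Real.sqrt_pos.2 hS
            rw [inv_mul_eq_div, le_div_iff₀ h4]
            push Not at h2
            nlinarith [Real.mul_self_sqrt hq.2.le]
        · rw [indicator_of_notMem (by exact h)]; exact zero_le
    _ = ofReal M * (∫⁻ q, {q : T3 | S < q.2.1 ∧ kin q ≤ q.2.1}.indicator
        (fun q => ofReal √q.2.1) q ∂KM) + ofReal (√S)⁻¹ * ofReal (∫ q, kin q * g q ∂KM) := by
        rw [lintegral_add_left ((Measurable.indicator (by fun_prop) hms).const_mul _),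
          lcmul, lcmul,
          ofReal_integral_eq_lintegral_ofReal hg.kint hk0]
    _ ≤ ofReal M * ofReal (8 * π ^ 2 / S) + ofReal (√S)⁻¹ * ofReal (∫ q, kin q * g q ∂KM) := by
        gcongr; exact KM_box hS
    _ = _ := by
        have h0 := hg.M0
        have := integral_nonneg_of_ae hk0
        rw [← ofReal_mul hg.M0, ← ofReal_mul (by positivity), ← ofReal_add (by positivity) (by positivity)]
        congr 1; ring

lemma pF_decay {g M} (hg : RM g M) {t : ℝ} (ht : 1 ≤ t) :
    pF g t ≤ (8 * π ^ 2 * M + ∫ q, kin q * g q ∂KM) / t := by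
  have hk : 0 ≤ ∫ q, kin q * g q ∂KM := integral_nonneg_of_ae (by
    filter_upwards [KM_pos] with q hq using mul_nonneg (kin_nonneg hq.1) (hg.nonneg q))
  have t0 : 0 < t := by linarith
  have hs1 : 1 ≤ √t := Real.one_le_sqrt.2 ht
  have hM := hg.M0
  have h1 : ofReal (pF g t) ≤ ofReal ((8 * π ^ 2 * M + ∫ q, kin q * g q ∂KM) / t) := by
    calc _ ≤ ofReal (4 * π)⁻¹ * ∫⁻ q, ofReal (√t)⁻¹ * {q : T3 | t < q.2.1}.indicator
          (fun q => ofReal (√q.2.1 * g q)) q ∂KM := by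
          rw [pF_ofReal hg.toRF]
          gcongr with q
          by_cases h : t < q.2.1
          · rw [indicator_of_mem (by exact h), indicator_of_mem (by exact h), ← ofReal_mul (by positivity)]
            refine ofReal_le_ofReal ?_
            rw [← mul_assoc]
            refine le_mul_of_one_le_left (hg.nonneg q) ?_
            rw [inv_mul_eq_div, one_le_div (by positivity)]
            exact Real.sqrt_le_sqrt h.le
          · rw [indicator_of_notMem (by exact h)]; exact zero_le
      _ ≤ ofReal (4 * π)⁻¹ * (ofReal (√t)⁻¹ *
          ofReal (8 * π ^ 2 * M / t + (∫ q, kin q * g q ∂KM) / √t)) := by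
          rw [lcmul]
          gcongr; exact tail_lint hg t0
      _ ≤ _ := by
          rw [← ofReal_mul (by positivity), ← ofReal_mul (by positivity)]
          refine ofReal_le_ofReal ?_
          have e : (√t)⁻¹ * (8 * π ^ 2 * M / t + (∫ q, kin q * g q ∂KM) / √t) ≤
              (8 * π ^ 2 * M + ∫ q, kin q * g q ∂KM) / t := by
            have e2 : (√t)⁻¹ * ((∫ q, kin q * g q ∂KM) / √t) = (∫ q, kin q * g q ∂KM) / t := by
              rw [inv_mul_eq_div, div_div, Real.mul_self_sqrt t0.le]
            rw [mul_add, e2, add_div]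
            gcongr
            exact mul_le_of_le_one_left (by positivity) (inv_le_one_of_one_le₀ hs1)
          refine (mul_le_of_le_one_left (by positivity) ?_).trans e
          exact inv_le_one_of_one_le₀ (by nlinarith [Real.pi_gt_three])
  exact (ofReal_le_ofReal_iff (by positivity)).1 h1

lemma p2_int {g M} (hg : RM g M) : IntegrableOn (fun t => pF g t ^ 2) (Ioi 0) := by
  have hc := pF_cont hg.toRF
  rw [← Ioc_union_Ioi_eq_Ioi zero_le_one]
  refine IntegrableOn.union ((hc.pow 2).integrableOn_Icc.mono_set Ioc_subset_Icc_self) ?_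
  set C := (8 * π ^ 2 * M + ∫ q, kin q * g q ∂KM)
  have h1 : IntegrableOn (fun t : ℝ => C ^ 2 * t ^ (-2 : ℝ)) (Ioi 1) :=
    (integrableOn_Ioi_rpow_of_lt (by norm_num) zero_lt_one).const_mul _
  refine Integrable.mono' h1 (hc.pow 2).aestronglyMeasurable ?_
  filter_upwards [ae_restrict_mem measurableSet_Ioi] with t ht
  have ht : 1 < t := ht
  have h2 := pF_decay hg ht.le
  rw [Real.norm_of_nonneg (by positivity), Real.rpow_neg (by linarith), Real.rpow_two, ← div_eq_mul_inv, ← div_pow]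
  exact pow_le_pow_left₀ (pF_nonneg hg.toRF t) h2 2

lemma pp_int {g M g' M'} (hg : RM g M) (hg' : RM g' M') :
    IntegrableOn (fun t => pF g t * pF g' t) (Ioi 0) := by
  refine Integrable.mono' ((p2_int hg).add (p2_int hg'))
    ((pF_cont hg.toRF).mul (pF_cont hg'.toRF)).aestronglyMeasurable (Eventually.of_forall fun t => ?_)
  rw [Real.norm_of_nonneg (mul_nonneg (pF_nonneg hg.toRF t) (pF_nonneg hg'.toRF t)), Pi.add_apply]
  nlinarith [sq_nonneg (pF g t - pF g' t), sq_nonneg (pF g t + pF g' t)]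

def UF (g : T3 → ℝ) (s : ℝ) : ℝ := ∫ t in (0:ℝ)..s, pF g t

lemma UF_deriv {g} (hg : RF g) (s : ℝ) : HasDerivAt (UF g) (pF g s) s :=
  ((pF_cont hg).integral_hasStrictDerivAt 0 _).hasDerivAt
lemma UF_cont {g} (hg : RF g) : Continuous (UF g) :=
  continuous_iff_continuousAt.2 fun s => (UF_deriv hg s).continuousAt
lemma UF_nonneg {g} (hg : RF g) {s : ℝ} (hs : 0 ≤ s) : 0 ≤ UF g s :=
  intervalIntegral.integral_nonneg hs fun t _ => pF_nonneg hg t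

lemma U_int {g M g' M'} (hg : RM g M) (hg' : RM g' M') :
    Integrable (fun q : T3 => UF g q.2.1 * g' q) KM ∧
    ∫ q, UF g q.2.1 * g' q ∂KM = 4 * π * ∫ t in Ioi 0, pF g t * pF g' t := by
  have hc := pF_cont hg.toRF
  have hm : Measurable (fun q : T3 => UF g q.2.1 * g' q) :=
    ((UF_cont hg.toRF).measurable.comp (by fun_prop)).mul hg'.meas
  have hn : 0 ≤ᵐ[KM] fun q : T3 => UF g q.2.1 * g' q := by
    filter_upwards [KM_pos] with q hq using mul_nonneg (UF_nonneg hg.toRF hq.2.le) (hg'.nonneg q)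
  have hI0 : 0 ≤ ∫ t in Ioi 0, pF g t * pF g' t :=
    integral_nonneg fun t => mul_nonneg (pF_nonneg hg.toRF t) (pF_nonneg hg'.toRF t)
  have key : ∫⁻ q, ofReal (UF g q.2.1 * g' q) ∂KM =
      ofReal (4 * π * ∫ t in Ioi 0, pF g t * pF g' t) := by
    have h1 : ∀ᵐ q ∂KM, ofReal (UF g q.2.1 * g' q) = ∫⁻ t in Ioi (0:ℝ),
        {p : (T3) × ℝ | p.2 < p.1.2.1}.indicator
          (fun p => ofReal (pF g p.2) * ofReal (g' p.1)) (q, t) := by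
      filter_upwards [KM_pos] with q hq
      rw [mul_comm, ofReal_mul (hg'.nonneg q), UF, intervalIntegral.integral_of_le hq.2.le,
        integral_Ioc_eq_integral_Ioo, ofReal_integral_eq_lintegral_ofReal
          (hc.integrableOn_Icc.mono_set Ioo_subset_Icc_self) (Eventually.of_forall (pF_nonneg hg.toRF)),
        ← lcmul, ← Ioi_inter_Iio, inter_comm,
        ← setLIntegral_indicator measurableSet_Iio]
      refine lintegral_congr fun t => ?_
      simp only [indicator_apply, mem_ofPred_eq, mem_Iio, mul_comm]
    have hmm : Measurable ({p : (T3) × ℝ | p.2 < p.1.2.1}.indicator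
          (fun p => ofReal (pF g p.2) * ofReal (g' p.1))) :=
      Measurable.indicator (((hc.measurable.comp measurable_snd).ennreal_ofReal).mul
        ((hg'.meas.comp measurable_fst).ennreal_ofReal)) (measurableSet_lt (by fun_prop) (by fun_prop))
    rw [lintegral_congr_ae h1, lintegral_lintegral_swap (f := fun q t => {p : (T3) × ℝ | p.2 < p.1.2.1}.indicator
          (fun p => ofReal (pF g p.2) * ofReal (g' p.1)) (q, t)) hmm.aemeasurable, ofReal_mul (by positivity),
      ofReal_integral_eq_lintegral_ofReal (pp_int hg hg') (Eventually.of_forall fun t =>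
        mul_nonneg (pF_nonneg hg.toRF t) (pF_nonneg hg'.toRF t)), ← lcmul]
    refine lintegral_congr fun t => ?_
    rw [ofReal_mul (pF_nonneg hg.toRF t), pF_ofReal hg'.toRF,
      mul_left_comm (ofReal (pF g t)), ← mul_assoc (ofReal (4 * π)), ← ofReal_mul (by positivity),
      mul_inv_cancel₀ (by positivity), ENNReal.ofReal_one, one_mul, ← lcmul]
    refine lintegral_congr fun q => ?_
    simp only [indicator_apply, mem_ofPred_eq, mul_ite, mul_zero]
  constructor
  · refine ⟨hm.aestronglyMeasurable, ?_⟩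
    rw [hasFiniteIntegral_iff_ofReal hn, key]; exact ofReal_lt_top
  · rw [integral_eq_lintegral_of_nonneg_ae hn hm.aestronglyMeasurable, key, toReal_ofReal (by positivity)]


lemma lint_hyp (k : ℝ → ℝ≥0∞) {c : ℝ} (hc : 0 < c) :
    ∫⁻ u in Ioi c, ofReal (u / √(u ^ 2 - c ^ 2)) * k (√(u ^ 2 - c ^ 2)) = ∫⁻ w in Ioi (0:ℝ), k w := by
  have hp : ∀ u ∈ Ioi c, 0 < u ^ 2 - c ^ 2 := fun u hu => by
    have : c < u := hu
    nlinarith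
  have himg : (fun u : ℝ => √(u ^ 2 - c ^ 2)) '' Ioi c = Ioi 0 := by
    ext y
    simp only [mem_image, mem_Ioi]
    constructor
    · rintro ⟨u, hu, rfl⟩; exact Real.sqrt_pos.2 (hp u hu)
    · intro hy
      refine ⟨√(y ^ 2 + c ^ 2), Real.lt_sqrt_of_sq_lt (by nlinarith), ?_⟩
      rw [Real.sq_sqrt (by positivity), add_sub_cancel_right, Real.sqrt_sq hy.le]
  rw [← himg, lintegral_image_eq_lintegral_abs_deriv_mul (f' := fun u => u / √(u ^ 2 - c ^ 2)) measurableSet_Ioi]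
  · refine slcongr fun u hu => ?_
    have : c < u := hu
    simp only [abs_of_nonneg (div_nonneg (hc.trans this).le (Real.sqrt_nonneg _))]
  · intro u hu
    have h1 : HasDerivAt (fun u : ℝ => u ^ 2 - c ^ 2) (2 * u) u := by
      simpa using (hasDerivAt_pow 2 u).sub_const (c ^ 2)
    refine (h1.sqrt (hp u hu).ne').hasDerivWithinAt.congr_deriv ?_
    rw [mul_div_mul_left _ _ two_ne_zero]
  · intro u hu v hv h
    have h2 := congrArg (· ^ 2) h
    simp only [Real.sq_sqrt (hp u hu).le, Real.sq_sqrt (hp v hv).le] at h2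
    have : u ^ 2 = v ^ 2 := by linarith
    exact (pow_left_inj₀ (hc.trans hu).le (hc.trans hv).le two_ne_zero).1 this

lemma lint_split (k : ℝ → ℝ≥0∞) : ∫⁻ w, k w = (∫⁻ w in Ioi (0:ℝ), k w) + ∫⁻ w in Ioi (0:ℝ), k (-w) := by
  have h1 : ∫⁻ w in Ioi (0:ℝ), k (-w) = ∫⁻ w in Iio (0:ℝ), k w := by
    have := lintegral_image_eq_lintegral_abs_deriv_mul (s := Ioi (0:ℝ)) (f := fun w : ℝ => -w) (f' := fun _ => -1)
      measurableSet_Ioi (fun x _ => (hasDerivAt_neg x).hasDerivWithinAt) neg_injective.injOn k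
    simpa using this.symm
  rw [h1, ← lintegral_add_compl k measurableSet_Ioi, compl_Ioi, setLIntegral_congr Iio_ae_eq_Iic]

lemma rad_zc (r u l : ℝ) : radPoint r u l = zc r⁻¹ (Real.sign u * √(r ^ 2 * u ^ 2 - l) / r) l := by
  simp only [radPoint, zc, inv_inv, e1, e2, div_eq_mul_inv]

lemma meas_sign : Measurable Real.sign := by
  unfold Real.sign
  exact Measurable.ite measurableSet_Iio measurable_const
    (Measurable.ite measurableSet_Ioi measurable_const measurable_const)

lemma mu_eq {f : Phase → ℝ} (hf : Measurable f) {l : ℝ} (hl : 0 < l) (σ : ℝ) :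
    muDist f σ l = PM {p | σ < red f (l, p)} := by
  have hrm := measurable_red hf
  have hA : MeasurableSet {p : T2 | σ < red f (l, p)} :=
    measurableSet_lt measurable_const (hrm.comp (by fun_prop))
  set G : T2 → ℝ≥0∞ := {p : T2 | σ < red f (l, p)}.indicator 1 with hG
  have hGm : Measurable G := measurable_one.indicator hA
  have hm1 : Measurable fun p : T2 => ((p.1⁻¹, Real.sign p.2 * √(p.1 ^ 2 * p.2 ^ 2 - l) / p.1) : T2) := by
    refine (by fun_prop : Measurable fun p : T2 => p.1⁻¹).prodMk ?_
    exact ((meas_sign.comp measurable_snd).mul (by fun_prop)).div measurable_fst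
  have hd : Measurable (nuDens l) := by
    unfold nuDens
    refine Measurable.ite ((measurableSet_lt measurable_const measurable_fst).inter
      (measurableSet_lt measurable_const (by fun_prop : Measurable fun p : T2 => p.1 ^ 2 * p.2 ^ 2))) ?_ measurable_const
    exact (by fun_prop : Measurable fun p : T2 => ofReal (4 * π ^ 2 * p.1 * |p.2| / √(p.1 ^ 2 * p.2 ^ 2 - l)))
  have hB : {p : T2 | σ < f (radPoint p.1 p.2 l)} =
      (fun p : T2 => ((p.1⁻¹, Real.sign p.2 * √(p.1 ^ 2 * p.2 ^ 2 - l) / p.1) : T2)) ⁻¹'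
        {p : T2 | σ < red f (l, p)} := by
    ext p; simp only [mem_ofPred_eq, mem_preimage, rad_zc, red]
  rw [muDist, hB, nuMeas, withDensity_apply _ (hm1 hA), ← lintegral_indicator (hm1 hA),
    ← lintegral_indicator_one hA, ← hG, lint_PM G hGm, Measure.volume_eq_prod, lintegral_prod _
      (hd.indicator (hm1 hA)).aemeasurable]
  have hz : ∀ r : ℝ, r ∉ Ioi (0:ℝ) → ∫⁻ u, (((fun p : T2 => ((p.1⁻¹, Real.sign p.2 * √(p.1 ^ 2 * p.2 ^ 2 - l) / p.1) : T2)) ⁻¹'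
        {p : T2 | σ < red f (l, p)}).indicator (nuDens l) (r, u)) = 0 := by
    intro r hr
    refine (lintegral_congr fun u => ?_).trans lintegral_zero
    have h0 : nuDens l (r, u) = 0 := if_neg fun h => hr h.1
    exact indicator_apply_eq_zero.2 fun _ => h0
  rw [← setLIntegral_eq_of_support_subset (s := Ioi (0:ℝ)), lint_inv]
  · refine slcongr fun s hs => ?_
    have hs : 0 < s := hs
    have hc : 0 < √l * s := by positivity
    have e4 : ofReal (4 * π ^ 2 / s ^ 2) = ofReal (s ^ 2)⁻¹ * ofReal (4 * π ^ 2) := by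
      rw [← ofReal_mul (by positivity)]; congr 1; ring
    rw [e4, mul_assoc]
    congr 1
    rw [lint_split, lint_split (fun w => G (s, w)), mul_add]
    have key : ∀ ε : ℝ, (ε = 1 ∨ ε = -1) → ∫⁻ u in Ioi (0:ℝ), (((fun p : T2 => ((p.1⁻¹, Real.sign p.2 *
        √(p.1 ^ 2 * p.2 ^ 2 - l) / p.1) : T2)) ⁻¹' {p : T2 | σ < red f (l, p)}).indicator (nuDens l) (s⁻¹, ε * u)) =
        ofReal (4 * π ^ 2) * ∫⁻ w in Ioi (0:ℝ), G (s, ε * w) := by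
      intro ε hε
      have hε2 : ε ^ 2 = 1 := by rcases hε with rfl | rfl <;> norm_num
      have hεa : |ε| = 1 := by rcases hε with rfl | rfl <;> norm_num
      rw [← lint_hyp (fun w => G (s, ε * w)) hc, ← lcmul]
      have hI : Ioi (√l * s) = Ioi (√l * s) ∩ Ioi 0 := by rw [Ioi_inter_Ioi, max_eq_left hc.le]
      rw [hI, ← setLIntegral_indicator measurableSet_Ioi]
      refine slcongr fun u hu => ?_
      have hu : 0 < u := hu
      have hsg : Real.sign (ε * u) = ε := by
        rcases hε with rfl | rfl
        · rw [one_mul, Real.sign_of_pos hu]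
        · rw [Real.sign_of_neg (by linarith)]
      have hcond : (0 < s⁻¹ ∧ l < s⁻¹ ^ 2 * (ε * u) ^ 2) ↔ √l * s < u := by
        rw [and_iff_right (by positivity), mul_pow, hε2, one_mul, inv_pow, inv_mul_eq_div, lt_div_iff₀ (by positivity),
          ← Real.sqrt_lt_sqrt_iff (by positivity), Real.sqrt_mul hl.le, Real.sqrt_sq hs.le, Real.sqrt_sq hu.le]
      have hsq : √(s⁻¹ ^ 2 * (ε * u) ^ 2 - l) = √(u ^ 2 - (√l * s) ^ 2) * s⁻¹ := by
        rw [mul_pow, hε2, one_mul, mul_pow, Real.sq_sqrt hl.le, ← Real.sqrt_sq (inv_nonneg.2 hs.le),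
          ← Real.sqrt_mul' _ (by positivity), Real.sqrt_sq (inv_nonneg.2 hs.le)]
        congr 1; field_simp
      classical
      by_cases h : √l * s < u
      · rw [indicator_of_mem (s := Ioi (√l * s)) (show u ∈ Ioi (√l * s) from h), indicator_apply, nuDens, if_pos (hcond.2 h), hG, indicator_apply]
        simp only [mem_preimage, inv_inv, hsg, hsq]
        have ee : ε * (√(u ^ 2 - (√l * s) ^ 2) * s⁻¹) / s⁻¹ = ε * √(u ^ 2 - (√l * s) ^ 2) := by field_simp
        rw [ee]
        split_ifs
        · rw [Pi.one_apply, mul_one, ← ofReal_mul (by positivity), abs_mul, hεa, abs_of_pos hu]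
          congr 1; field_simp
        · simp
      · rw [indicator_of_notMem (s := Ioi (√l * s)) (show u ∉ Ioi (√l * s) from h), indicator_apply, nuDens, if_neg (fun h2 => h (hcond.1 h2)), ite_self]
    have k1 := key 1 (Or.inl rfl)
    have k2 := key (-1) (Or.inr rfl)
    simp only [one_mul, neg_mul] at k1 k2
    rw [k1, k2]
  · intro r hr
    by_contra h
    exact hr (hz r h)


lemma rm_red {f : Phase → ℝ} (hf : memErad f) {M : ℝ} (h0 : 0 ≤ M) (hM : eLpNorm f ⊤ volume ≤ ofReal M) :
    RM (red f) M where
  toRF := rf_red hf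
  M0 := h0
  le := by
    rw [← mp_Psi.map_eq, ae_map_iff measurable_Psi.aemeasurable
      (measurableSet_le (measurable_red hf.1.1) measurable_const)]
    rw [eLpNorm_exponent_top] at hM
    filter_upwards [sph_red_ae hf.2, ae_le_eLpNormEssSup (f := f) (μ := volume)] with z h1 h2
    rw [← h1]
    have h3 := h2.trans hM
    rw [Real.enorm_of_nonneg (hf.1.2.1 z)] at h3
    exact (ofReal_le_ofReal_iff h0).1 h3

lemma lint_toReal {u : ℝ → ℝ} (hu : IntegrableOn u (Ioi 0)) (h0 : ∀ s, 0 ≤ u s) :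
    (∫⁻ s in Ioi (0:ℝ), ofReal (4 * π * u s)).toReal = 4 * π * ∫ s in Ioi (0:ℝ), u s := by
  rw [← integral_const_mul, integral_eq_lintegral_of_nonneg_ae]
  · exact ae_of_all _ fun s => mul_nonneg (by positivity) (h0 s)
  · exact (hu.const_mul _).aestronglyMeasurable

lemma x2_int {g M g' M'} (hg : RM g M) (hg' : RM g' M') :
    IntegrableOn (fun t => (pF g t - pF g' t) ^ 2) (Ioi 0) := by
  refine (((p2_int hg).add (p2_int hg')).sub ((pp_int hg hg').const_mul 2)).congr (ae_of_all _ fun t => ?_)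
  simp only [Pi.add_apply, Pi.sub_apply]; ring

lemma ham_eq {f : Phase → ℝ} (hf : memErad f) {M} (hM : RM (red f) M) :
    Ham f = (∫ q, kin q * red f q ∂KM) / 2 - 2 * π * ∫ s in Ioi (0:ℝ), pF (red f) s ^ 2 := by
  rw [Ham, kin_eq hf, fieldSq, (field_int hf hf).2, lint_toReal (p2_int hM) (fun s => sq_nonneg _)]
  ring

lemma fd_eq {f g : Phase → ℝ} (hf : memErad f) (hg : memErad g) {M M'} (hM : RM (red f) M) (hM' : RM (red g) M') :
    fieldDist f g = √(4 * π * ∫ s in Ioi (0:ℝ), (pF (red f) s - pF (red g) s) ^ 2) := by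
  rw [fieldDist, (field_int hf hg).1, lint_toReal (x2_int hM hM') (fun s => sq_nonneg _)]

lemma d1_eq {f g : Phase → ℝ} (hf : memErad f) (hg : memErad g) :
    distL1 f g = (∫ q, |red f q - red g q| ∂KM) ∧ distL1v f g = ∫ q, kin q * |red f q - red g q| ∂KM := by
  have m1 := measurable_red hf.1.1
  have m2 := measurable_red hg.1.1
  have m3 : Measurable fun q => |red f q - red g q| := (continuous_abs.measurable.comp (m1.sub m2))
  constructor
  · rw [← integral_Psi m3, distL1]
    refine integral_congr_ae ?_
    filter_upwards [sph_red_ae hf.2, sph_red_ae hg.2] with z h1 h2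
    rw [h1, h2]
  · rw [← integral_Psi (G := fun q => kin q * |red f q - red g q|) (measurable_kin.mul m3), distL1v]
    refine integral_congr_ae ?_
    filter_upwards [sph_red_ae hf.2, sph_red_ae hg.2, ae_ne0] with z h1 h2 h3
    rw [h1, h2, kin_Psi h3]

lemma Q_mem {Q F e₀} (hQ : AssumptionA Q F e₀) : memErad Q := by
  refine ⟨⟨hQ.contQ.measurable, hQ.nonneg, ?_⟩, hQ.sph⟩
  have h1 := (hQ.contQ.memLp_of_hasCompactSupport (p := 1) (μ := volume) hQ.cpt).2
  have h2 := (hQ.contQ.memLp_of_hasCompactSupport (p := ⊤) (μ := volume) hQ.cpt).2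
  have h3 : Integrable (fun z : Phase => ‖z.2‖ ^ 2 * Q z) volume :=
    Continuous.integrable_of_hasCompactSupport (by have := hQ.contQ; fun_prop) hQ.cpt.mul_left
  have h4 := h3.2
  simp only [hasFiniteIntegral_iff_enorm, enorm_mul, enorm_pow, enorm_norm] at h4
  exact ENNReal.add_lt_top.2 ⟨ENNReal.add_lt_top.2 ⟨h1, h2⟩, h4⟩

def mu (g : T3 → ℝ) (σ l : ℝ) : ℝ≥0∞ := PM {p | σ < g (l, p)}

lemma mu_anti (g) (l : ℝ) : Antitone fun σ => mu g σ l := fun _ _ h =>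
  measure_mono fun _ hp => lt_of_le_of_lt h hp

lemma mu_meas {g} (hg : Measurable g) : Measurable fun y : T2 => mu g y.1 y.2 := by
  have : MeasurableSet {z : T4 | z.1.1 < g (z.1.2, z.2)} :=
    measurableSet_lt (by fun_prop) (hg.comp (by fun_prop))
  exact measurable_measure_prodMk_left this

lemma mu_right {g : T3 → ℝ} {l σ : ℝ} {c : ℝ≥0∞} (h : c < mu g σ l) : ∃ σ' > σ, c < mu g σ' l := by
  obtain ⟨u, hu, hu1, hu2⟩ := exists_seq_strictAnti_tendsto σ
  have h1 : {p : T2 | σ < g (l, p)} = ⋃ n, {p : T2 | u n < g (l, p)} := by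
    ext p
    simp only [mem_ofPred_eq, mem_iUnion]
    constructor
    · intro h; exact (hu2.eventually (gt_mem_nhds h)).exists
    · rintro ⟨n, hn⟩; exact (hu1 n).trans hn
  have h2 : Monotone fun n => {p : T2 | u n < g (l, p)} := fun a b hab p hp =>
    lt_of_le_of_lt (hu.antitone hab) hp
  rw [mu, h1, h2.measure_iUnion, lt_iSup_iff] at h
  obtain ⟨n, hn⟩ := h
  exact ⟨u n, hu1 n, hn⟩

lemma sch_lt {f : Phase → ℝ} (hf : Measurable f) {l M : ℝ} (hl : 0 < l) (hM : mu (red f) M l = 0) (t : ℝ) :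
    0 ≤ schwarz f t l ∧ ∀ σ, 0 ≤ σ → (σ < schwarz f t l ↔ ofReal t < mu (red f) σ l) := by
  have e : ∀ σ, muDist f σ l = mu (red f) σ l := mu_eq hf hl
  unfold schwarz
  simp only [e]
  have hb : BddAbove {s : ℝ | 0 ≤ s ∧ ofReal t < mu (red f) s l} := by
    refine ⟨M, fun s hs => ?_⟩
    by_contra h
    have := mu_anti (red f) l (not_le.1 h).le
    simp only [hM, nonpos_iff_eq_zero] at this
    have h3 := hs.2
    rw [this] at h3
    exact not_lt_bot h3
  split_ifs with h
  · refine ⟨Real.sSup_nonneg fun s hs => hs.1, fun σ hσ => ⟨fun h1 => ?_, fun h1 => ?_⟩⟩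
    · obtain ⟨s, hs, h2⟩ := exists_lt_of_lt_csSup (s := {s : ℝ | 0 ≤ s ∧ ofReal t < mu (red f) s l}) ⟨0, le_rfl, h⟩ h1
      exact hs.2.trans_le (mu_anti _ l h2.le)
    · obtain ⟨s, hs, h2⟩ := mu_right h1
      exact hs.trans_le (le_csSup hb ⟨hσ.trans hs.le, h2⟩)
  · refine ⟨le_rfl, fun σ hσ => ⟨fun h1 => absurd h1 hσ.not_gt, fun h1 => ?_⟩⟩
    exact absurd (h1.trans_le (mu_anti _ l hσ)) h

lemma mu_M {g M} (hg : RM g M) : ∀ᵐ l ∂(volume.restrict (Ioi (0:ℝ))), mu g M l = 0 := by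
  filter_upwards [Measure.ae_ae_of_ae_prod hg.le] with l hl
  rw [ae_iff] at hl
  simpa [mu] using hl

lemma vol_ico (a b : ℝ) (hb : 0 ≤ b) :
    ∫⁻ σ in Ioi (0:ℝ), {σ | σ < a ∧ ¬ σ < b}.indicator 1 σ = ofReal (a - b) := by
  have : {σ | σ < a ∧ ¬ σ < b} = Ico b a := by ext; simp [and_comm]
  rw [this, lintegral_indicator_one measurableSet_Ico, Measure.restrict_apply measurableSet_Ico]
  rw [← Real.volume_Ico]
  refine measure_congr ?_
  filter_upwards [Measure.ae_ne volume (0:ℝ)] with x hx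
  refine propext ⟨fun h => h.1, fun h => ⟨h, lt_of_le_of_ne (hb.trans h.1) (Ne.symm hx)⟩⟩

lemma vol_mu (a b : ℝ≥0∞) :
    ∫⁻ t in Ioi (0:ℝ), {t | ofReal t < a ∧ ¬ ofReal t < b}.indicator 1 t = a - b := by
  have hm : MeasurableSet {t | ofReal t < a ∧ ¬ ofReal t < b} := by
    refine (measurableSet_lt ENNReal.measurable_ofReal measurable_const).inter
      (measurableSet_lt ENNReal.measurable_ofReal measurable_const).compl
  rw [lintegral_indicator_one hm, Measure.restrict_apply hm]
  rcases eq_or_ne b ⊤ with rfl | hb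
  · have : {t : ℝ | ofReal t < a ∧ ¬ ofReal t < ⊤} = ∅ := by ext; simp
    simp [this]
  lift b to ℝ≥0 using hb
  rcases eq_or_ne a ⊤ with rfl | ha
  · rw [ENNReal.top_sub_coe, eq_top_iff]
    refine (Real.volume_Ioi (a := (b:ℝ))).symm.le.trans ?_
    refine measure_mono fun t ht => ?_
    have ht : (b:ℝ) < t := ht
    refine ⟨⟨ofReal_lt_top, ?_⟩, lt_of_le_of_lt b.2 ht⟩
    rw [not_lt, ← ofReal_coe_nnreal]
    exact ofReal_le_ofReal ht.le
  lift a to ℝ≥0 using ha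
  have e : ofReal ((a:ℝ) - b) = (a:ℝ≥0∞) - b := by
    rw [ENNReal.ofReal_sub _ b.coe_nonneg, ofReal_coe_nnreal, ofReal_coe_nnreal]
  rw [← e, ← Real.volume_Ico]
  refine measure_congr ?_
  filter_upwards [Measure.ae_ne volume (0:ℝ)] with x hx
  refine propext ⟨fun h => ?_, fun h => ?_⟩
  · obtain ⟨⟨h1, h2⟩, h3⟩ := h
    have h3 : 0 < x := h3
    rw [← ofReal_coe_nnreal, ENNReal.ofReal_lt_ofReal_iff_of_nonneg h3.le] at h1 h2
    exact ⟨not_lt.1 h2, h1⟩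
  · have h3 : 0 < x := lt_of_le_of_ne (b.2.trans h.1) (Ne.symm hx)
    refine ⟨⟨?_, ?_⟩, h3⟩
    · rw [← ofReal_coe_nnreal, ENNReal.ofReal_lt_ofReal_iff_of_nonneg h3.le]; exact h.2
    · rw [← ofReal_coe_nnreal, ENNReal.ofReal_lt_ofReal_iff_of_nonneg h3.le]; exact h.1.not_gt

def HM : Measure ℝ := volume.restrict (Ioi 0)
instance : SigmaFinite HM := by unfold HM; infer_instance

lemma sch_half {f g : Phase → ℝ} (hf : memErad f) (hg : memErad g) {M M'} (hM : RM (red f) M) (hM' : RM (red g) M') :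
    ∃ D : T2 → ℝ≥0∞, Measurable D ∧
      (∀ᵐ y ∂(HM.prod HM), ofReal (schwarz f y.1 y.2 - schwarz g y.1 y.2) = D y) ∧
      ∫⁻ y, D y ∂(HM.prod HM) = ∫⁻ l, ∫⁻ σ, (mu (red f) σ l - mu (red g) σ l) ∂HM ∂HM := by
  have k1 := mu_meas hM.meas
  have k2 := mu_meas hM'.meas
  have hS : MeasurableSet {z : (T2) × ℝ | ofReal z.1.1 < mu (red f) z.2 z.1.2 ∧
      ¬ ofReal z.1.1 < mu (red g) z.2 z.1.2} := by
    have k0 : Measurable fun z : (T2) × ℝ => ofReal z.1.1 := by fun_prop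
    exact (measurableSet_lt k0 (k1.comp (f := fun z : (T2) × ℝ => (z.2, z.1.2)) (by fun_prop))).inter
      (measurableSet_lt k0 (k2.comp (f := fun z : (T2) × ℝ => (z.2, z.1.2)) (by fun_prop))).compl
  have hI : Measurable ({z : (T2) × ℝ | ofReal z.1.1 < mu (red f) z.2 z.1.2 ∧
      ¬ ofReal z.1.1 < mu (red g) z.2 z.1.2}.indicator (1 : (T2) × ℝ → ℝ≥0∞)) := measurable_one.indicator hS
  have hD : Measurable fun y : T2 => ∫⁻ σ, {z : (T2) × ℝ | ofReal z.1.1 < mu (red f) z.2 z.1.2 ∧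
      ¬ ofReal z.1.1 < mu (red g) z.2 z.1.2}.indicator (1 : (T2) × ℝ → ℝ≥0∞) (y, σ) ∂HM :=
    hI.lintegral_prod_right'
  refine ⟨_, hD, ?_, ?_⟩
  · have hae : ∀ᵐ l ∂HM, 0 < l ∧ mu (red f) M l = 0 ∧ mu (red g) M' l = 0 := by
      filter_upwards [mu_M hM, mu_M hM', ae_restrict_mem measurableSet_Ioi] with l h1 h2 h3
      exact ⟨h3, h1, h2⟩
    filter_upwards [Measure.quasiMeasurePreserving_snd.ae hae] with y hy
    obtain ⟨hl, h1, h2⟩ := hy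
    have a1 := sch_lt hf.1.1 hl h1 y.1
    have a2 := sch_lt hg.1.1 hl h2 y.1
    rw [← vol_ico _ _ a2.1]
    refine slcongr fun σ hσ => ?_
    have hσ : 0 < σ := hσ
    classical
    simp only [indicator_apply, mem_ofPred_eq, a1.2 σ hσ.le, a2.2 σ hσ.le, Pi.one_apply]
  · rw [lintegral_prod_symm _ hD.aemeasurable]
    refine lintegral_congr fun l => ?_
    rw [lintegral_lintegral_swap (f := fun t σ => {z : (T2) × ℝ | ofReal z.1.1 < mu (red f) z.2 z.1.2 ∧
      ¬ ofReal z.1.1 < mu (red g) z.2 z.1.2}.indicator (1 : (T2) × ℝ → ℝ≥0∞) ((t, l), σ))]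
    · refine lintegral_congr fun σ => ?_
      rw [← vol_mu]; rfl
    · exact (hI.comp (f := fun z : T2 => ((z.1, l), z.2)) (by fun_prop)).aemeasurable

def DD (g g' : T3 → ℝ) : ℝ≥0∞ :=
  ∫⁻ l, ∫⁻ σ, ((mu g σ l - mu g' σ l) + (mu g' σ l - mu g σ l)) ∂HM ∂HM

lemma mu_lint {g} (hg : RF g) : ∫⁻ l, ∫⁻ σ, mu g σ l ∂HM ∂HM = ∫⁻ q, ofReal (g q) ∂KM := by
  rw [KM, lintegral_prod _ (hg.meas.ennreal_ofReal).aemeasurable]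
  refine lintegral_congr fun l => ?_
  rw [lintegral_eq_lintegral_meas_lt PM (ae_of_all _ fun p => hg.nonneg (l, p))
    (hg.meas.comp (by fun_prop)).aemeasurable]
  rfl

lemma sch_DD {f g : Phase → ℝ} (hf : memErad f) (hg : memErad g) {M M'} (hM : RM (red f) M) (hM' : RM (red g) M') :
    DD (red f) (red g) = ofReal (∫ p in (Ioi (0:ℝ)) ×ˢ (Ioi (0:ℝ)), |schwarz f p.1 p.2 - schwarz g p.1 p.2|) := by
  have hfin : ∀ {g M}, RM g M → ∫⁻ l, ∫⁻ σ, mu g σ l ∂HM ∂HM < ⊤ := by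
    intro g M h
    rw [mu_lint h.toRF]
    have := h.int.2
    rw [hasFiniteIntegral_iff_ofReal (ae_of_all _ h.nonneg)] at this
    exact this
  obtain ⟨D1, m1, a1, i1⟩ := sch_half hf hg hM hM'
  obtain ⟨D2, m2, a2, i2⟩ := sch_half hg hf hM' hM
  have hprod : (volume.restrict ((Ioi (0:ℝ)) ×ˢ (Ioi (0:ℝ))) : Measure (T2)) = HM.prod HM := by
    rw [HM, Measure.prod_restrict, Measure.volume_eq_prod]
  have hae : ∀ᵐ y ∂(HM.prod HM), ofReal |schwarz f y.1 y.2 - schwarz g y.1 y.2| = D1 y + D2 y := by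
    filter_upwards [a1, a2] with y h1 h2
    rw [← h1, ← h2]
    rcases le_total (schwarz f y.1 y.2) (schwarz g y.1 y.2) with h | h
    · rw [abs_of_nonpos (by linarith), ofReal_of_nonpos (p := _ - _) (by linarith : schwarz f y.1 y.2 - schwarz g y.1 y.2 ≤ 0), zero_add]
      congr 1; ring
    · rw [abs_of_nonneg (by linarith), ofReal_of_nonpos (p := schwarz g y.1 y.2 - schwarz f y.1 y.2) (by linarith), add_zero]
  have hL : ∫⁻ y, (D1 y + D2 y) ∂(HM.prod HM) = DD (red f) (red g) := by
    rw [lintegral_add_left m1, i1, i2, DD, ← lintegral_add_left]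
    · refine lintegral_congr fun l => ?_
      rw [lintegral_add_left]
      exact ((mu_meas hM.meas).comp (measurable_prodMk_right (y := l))).sub ((mu_meas hM'.meas).comp (measurable_prodMk_right (y := l)))
    · exact Measurable.lintegral_prod_left' (f := fun y : T2 => mu (red f) y.1 y.2 - mu (red g) y.1 y.2)
        ((mu_meas hM.meas).sub (mu_meas hM'.meas))
  have hLf : ∫⁻ y, (D1 y + D2 y) ∂(HM.prod HM) < ⊤ := by
    rw [lintegral_add_left m1, i1, i2]
    refine ENNReal.add_lt_top.2 ⟨lt_of_le_of_lt ?_ (hfin hM), lt_of_le_of_lt ?_ (hfin hM')⟩ <;>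
    exact lintegral_mono fun l => lintegral_mono fun σ => tsub_le_self
  rw [hprod, integral_eq_lintegral_of_nonneg_ae (ae_of_all _ fun _ => abs_nonneg _), lintegral_congr_ae hae,
    ofReal_toReal hLf.ne, hL]
  refine AEMeasurable.aestronglyMeasurable ⟨fun y => (D1 y + D2 y).toReal, (m1.add m2).ennreal_toReal, ?_⟩
  filter_upwards [hae] with y hy
  rw [← hy, toReal_ofReal (abs_nonneg _)]


structure BG (G : T3 → ℝ) (ρ : ℝ → ℝ) (E : T2 → ℝ) (e₀ Φ R : ℝ) : Prop where
  rm : RM G R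
  le : ∀ q, G q ≤ R
  rc : ContinuousOn ρ (Ioi 0)
  rmeas : Measurable ρ
  r0 : ∀ s, 0 ≤ ρ s
  rR : ∀ s, ρ s ≤ R
  rint : ∀ s, 0 < s → ∫⁻ w, ∫⁻ l in Ioi (0:ℝ), ofReal (G (l, (s, w))) = ofReal (ρ s / (π * s ^ 2))
  rpos : ∀ s l w, 0 < s → 0 < l → 0 < G (l, (s, w)) → 0 < ρ s
  dp : ∀ s, 0 < s → HasDerivAt (pF G) (-(ρ s / s ^ 4)) s
  UΦ : ∀ s, 0 ≤ s → UF G s ≤ Φ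
  e0 : e₀ < 0
  Em : Measurable E
  E1 : ∀ y, -Φ ≤ E y
  E2 : ∀ y, E y ≤ e₀
  lev : ∀ σ l s w, 0 < σ → 0 < l → 0 < s →
    (σ < G (l, (s, w)) ↔ w ^ 2 / 2 < E (σ, l) + UF G s - l * s ^ 2 / 2)
  gc : ∀ l, ContinuousOn (fun p : T2 => G (l, p)) (Ioi 0 ×ˢ univ)

lemma F_down {u : ℝ → ℝ} (hc : Continuous u) (hd : ∀ e, 0 < u e → deriv u e < 0) {e e' σ : ℝ}
    (hσ : 0 < σ) (h : σ < u e') (hee : e < e') : σ < u e := by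
  by_contra hn
  have hn : u e ≤ σ := not_lt.1 hn
  set S := Icc e e' ∩ u ⁻¹' Iic σ
  have hS : IsCompact S := isCompact_Icc.inter_right (isClosed_Iic.preimage hc)
  have hne : S.Nonempty := ⟨e, ⟨le_rfl, hee.le⟩, hn⟩
  obtain ⟨x, hxS, hx⟩ := hS.exists_isMaxOn hne continuousOn_id
  have hxe : x < e' := lt_of_le_of_ne hxS.1.2 fun h1 => by
    have h2 : u x ≤ σ := hxS.2
    rw [h1] at h2; linarith
  have hgt : ∀ y, x < y → y ≤ e' → σ < u y := fun y h1 h2 => by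
    by_contra h3
    have : y ≤ x := hx (show y ∈ S from ⟨⟨hxS.1.1.trans h1.le, h2⟩, not_lt.1 h3⟩)
    linarith
  have hux : σ ≤ u x := by
    refine ge_of_tendsto (hc.continuousAt.tendsto.mono_left nhdsWithin_le_nhds : Tendsto u (𝓝[>] x) _) ?_
    filter_upwards [Ioc_mem_nhdsGT hxe] with y hy
    exact (hgt y hy.1 hy.2).le
  have := strictAntiOn_of_deriv_neg (convex_Icc x e') hc.continuousOn (fun y hy => by
    rw [interior_Icc] at hy
    exact hd y (hσ.trans (hgt y hy.1 hy.2.le))) (left_mem_Icc.2 hxe.le) (right_mem_Icc.2 hxe.le) hxe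
  have h2 : u x ≤ σ := hxS.2
  linarith

lemma rho_facts {Q F e₀} (hQ : AssumptionA Q F e₀) :
    Continuous (rhoF Q) ∧ (∃ R, ∀ x, rhoF Q x ≤ R) ∧ (∀ x, 0 ≤ rhoF Q x) ∧
    (∀ z, 0 < Q z → 0 < rhoF Q z.1) ∧ ∀ x, ofReal (rhoF Q x) = ∫⁻ v, ofReal (Q (x, v)) := by
  set k := Prod.snd '' tsupport Q
  have hk : IsCompact k := hQ.cpt.isCompact.image continuous_snd
  have h0 : ∀ x v, v ∉ k → Q (x, v) = 0 := fun x v hv => by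
    by_contra h
    exact hv ⟨(x, v), subset_tsupport _ h, rfl⟩
  have hcx : ∀ x, Continuous fun v => Q (x, v) := fun x => hQ.contQ.comp (by fun_prop)
  have hcs : ∀ x, HasCompactSupport fun v => Q (x, v) := fun x => HasCompactSupport.intro hk fun v hv => h0 x v hv
  have hc : Continuous (rhoF Q) := by
    rw [← continuousOn_univ]
    exact continuousOn_integral_of_compact_support (f := fun x v => Q (x, v)) hk
      (by rw [univ_prod_univ]; exact hQ.contQ.continuousOn) (fun p x _ hx => h0 p x hx)
  refine ⟨hc, ?_, fun x => integral_nonneg fun v => hQ.nonneg _, ?_, fun x => ?_⟩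
  · have : HasCompactSupport (rhoF Q) := by
      refine HasCompactSupport.intro (hQ.cpt.isCompact.image continuous_fst) fun x hx => ?_
      have : ∀ v, Q (x, v) = 0 := fun v => by
        by_contra h
        exact hx ⟨(x, v), subset_tsupport _ h, rfl⟩
      simp [rhoF, this]
    obtain ⟨C, hC⟩ := this.exists_bound_of_continuous hc
    exact ⟨C, fun x => (le_abs_self _).trans (hC x)⟩
  · intro z hz
    exact (hcx z.1).integral_pos_of_hasCompactSupport_nonneg_nonzero (hcs z.1) (fun v => hQ.nonneg _) (x := z.2) hz.ne'
  · exact ofReal_integral_eq_lintegral_ofReal ((hcx x).integrable_of_hasCompactSupport (hcs x))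
      (ae_of_all _ fun v => hQ.nonneg _)

lemma exists_BG {Q F e₀} (hQ : AssumptionA Q F e₀) : ∃ ρ E Φ R, BG (red Q) ρ E e₀ Φ R := by
  have hm := Q_mem hQ
  have hrf := rf_red hm
  obtain ⟨rc, ⟨R1, hR1⟩, r0, rp, rl⟩ := rho_facts hQ
  obtain ⟨R2, hR2⟩ := hQ.cpt.exists_bound_of_continuous hQ.contQ
  have hR2' : ∀ z, Q z ≤ R2 := fun z => (le_abs_self _).trans (hR2 z)
  set R := max R1 R2
  have R0 : 0 ≤ R := (hQ.nonneg 0).trans ((hR2' 0).trans (le_max_right _ _))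
  have hle : ∀ q, red Q q ≤ R := fun q => (hR2' _).trans (le_max_right _ _)
  have hrm : RM (red Q) R := { toRF := hrf, M0 := R0, le := ae_of_all _ hle }
  set ρ : ℝ → ℝ := fun s => rhoF Q (s⁻¹ • e1) with hρ
  have ρc : ContinuousOn ρ (Ioi 0) := fun s hs => by
    have : ContinuousAt (fun s : ℝ => s⁻¹) s := continuousAt_inv₀ (ne_of_gt hs)
    exact (rc.continuousAt.comp (f := fun s : ℝ => s⁻¹ • e1) (this.smul continuousAt_const)).continuousWithinAt
  have ρm : Measurable ρ := rc.measurable.comp (by fun_prop)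
  have ρR : ∀ s, ρ s ≤ R := fun s => (hR1 _).trans (le_max_left _ _)
  have nx : ∀ s : ℝ, 0 < s → ‖s⁻¹ • e1‖ = s⁻¹ ∧ s⁻¹ • e1 ≠ 0 := fun s hs => by
    have : ‖s⁻¹ • e1‖ = s⁻¹ := by rw [norm_smul, e1n, mul_one, Real.norm_of_nonneg (by positivity)]
    refine ⟨this, fun h => ?_⟩
    rw [h, norm_zero] at this
    exact (inv_pos.2 hs).ne this
  have rint : ∀ s, 0 < s → ∫⁻ w, ∫⁻ l in Ioi (0:ℝ), ofReal (red Q (l, (s, w))) =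
      ofReal (ρ s / (π * s ^ 2)) := by
    intro s hs
    have h1 := lint_v (fun q => ofReal (red Q q)) hrf.meas.ennreal_ofReal (nx s hs).2
    have h2 : ∫⁻ v, ofReal (red Q (Psi (s⁻¹ • e1, v))) = ofReal (ρ s) := by
      rw [hρ, rl]
      refine lintegral_congr fun v => ?_
      rw [sph_red hQ.sph (z := (s⁻¹ • e1, v)) (nx s hs).2]
    rw [h2, (nx s hs).1, inv_inv] at h1
    have h3 : π * ((s⁻¹) ^ 2)⁻¹ = π * s ^ 2 := by rw [inv_pow, inv_inv]
    rw [h3] at h1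
    rw [ENNReal.ofReal_div_of_pos (by positivity), h1, mul_comm, ENNReal.mul_div_cancel_right]
    · exact (ENNReal.ofReal_pos.2 (by positivity)).ne'
    · exact ofReal_ne_top
  have hp : ∀ t, 0 < t → ofReal (pF (red Q) t) = ∫⁻ s in Ioi t, ofReal (ρ s / s ^ 4) := by
    intro t ht
    rw [pF_ofReal hrf, lint_KM _ (hrf.meas.ennreal_ofReal.indicator (meas_half t)),
      ← lcmul]
    have hI : Ioi t = Ioi t ∩ Ioi 0 := by rw [Ioi_inter_Ioi, max_eq_left ht.le]
    rw [hI, ← setLIntegral_indicator measurableSet_Ioi]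
    refine slcongr fun s hs => ?_
    have hs : 0 < s := hs
    by_cases h : t < s
    · have e : ∀ w l, {q : T3 | t < q.2.1}.indicator (fun q => ofReal (red Q q)) (l, (s, w)) =
        ofReal (red Q (l, (s, w))) := fun w l => indicator_of_mem (by exact h) _
      simp only [e]
      rw [rint s hs, indicator_of_mem (show s ∈ Ioi t from h), ← ofReal_mul (by positivity),
        ← ofReal_mul (by positivity)]
      congr 1
      field_simp
    · have e : ∀ w l, {q : T3 | t < q.2.1}.indicator (fun q => ofReal (red Q q)) (l, (s, w)) = 0 :=
        fun w l => indicator_of_notMem (by exact h) _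
      simp only [e]
      rw [indicator_of_notMem (show s ∉ Ioi t from h)]
      simp
  have hcI : ContinuousOn (fun s => ρ s / s ^ 4) (Ioi 0) :=
    ρc.div (by fun_prop) fun s hs => by have : 0 < s := hs; positivity
  have hn : ∀ s, 0 ≤ ρ s / s ^ 4 := fun s => div_nonneg (r0 _) (by positivity)
  have hii : ∀ t, 0 < t → IntegrableOn (fun s => ρ s / s ^ 4) (Ioi t) := by
    intro t ht
    refine ⟨(ρm.div (by fun_prop)).aestronglyMeasurable, ?_⟩
    rw [hasFiniteIntegral_iff_ofReal (ae_of_all _ hn), ← hp t ht]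
    exact ofReal_lt_top
  have hpi : ∀ t, 0 < t → pF (red Q) t = ∫ s in Ioi t, ρ s / s ^ 4 := by
    intro t ht
    rw [← ENNReal.ofReal_eq_ofReal_iff (pF_nonneg hrf t) (integral_nonneg hn), hp t ht,
      ofReal_integral_eq_lintegral_ofReal (hii t ht) (ae_of_all _ hn)]
  have dp : ∀ s, 0 < s → HasDerivAt (pF (red Q)) (-(ρ s / s ^ 4)) s := by
    intro s hs
    have h1 : ∀ t, 0 < t → pF (red Q) t = pF (red Q) s - ∫ u in s..t, ρ u / u ^ 4 := by
      intro t ht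
      have := intervalIntegral.integral_Ioi_sub_Ioi' (hii s hs) (hii t ht)
      rw [hpi t ht, hpi s hs, ← this]; ring
    have h2 : HasDerivAt (fun t => ∫ u in s..t, ρ u / u ^ 4) (ρ s / s ^ 4) s := by
      refine intervalIntegral.integral_hasDerivAt_right (by simp) ?_ (hcI.continuousAt (Ioi_mem_nhds hs))
      exact hcI.stronglyMeasurableAtFilter isOpen_Ioi s hs
    refine (h2.const_sub (pF (red Q) s)).congr_of_eventuallyEq ?_
    filter_upwards [Ioi_mem_nhds hs] with t ht
    exact h1 t ht
  have hp3 : ∀ s, 0 < s → pF (red Q) s ≤ R / 3 * (s ^ 3)⁻¹ := by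
    intro s hs
    rw [hpi s hs]
    have hj : IntegrableOn (fun u : ℝ => R * u ^ (-4:ℝ)) (Ioi s) :=
      (integrableOn_Ioi_rpow_of_lt (by norm_num) hs).const_mul _
    refine (setIntegral_mono_on (hii s hs) hj measurableSet_Ioi fun u hu => ?_).trans ?_
    · have hu : 0 < u := hs.trans hu
      rw [Real.rpow_neg hu.le, div_eq_mul_inv]
      have : u ^ (4:ℝ) = u ^ 4 := by exact_mod_cast Real.rpow_natCast u 4
      rw [this]
      exact mul_le_mul_of_nonneg_right (ρR u) (by positivity)
    · rw [integral_const_mul, integral_Ioi_rpow_of_lt (by norm_num) hs]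
      have : s ^ (-4 + 1 : ℝ) = (s ^ 3)⁻¹ := by
        rw [show (-4 + 1 : ℝ) = -((3:ℕ):ℝ) by norm_num, Real.rpow_neg hs.le, Real.rpow_natCast]
      rw [this]
      apply le_of_eq; ring
  have hU : ∃ Φ0, ∀ s, 0 ≤ s → UF (red Q) s ≤ Φ0 := by
    refine ⟨UF (red Q) 1 + R / 6, fun s hs => ?_⟩
    have mono : ∀ a b, a ≤ b → UF (red Q) a ≤ UF (red Q) b := fun a b hab =>
      monotone_of_deriv_nonneg (fun x => (UF_deriv hrf x).differentiableAt)
        (fun x => by rw [(UF_deriv hrf x).deriv]; exact pF_nonneg hrf x) hab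
    rcases le_total s 1 with h | h
    · linarith [mono s 1 h]
    have key : AntitoneOn (fun s => UF (red Q) s + R / 6 * (s ^ 2)⁻¹) (Ici 1) := by
      have hd : ∀ x : ℝ, 1 ≤ x → HasDerivAt (fun s => UF (red Q) s + R / 6 * (s ^ 2)⁻¹)
          (pF (red Q) x + R / 6 * (-(2 * x) / (x ^ 2) ^ 2)) x := by
        intro x hx
        have h1 : HasDerivAt (fun s : ℝ => s ^ 2) (2 * x) x := by simpa using hasDerivAt_pow 2 x
        exact (UF_deriv hrf x).add ((h1.fun_inv (by positivity)).const_mul _)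
      refine antitoneOn_of_deriv_nonpos (convex_Ici 1) (fun x hx => (hd x hx).continuousAt.continuousWithinAt)
        (fun x hx => ?_) (fun x hx => ?_)
      · rw [interior_Ici] at hx; exact (hd x (le_of_lt hx)).differentiableAt.differentiableWithinAt
      · rw [interior_Ici] at hx
        have hx : 1 < x := hx
        rw [(hd x hx.le).deriv]
        have h1 := hp3 x (by linarith)
        have h2 : R / 6 * (-(2 * x) / (x ^ 2) ^ 2) = - (R / 3 * (x ^ 3)⁻¹) := by
          have : x ≠ 0 := by positivity
          field_simp; ring
        linarith
    have := key self_mem_Ici h h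
    simp only [one_pow, inv_one, mul_one] at this
    have h3 : 0 ≤ R / 6 * (s ^ 2)⁻¹ := by positivity
    linarith
  obtain ⟨Φ0, hΦ0⟩ := hU
  set Φ := max (Φ0 + 1) (-e₀)
  set Fm : ℝ → ℝ → ℝ := fun e l => F e (max l 0) with hFm
  have Fmc : Continuous fun y : T2 => Fm y.1 y.2 :=
    hQ.Fcont.comp_continuous (f := fun y : T2 => (y.1, max y.2 0)) (by fun_prop) fun y => by exact le_max_right y.2 0
  set S : T2 → Set ℝ := fun y => insert (-Φ) {e | max y.1 0 < Fm e y.2} with hS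
  have hSb : ∀ y, ∀ e ∈ S y, e ≤ e₀ := by
    intro y e he
    rcases he with rfl | he
    · linarith [le_max_right (Φ0 + 1) (-e₀)]
    · exact (hQ.Fsupp _ _ (le_max_right _ _) ((le_max_right _ _).trans_lt he)).le
  have hSbd : ∀ y, BddAbove (S y) := fun y => ⟨e₀, fun e he => hSb y e he⟩
  have hSne : ∀ y, (S y).Nonempty := fun y => ⟨-Φ, mem_insert _ _⟩
  refine ⟨ρ, fun y => sSup (S y), Φ, R, hrm, hle, ρc, ρm, fun s => r0 _, ρR, rint, ?_, dp, ?_, hQ.e₀neg, ?_, ?_, ?_, ?_, ?_⟩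
  · intro s l w hs hl h
    exact rp (zc s w l) h
  · intro s hs
    linarith [hΦ0 s hs, le_max_left (Φ0 + 1) (-e₀)]
  · refine measurable_of_Ioi fun c => ?_
    have : (fun y => sSup (S y)) ⁻¹' Ioi c = {_y | c < -Φ} ∪ ⋃ e : ℚ, {y | c < e ∧ max y.1 0 < Fm e y.2} := by
      ext y
      simp only [mem_preimage, mem_Ioi, lt_csSup_iff (hSbd y) (hSne y), mem_union, mem_ofPred_eq, mem_iUnion]
      constructor
      · rintro ⟨e, he | he, h⟩
        · left; rw [← he]; exact h
        · right
          have ho : IsOpen {x : ℝ | max y.1 0 < Fm x y.2 ∧ c < x} :=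
            (isOpen_lt continuous_const (Fmc.comp (f := fun x : ℝ => (x, y.2)) (by fun_prop))).inter (isOpen_lt continuous_const continuous_id)
          obtain ⟨r, hr⟩ := (Rat.denseRange_cast (𝕜 := ℝ)).exists_mem_open ho ⟨e, he, h⟩
          exact ⟨r, hr.2, hr.1⟩
      · rintro (h | ⟨e, h1, h2⟩)
        · exact ⟨-Φ, mem_insert _ _, h⟩
        · exact ⟨e, Or.inr h2, h1⟩
    rw [this]
    refine (MeasurableSet.const _).union (MeasurableSet.iUnion fun e => (MeasurableSet.const _).inter ?_)
    exact measurableSet_lt (by fun_prop) (Fmc.comp (f := fun y : T2 => ((e:ℝ), y.2)) (by fun_prop)).measurable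
  · intro y; exact le_csSup (hSbd y) (mem_insert _ _)
  · intro y; exact csSup_le (hSne y) (hSb y)
  · intro σ l s w hσ hl hs
    have hPz := Psi_zc (w := w) hs hl.le
    have hell : ellOf (zc s w l) = l := congrArg Prod.fst hPz
    have hmic : microE Q (zc s w l) = w ^ 2 / 2 + l * s ^ 2 / 2 - UF (red Q) s := by
      have : phiF Q (zc s w l).1 = -UF (red Q) s := by
        rw [phi_eq hm (by exact (nx s hs).2), UF]
        congr 2
        exact (congrArg _ (nx s hs).1).trans (inv_inv s)
      rw [microE, zc_v hl.le, this]; ring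
    have hval : red Q (l, (s, w)) = Fm (w ^ 2 / 2 + l * s ^ 2 / 2 - UF (red Q) s) l := by
      simp only [red, hFm, max_eq_left hl.le]
      rw [hQ.eqF, hmic, hell]
    set e := w ^ 2 / 2 + l * s ^ 2 / 2 - UF (red Q) s with he
    have hcu : Continuous fun x => Fm x l := Fmc.comp (f := fun x : ℝ => (x, l)) (by fun_prop)
    have hσm : max σ 0 = σ := max_eq_left hσ.le
    have hgoal : (σ < Fm e l ↔ e < sSup (S (σ, l))) := by
      constructor
      · intro h
        have ho : ∀ᶠ x in 𝓝[>] e, σ < Fm x l :=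
          nhdsWithin_le_nhds (hcu.continuousAt.eventually (lt_mem_nhds h))
        obtain ⟨x, hx1, hx2⟩ := (ho.and self_mem_nhdsWithin).exists
        refine lt_of_lt_of_le (mem_Ioi.1 hx2) (le_csSup (hSbd _) (Or.inr ?_))
        simpa [hσm] using hx1
      · intro h
        obtain ⟨x, hx, hxe⟩ := exists_lt_of_lt_csSup (hSne _) h
        rcases hx with rfl | hx
        · exfalso
          have := hΦ0 s hs.le
          have h4 := le_max_left (Φ0 + 1) (-e₀)
          have : e ≥ -Φ0 := by
            have : 0 ≤ w ^ 2 / 2 + l * s ^ 2 / 2 := by positivity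
            linarith
          linarith
        · simp only [mem_ofPred_eq, hσm] at hx
          refine F_down hcu (fun x hx => ?_) hσ hx hxe
          have := hQ.FeNeg x (max l 0) (le_max_right _ _) hx
          exact this
    rw [hval, hgoal]
    constructor <;> intro h <;> linarith
  · intro l p hp
    have h1 : ContinuousAt (fun p : T2 => p.1⁻¹) p := continuousAt_fst.inv₀ (ne_of_gt hp.1)
    exact (hQ.contQ.continuousAt.comp (f := fun p : T2 => zc p.1 p.2 l) ((h1.smul continuousAt_const).prodMk
      (by fun_prop))).continuousWithinAt


def T0 (X k w : ℝ) : ℝ := max (X + k - w ^ 2 / 2) 0 - if w ^ 2 / 2 < X then X + k - w ^ 2 / 2 else 0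

lemma T0_even (X k w : ℝ) : T0 X k (-w) = T0 X k w := by simp [T0]

lemma T0_quad {X k c d α β : ℝ} (hc : c ≤ d) (h0 : ∀ w ∈ Icc c d, 0 ≤ α + β * w ^ 2)
    (hg : ∀ w, 0 < w → T0 X k w ≤ (Icc c d).indicator (fun w => α + β * w ^ 2) w) :
    ∫⁻ w, ofReal (T0 X k w) ≤ ofReal (2 * (α * (d - c) + β * (d ^ 3 - c ^ 3) / 3)) := by
  have h1 : ∫⁻ w in Ioi (0:ℝ), ofReal (T0 X k w) ≤ ofReal (α * (d - c) + β * (d ^ 3 - c ^ 3) / 3) := by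
    have hi : IntervalIntegrable (fun w : ℝ => α + β * w ^ 2) volume c d := (by fun_prop : Continuous _).intervalIntegrable _ _
    have e : ∫ w in c..d, (α + β * w ^ 2) = α * (d - c) + β * (d ^ 3 - c ^ 3) / 3 := by
      rw [intervalIntegral.integral_add (by simp) ((by fun_prop : Continuous _).intervalIntegrable _ _),
        intervalIntegral.integral_const_mul, integral_pow]
      simp; ring
    rw [← e, intervalIntegral.integral_of_le hc, ← integral_Icc_eq_integral_Ioc,
      ofReal_integral_eq_lintegral_ofReal ((intervalIntegrable_iff_integrableOn_Icc_of_le hc).1 hi)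
        ((ae_restrict_iff' measurableSet_Icc).2 (ae_of_all _ h0)), ← lintegral_indicator measurableSet_Icc]
    refine le_trans (setLIntegral_mono' measurableSet_Ioi fun w hw => ?_) (setLIntegral_le_lintegral (Ioi 0) _)
    refine (ofReal_le_ofReal (hg w hw)).trans ?_
    by_cases h : w ∈ Icc c d
    · rw [indicator_of_mem h, indicator_of_mem h]
    · rw [indicator_of_notMem h, indicator_of_notMem h, ENNReal.ofReal_zero]
  rw [lint_split]
  simp only [T0_even]
  rw [ofReal_mul zero_le_two, ENNReal.ofReal_ofNat, two_mul]
  exact add_le_add h1 h1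

lemma I_neg {X k : ℝ} (hX : X ≤ 0) : ∫⁻ w, ofReal (T0 X k w) ≤
    if 0 < X + k then ofReal (2 * k * √(2 * k)) else 0 := by
  have hT : ∀ w, T0 X k w = max (X + k - w ^ 2 / 2) 0 := fun w => by
    rw [T0, if_neg (by nlinarith [sq_nonneg w]), sub_zero]
  split_ifs with h
  · have hk : 0 < k := by linarith
    refine (T0_quad (c := 0) (d := √(2 * k)) (α := k) (β := 0) (Real.sqrt_nonneg _) (fun w _ => by simp [hk.le]) fun w hw => ?_).trans
      (ofReal_le_ofReal (by apply le_of_eq; ring))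
    rw [hT]
    by_cases h2 : w ∈ Icc 0 (√(2 * k))
    · rw [indicator_of_mem h2]
      exact max_le (by nlinarith [sq_nonneg w]) (by simp [hk.le])
    · rw [indicator_of_notMem h2]
      have : √(2 * k) < w := by
        by_contra h3; exact h2 ⟨hw.le, not_lt.1 h3⟩
      have := (Real.sqrt_lt' hw).1 this
      exact max_le (by linarith) le_rfl
  · refine le_of_eq ((lintegral_congr fun w => ?_).trans lintegral_zero)
    rw [hT, max_eq_right (by nlinarith [sq_nonneg w]), ENNReal.ofReal_zero]

lemma I_pos_aux {X k a : ℝ} (hX : 0 < X) (ha : a = √(2 * X)) : ∃ v, ∫⁻ w, ofReal (T0 X k w) ≤ ofReal v ∧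
    ((0 ≤ k ∧ v ≤ k ^ 2 / a) ∨ (∃ b, 0 ≤ b ∧ b ≤ a ∧ a ^ 2 - b ^ 2 = 2 * (-k) ∧ v = (a - b) ^ 2 * (a + 2 * b) / 3) ∨
      (X < -k ∧ v = 2 * a * (-k) - 2 * a ^ 3 / 3)) := by
  have ha2 : a ^ 2 = 2 * X := by rw [ha, Real.sq_sqrt (by linarith)]
  have ha0 : 0 < a := by rw [ha]; exact Real.sqrt_pos.2 (by linarith)
  have cmp : ∀ w, 0 < w → (w ^ 2 / 2 < X ↔ w < a) := fun w hw => by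
    rw [← pow_lt_pow_iff_left₀ hw.le ha0.le two_ne_zero, ha2]; constructor <;> intro h <;> linarith
  rcases lt_or_ge (X + k) 0 with h | h
  · refine ⟨_, T0_quad (c := 0) (d := a) (α := -(X + k)) (β := 1 / 2) ha0.le (fun w _ => by nlinarith [sq_nonneg w]) fun w hw => ?_,
      Or.inr (Or.inr ⟨by linarith, ?_⟩)⟩
    · rw [T0, max_eq_right (by nlinarith [sq_nonneg w])]
      by_cases h2 : w ^ 2 / 2 < X
      · rw [if_pos h2, indicator_of_mem (show w ∈ Icc _ _ from ⟨hw.le, ((cmp w hw).1 h2).le⟩)]; linarith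
      · rw [if_neg h2, sub_zero]
        exact indicator_nonneg (fun w _ => by nlinarith [sq_nonneg w]) w
    · have : X = a ^ 2 / 2 := by linarith
      rw [this]; ring
  set b := √(2 * (X + k)) with hb
  have hb0 : 0 ≤ b := Real.sqrt_nonneg _
  have hb2 : b ^ 2 = 2 * (X + k) := by rw [hb, Real.sq_sqrt (by linarith)]
  have eX : X + k = b ^ 2 / 2 := by linarith
  rcases lt_or_ge k 0 with hk | hk
  · have hba : b ≤ a := by
      rw [← pow_le_pow_iff_left₀ hb0 ha0.le two_ne_zero]; linarith
    have hnn : ∀ w ∈ Icc b a, 0 ≤ -(b ^ 2 / 2) + 1 / 2 * w ^ 2 := fun w hw => by nlinarith [hw.1]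
    refine ⟨_, T0_quad (c := b) (d := a) (α := -(b ^ 2 / 2)) (β := 1 / 2) hba hnn fun w hw => ?_,
      Or.inr (Or.inl ⟨b, hb0, hba, by linarith, by ring⟩)⟩
    have hr := indicator_nonneg hnn w
    rw [T0, eX]
    by_cases h2 : w ^ 2 / 2 < X
    · rw [if_pos h2]
      by_cases h3 : b ≤ w
      · rw [indicator_of_mem (show w ∈ Icc _ _ from ⟨h3, ((cmp w hw).1 h2).le⟩), max_eq_right (by nlinarith)]; linarith
      · rw [max_eq_left (by nlinarith), sub_self]; exact hr
    · rw [if_neg h2, sub_zero, max_eq_right (by linarith)]; exact hr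
  · have hba : a ≤ b := by
      rw [← pow_le_pow_iff_left₀ ha0.le hb0 two_ne_zero]; linarith
    have hnn : ∀ w ∈ Icc a b, 0 ≤ b ^ 2 / 2 + (-1 / 2) * w ^ 2 := fun w hw => by nlinarith [hw.1, hw.2]
    refine ⟨_, T0_quad (c := a) (d := b) (α := b ^ 2 / 2) (β := -1 / 2) hba hnn fun w hw => ?_, Or.inl ⟨hk, ?_⟩⟩
    · have hr := indicator_nonneg hnn w
      rw [T0, eX]
      by_cases h2 : w ^ 2 / 2 < X
      · rw [if_pos h2, max_eq_left (by linarith), sub_self]; exact hr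
      · rw [if_neg h2, sub_zero]
        by_cases h3 : w ≤ b
        · rw [indicator_of_mem (show w ∈ Icc _ _ from ⟨not_lt.1 fun h => h2 ((cmp w hw).2 h), h3⟩)]
          exact max_le (by linarith) (by nlinarith)
        · rw [max_eq_right (by nlinarith)]; exact hr
    · rw [le_div_iff₀ ha0]
      have : k = (b ^ 2 - a ^ 2) / 2 := by linarith
      rw [this]
      nlinarith [mul_nonneg (sq_nonneg (b - a)) (mul_nonneg (sub_nonneg.2 hba) (by linarith : 0 ≤ 3 * b + a))]

lemma I_pos1 {X k : ℝ} (hX : 0 < X) : ∫⁻ w, ofReal (T0 X k w) ≤ ofReal (3 / 2 * (k ^ 2 / √(2 * X))) := by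
  obtain ⟨v, hv, h⟩ := I_pos_aux (k := k) hX rfl
  refine hv.trans (ofReal_le_ofReal ?_)
  have ha0 : 0 < √(2 * X) := Real.sqrt_pos.2 (by linarith)
  set a := √(2 * X)
  have h0 : 0 ≤ k ^ 2 / a := by positivity
  rcases h with ⟨_, h⟩ | ⟨b, hb0, hba, h1, rfl⟩ | ⟨_, rfl⟩
  · linarith
  · have : k = -(a ^ 2 - b ^ 2) / 2 := by linarith
    rw [this, mul_div_assoc', le_div_iff₀ ha0]
    nlinarith [mul_nonneg (sq_nonneg (a - b)) (sq_nonneg (a - b)), mul_nonneg (sq_nonneg (a - b)) (mul_nonneg ha0.le hb0),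
      mul_nonneg (sq_nonneg (a - b)) (sq_nonneg b), mul_nonneg (sq_nonneg (a - b)) (sq_nonneg a)]
  · rw [mul_div_assoc', le_div_iff₀ ha0]
    nlinarith [sq_nonneg (-k - 2 / 3 * a ^ 2)]

lemma I_pos2 {X k : ℝ} (hX : 0 < X) : ∫⁻ w, ofReal (T0 X k w) ≤
    ofReal (k ^ 2 / √(2 * X) + 2 * k ^ 2 * √√|k| * (√√X ^ 3)⁻¹) := by
  obtain ⟨v, hv, h⟩ := I_pos_aux (k := k) hX rfl
  refine hv.trans (ofReal_le_ofReal ?_)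
  have ha0 : 0 < √(2 * X) := Real.sqrt_pos.2 (by linarith)
  have haX : √(2 * X) = √2 * √√X ^ 2 := by rw [Real.sqrt_mul (by norm_num), Real.sq_sqrt (Real.sqrt_nonneg _)]
  have hk4 : |k| = √√|k| ^ 4 := by
    rw [show 4 = 2 * 2 by norm_num, pow_mul, Real.sq_sqrt (Real.sqrt_nonneg _), Real.sq_sqrt (abs_nonneg _)]
  have hX4 : X = √√X ^ 4 := by
    rw [show 4 = 2 * 2 by norm_num, pow_mul, Real.sq_sqrt (Real.sqrt_nonneg _), Real.sq_sqrt hX.le]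
  have hy0 : 0 < √√X := Real.sqrt_pos.2 (Real.sqrt_pos.2 hX)
  have hκ0 : 0 ≤ √√|k| := Real.sqrt_nonneg _
  set a := √(2 * X) with ha
  set y := √√X with hy
  set κ := √√|k| with hκ
  have ha2 : a ^ 2 = 2 * X := Real.sq_sqrt (by linarith)
  have hs2 : 1 ≤ √2 := by rw [Real.one_le_sqrt]; norm_num
  have hay : y ^ 2 ≤ a := by rw [haX]; nlinarith [sq_nonneg y]
  have h00 : 0 ≤ 2 * k ^ 2 * κ * (y ^ 3)⁻¹ := by positivity
  rcases h with ⟨_, h⟩ | ⟨b, hb0, hba, h1, rfl⟩ | ⟨hk, rfl⟩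
  · linarith
  · have hkn : k ≤ 0 := by nlinarith
    have hka : |k| = -k := abs_of_nonpos hkn
    have hkX : |k| ≤ X := by rw [hka]; nlinarith
    have hκy : κ ≤ y := by
      rw [hX4, hk4] at hkX
      exact (pow_le_pow_iff_left₀ hκ0 hy0.le (by norm_num)).1 hkX
    have st1 : (a - b) ^ 2 * (a + 2 * b) / 3 ≤ k ^ 2 / a + 2 * |k| ^ 3 / a ^ 3 := by
      have e1 : k ^ 2 / a + 2 * |k| ^ 3 / a ^ 3 = (k ^ 2 * a ^ 2 + 2 * |k| ^ 3) / a ^ 3 := by field_simp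
      rw [e1, le_div_iff₀ (by positivity), hka]
      have e2 : k = -((a - b) * (a + b) / 2) := by linarith [show a ^ 2 - b ^ 2 = (a - b) * (a + b) by ring]
      rw [e2]
      have hd : 0 ≤ a - b := by linarith
      have : 0 ≤ (a - b) ^ 2 * ((a - b) * (3 * (a - b) * a ^ 3 + 12 * a * b ^ 2 * (a - b)+ 100 * b ^ 3 * a)) := by positivity
      have h3 : 0 ≤ (a - b) ^ 3 := by positivity
      have q : 4 * a ^ 3 * (a + 2 * b) ≤ 3 * (a + b) ^ 2 * a ^ 2 + 3 * (a - b) * (a + b) ^ 3 := by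
        nlinarith [mul_nonneg hd (mul_nonneg ha0.le (sq_nonneg a)), mul_nonneg hd (mul_nonneg ha0.le (sq_nonneg b)),
          mul_nonneg hd (mul_nonneg hb0 (sq_nonneg a)), mul_nonneg hd (mul_nonneg hb0 (sq_nonneg b))]
      nlinarith [mul_le_mul_of_nonneg_left q (sq_nonneg (a - b))]
    refine st1.trans (add_le_add le_rfl ?_)
    have hk2 : |k| ^ 3 = k ^ 2 * κ ^ 4 := by rw [← hk4, ← sq_abs k]; ring
    rw [hk2, div_eq_mul_inv]
    have : κ ^ 4 * (a ^ 3)⁻¹ ≤ κ * (y ^ 3)⁻¹ := by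
      rw [← div_eq_mul_inv, ← div_eq_mul_inv, div_le_div_iff₀ (by positivity) (by positivity)]
      have h5 : κ ^ 3 ≤ y ^ 3 := pow_le_pow_left₀ hκ0 hκy 3
      have h6 : (y ^ 2) ^ 3 ≤ a ^ 3 := pow_le_pow_left₀ (by positivity) hay 3
      calc κ ^ 4 * y ^ 3 = κ * (κ ^ 3 * y ^ 3) := by ring
        _ ≤ κ * (y ^ 3 * y ^ 3) := by gcongr
        _ ≤ κ * a ^ 3 := by gcongr; linarith [show (y ^ 2) ^ 3 = y ^ 3 * y ^ 3 by ring]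
    calc 2 * (k ^ 2 * κ ^ 4) * (a ^ 3)⁻¹ = 2 * k ^ 2 * (κ ^ 4 * (a ^ 3)⁻¹) := by ring
      _ ≤ 2 * k ^ 2 * (κ * (y ^ 3)⁻¹) := by gcongr
      _ = _ := by ring
  · have hka : |k| = -k := abs_of_neg (by linarith)
    have hκy : y ≤ κ := by
      have : X ≤ |k| := by rw [hka]; exact hk.le
      rw [hX4, hk4] at this
      exact (pow_le_pow_iff_left₀ hy0.le hκ0 (by norm_num)).1 this
    have st1 : 2 * a * -k - 2 * a ^ 3 / 3 ≤ k ^ 2 / a + 1 / 2 * (k ^ 2 / a) := by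
      rw [mul_div_assoc', ← add_div, le_div_iff₀ ha0]
      nlinarith [sq_nonneg (-k - 2 / 3 * a ^ 2)]
    refine st1.trans (add_le_add le_rfl ?_)
    have : 1 / a ≤ κ * (y ^ 3)⁻¹ := by
      rw [← div_eq_mul_inv, div_le_div_iff₀ (by positivity) (by positivity)]
      calc 1 * y ^ 3 = y * y ^ 2 := by ring
        _ ≤ κ * a := by gcongr
    calc 1 / 2 * (k ^ 2 / a) = 1 / 2 * k ^ 2 * (1 / a) := by ring
      _ ≤ 2 * k ^ 2 * (κ * (y ^ 3)⁻¹) := by gcongr; norm_num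
      _ = _ := by ring

lemma beta_lint {r α β : ℝ} (hr : -1 < r) (hr0 : r ≤ 0) (h : α < β) :
    ∫⁻ s in Ioo α β, ofReal (((s - α) * (β - s)) ^ r) ≤
      ofReal (((β - α) / 2) ^ r * (2 * ((β - α) ^ (r + 1) / (r + 1)))) := by
  have hL : 0 < β - α := by linarith
  have i1 : IntervalIntegrable (fun s => (s - α) ^ r) volume α β := by
    simpa using (intervalIntegral.intervalIntegrable_rpow' (a := α - α) (b := β - α) hr).comp_sub_right α
  have i2 : IntervalIntegrable (fun s => (β - s) ^ r) volume α β := by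
    simpa using (intervalIntegral.intervalIntegrable_rpow' (a := β - α) (b := β - β) hr).comp_sub_left β
  have e : ∫ s in α..β, ((β - α) / 2) ^ r * ((s - α) ^ r + (β - s) ^ r) =
      ((β - α) / 2) ^ r * (2 * ((β - α) ^ (r + 1) / (r + 1))) := by
    rw [intervalIntegral.integral_const_mul, intervalIntegral.integral_add i1 i2,
      intervalIntegral.integral_comp_sub_right (fun x => x ^ r), intervalIntegral.integral_comp_sub_left (fun x => x ^ r),
      sub_self, sub_self, integral_rpow (Or.inl hr), Real.zero_rpow (by linarith)]
    ring
  rw [← e, intervalIntegral.integral_of_le h.le, integral_Ioc_eq_integral_Ioo,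
    ofReal_integral_eq_lintegral_ofReal]
  · refine setLIntegral_mono' measurableSet_Ioo fun s hs => ofReal_le_ofReal ?_
    have h1 : 0 < s - α := by linarith [hs.1]
    have h2 : 0 < β - s := by linarith [hs.2]
    rw [Real.mul_rpow h1.le h2.le]
    have p1 := Real.rpow_nonneg h1.le r
    have p2 := Real.rpow_nonneg h2.le r
    have p3 := Real.rpow_nonneg (by linarith : 0 ≤ (β - α) / 2) r
    rcases le_total ((β - α) / 2) (s - α) with h3 | h3
    · have := Real.rpow_le_rpow_of_nonpos (by linarith : 0 < (β - α) / 2) h3 hr0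
      nlinarith
    · have := Real.rpow_le_rpow_of_nonpos (by linarith : 0 < (β - α) / 2) (by linarith : (β - α) / 2 ≤ β - s) hr0
      nlinarith
  · exact ((intervalIntegrable_iff_integrableOn_Ioo_of_le h.le).1 (i1.add i2)).const_mul _
  · refine (ae_restrict_iff' measurableSet_Ioo).2 (ae_of_all _ fun s hs => ?_)
    have h1 : 0 < s - α := by linarith [hs.1]
    have h2 : 0 < β - s := by linarith [hs.2]
    have : 0 < (β - α) / 2 := by linarith
    simp only [Pi.zero_apply]
    positivity


lemma pair_cov (ν : Measure ℝ) [IsFiniteMeasure ν] {f g : ℝ → ℝ} (hf : Integrable f ν) (hg : Integrable g ν)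
    (hfg : Integrable (fun t => f t * g t) ν) :
    Integrable (fun z : T2 => (f z.1 - f z.2) * (g z.1 - g z.2)) (ν.prod ν) ∧
    ∫ z, (f z.1 - f z.2) * (g z.1 - g z.2) ∂(ν.prod ν) =
      2 * (ν.real univ * ∫ t, f t * g t ∂ν - (∫ t, f t ∂ν) * ∫ t, g t ∂ν) := by
  have i1 : Integrable (fun z : T2 => f z.1 * g z.1) (ν.prod ν) := hfg.comp_fst ν
  have i2 : Integrable (fun z : T2 => f z.2 * g z.2) (ν.prod ν) := hfg.comp_snd ν
  have i3 : Integrable (fun z : T2 => f z.1 * g z.2) (ν.prod ν) := hf.mul_prod hg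
  have i4 : Integrable (fun z : T2 => g z.1 * f z.2) (ν.prod ν) := hg.mul_prod hf
  have e : (fun z : T2 => (f z.1 - f z.2) * (g z.1 - g z.2)) =
      fun z => (f z.1 * g z.1 + f z.2 * g z.2) - (f z.1 * g z.2 + g z.1 * f z.2) := by ext z; ring
  rw [e]
  refine ⟨(i1.add i2).sub (i3.add i4), ?_⟩
  rw [integral_sub (f := fun z : T2 => f z.1 * g z.1 + f z.2 * g z.2) (g := fun z => f z.1 * g z.2 + g z.1 * f z.2)
    (i1.add i2) (i3.add i4), integral_add i1 i2, integral_add i3 i4, integral_prod_mul,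
    integral_prod_mul, integral_fun_fst (f := fun t => f t * g t), integral_fun_snd (f := fun t => f t * g t)]
  simp only [smul_eq_mul]; ring

lemma var_pt {α β t s : ℝ} {b d x v : ℝ → ℝ} (ht : t ∈ Ioo α β) (hs : s ∈ Ioo α β) (hts : t ≤ s)
    (hb : ∀ s ∈ Ioo α β, HasDerivAt b (-v s) s) (hd : ∀ s, HasDerivAt d (x s) s)
    (hx : Continuous x) (hv : ContinuousOn v (Ioo α β)) (hv0 : ∀ s ∈ Ioo α β, 0 < v s) (hvm : Measurable v) :
    ofReal ((d t - d s) ^ 2) ≤ ofReal (b t - b s) * ∫⁻ τ in Ioc t s, ofReal (x τ ^ 2 / v τ) ∧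
      0 ≤ b t - b s := by
  have sub : Icc t s ⊆ Ioo α β := fun τ h => ⟨ht.1.trans_le h.1, h.2.trans_lt hs.2⟩
  set y := fun τ => x τ ^ 2 / v τ with hy
  have yc : ContinuousOn y (Ioo α β) := (hx.pow 2).continuousOn.div hv fun s h => (hv0 s h).ne'
  have ym : Measurable y := (hx.measurable.pow_const 2).div hvm
  have yi : ∀ τ ∈ Icc t s, IntervalIntegrable y volume t τ := fun τ h =>
    ContinuousOn.intervalIntegrable (yc.mono fun z hz => sub (by
      rw [uIcc_of_le h.1] at hz; exact ⟨hz.1, hz.2.trans h.2⟩))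
  have Yd : ∀ τ ∈ Icc t s, HasDerivAt (fun τ => ∫ z in t..τ, y z) (y τ) τ := fun τ h =>
    intervalIntegral.integral_hasDerivAt_right (yi τ h) ym.stronglyMeasurable.stronglyMeasurableAtFilter
      (yc.continuousAt (Ioo_mem_nhds (sub h).1 (sub h).2))
  have key : ∀ c : ℝ, 0 ≤ (∫ z in t..s, y z) * (c * c) + (-2 * (d s - d t)) * c + (b t - b s) := fun c => by
    have D : ∀ τ ∈ Icc t s, HasDerivAt (fun τ => c ^ 2 * (∫ z in t..τ, y z) - b τ - 2 * c * d τ)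
        (c ^ 2 * y τ - (-v τ) - 2 * c * x τ) τ := fun τ h =>
      (((Yd τ h).const_mul _).sub (hb τ (sub h))).sub ((hd τ).const_mul _)
    have := monotoneOn_of_deriv_nonneg (convex_Icc t s) (fun τ h => (D τ h).continuousAt.continuousWithinAt)
      (fun τ h => (D τ (interior_subset h)).differentiableAt.differentiableWithinAt) (fun τ h => by
        rw [(D τ (interior_subset h)).deriv]
        have h0 := hv0 τ (sub (interior_subset h))
        have : c ^ 2 * y τ - (-v τ) - 2 * c * x τ = (c * x τ - v τ) ^ 2 / v τ := by
          simp only [hy]; field_simp; ring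
        rw [this]; positivity) (left_mem_Icc.2 hts) (right_mem_Icc.2 hts) hts
    simp only [intervalIntegral.integral_same] at this
    nlinarith
  have hdis := discrim_le_zero key
  rw [discrim] at hdis
  have h0 : 0 ≤ b t - b s := by simpa using key 0
  refine ⟨?_, h0⟩
  have h1 : (d t - d s) ^ 2 ≤ (b t - b s) * ∫ z in t..s, y z := by nlinarith
  refine (ofReal_le_ofReal h1).trans ?_
  rw [ofReal_mul h0, intervalIntegral.integral_of_le hts, ofReal_integral_eq_lintegral_ofReal]
  · exact (intervalIntegrable_iff_integrableOn_Ioc_of_le hts).1 (yi s (right_mem_Icc.2 hts))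
  · exact (ae_restrict_iff' measurableSet_Ioc).2 (Eventually.of_forall fun τ h =>
      div_nonneg (sq_nonneg _) (hv0 τ (sub (Ioc_subset_Icc_self h))).le)

lemma variance {α β C : ℝ} {m b P d x v : ℝ → ℝ} (hαβ : α < β) (mm : Measurable m)
    (m0 : ∀ s ∈ Ioo α β, 0 < m s) (mi : IntegrableOn m (Ioo α β))
    (hb : ∀ s ∈ Ioo α β, HasDerivAt b (-v s) s) (hd : ∀ s, HasDerivAt d (x s) s) (bc : Continuous b)
    (hx : Continuous x) (hv : ContinuousOn v (Ioo α β)) (hv0 : ∀ s ∈ Ioo α β, 0 < v s) (hvm : Measurable v)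
    (Pc : ContinuousOn P (Icc α β)) (Pa : P α = 0) (Pb : P β = 0)
    (hP : ∀ s ∈ Ioo α β, HasDerivAt P (b s * m s) s) (hC : ∀ s ∈ Ioo α β, |d s| ≤ C) :
    ∃ μ, |μ| ≤ C ∧ ∫⁻ s in Ioo α β, ofReal ((d s + μ) ^ 2 * m s) ≤
      ∫⁻ s in Ioo α β, ofReal (x s ^ 2 / v s * P s) := by
  have dc : Continuous d := continuous_iff_continuousAt.2 fun s => (hd s).continuousAt
  set ν := (volume.restrict (Ioo α β)).withDensity (fun s => ofReal (m s)) with hν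
  have mM : Measurable fun s => ofReal (m s) := mm.ennreal_ofReal
  have mpos : ∀ᵐ s ∂(volume.restrict (Ioo α β)), 0 ≤ m s :=
    (ae_restrict_iff' measurableSet_Ioo).2 (Eventually.of_forall fun s h => (m0 s h).le)
  have νu : ν univ = ofReal (∫ s in Ioo α β, m s) := by
    rw [hν, withDensity_apply _ MeasurableSet.univ, Measure.restrict_univ, ofReal_integral_eq_lintegral_ofReal mi mpos]
  have : IsFiniteMeasure ν := ⟨by rw [νu]; exact ofReal_lt_top⟩
  have νae : ∀ᵐ s ∂ν, s ∈ Ioo α β :=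
    (withDensity_absolutelyContinuous _ _) (ae_restrict_mem measurableSet_Ioo)
  have νint : ∀ f : ℝ → ℝ, ∫ s, f s ∂ν = ∫ s in Ioo α β, f s * m s := fun f => by
    rw [hν, integral_withDensity_eq_integral_toReal_smul mM (Eventually.of_forall fun _ => ofReal_lt_top)]
    refine integral_congr_ae (mpos.mono fun s h => ?_)
    simp only [toReal_ofReal h, smul_eq_mul, mul_comm]
  have νlint : ∀ f : ℝ → ℝ≥0∞, Measurable f → ∫⁻ s, f s ∂ν = ∫⁻ s in Ioo α β, ofReal (m s) * f s := fun f hf => by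
    rw [hν, lintegral_withDensity_eq_lintegral_mul _ mM hf]; rfl
  have bdd : ∀ f : ℝ → ℝ, Continuous f → ∃ K, ∀ᵐ s ∂ν, ‖f s‖ ≤ K := fun f hf => by
    obtain ⟨K, hK⟩ := isCompact_Icc.exists_bound_of_continuousOn (s := Icc α β) hf.continuousOn
    exact ⟨K, νae.mono fun s h => hK s (Ioo_subset_Icc_self h)⟩
  have ci : ∀ f : ℝ → ℝ, Continuous f → Integrable f ν := fun f hf => by
    obtain ⟨K, hK⟩ := bdd f hf
    exact Integrable.of_bound hf.aestronglyMeasurable K hK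
  have M0 : 0 < ν.real univ := by
    rw [Measure.real, νu, toReal_ofReal (integral_nonneg_of_ae mpos),
      integral_pos_iff_support_of_nonneg_ae mpos mi]
    refine lt_of_lt_of_le ?_ (measure_mono (μ := volume.restrict (Ioo α β)) (fun s (h : s ∈ Ioo α β) => (m0 s h).ne'))
    simp [hαβ]
  set M := ν.real univ with hM
  set D := ∫ s, d s ∂ν with hD
  refine ⟨-(D / M), ?_, ?_⟩
  · rw [abs_neg, abs_div, abs_of_pos M0, div_le_iff₀ M0]
    simpa using norm_integral_le_of_norm_le_const (μ := ν) (f := d) (C := C) (νae.mono fun s h => hC s h)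
  have c1 := pair_cov ν (ci d dc) (ci d dc) (ci _ (dc.mul dc))
  have e1 : ∫ z, (d z.1 - d z.2) * (d z.1 - d z.2) ∂(ν.prod ν) = 2 * M * ∫ s, (d s + -(D / M)) ^ 2 ∂ν := by
    rw [c1.2]
    have : ∀ s, (d s + -(D / M)) ^ 2 = d s * d s - (2 * (D / M)) * d s + (D / M) ^ 2 := fun s => by ring
    simp_rw [this]
    rw [integral_add (f := fun s => d s * d s - (2 * (D / M)) * d s) ((ci _ (dc.mul dc)).sub ((ci _ dc).const_mul _)) (integrable_const _),
      integral_sub (f := fun s => d s * d s) (ci _ (dc.mul dc)) ((ci _ dc).const_mul _), integral_const_mul, integral_const, smul_eq_mul]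
    rw [← hM, ← hD]; field_simp; ring
  have c2 : ∀ τ ∈ Ioo α β, ∫⁻ z, ofReal ((b z.1 - b z.2) * ((Iio τ).indicator 1 z.1 - (Iio τ).indicator 1 z.2)) ∂(ν.prod ν)
      = ofReal (2 * M * P τ) := fun τ hτ => by
    have gi : Integrable (fun t => b t * (Iio τ).indicator (1 : ℝ → ℝ) t) ν := by
      refine ((ci b bc).indicator (measurableSet_Iio (a := τ))).congr (Eventually.of_forall fun t => ?_)
      by_cases h : t ∈ Iio τ <;> simp [h]
    have hi : Integrable ((Iio τ).indicator (1 : ℝ → ℝ)) ν := (integrable_const (1:ℝ)).indicator measurableSet_Iio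
    have h := pair_cov ν (ci b bc) hi gi
    have bmi : IntegrableOn (fun s => b s * m s) (Ioo α β) := by
      obtain ⟨K, hK⟩ := isCompact_Icc.exists_bound_of_continuousOn (s := Icc α β) bc.continuousOn
      exact Integrable.bdd_mul mi bc.aestronglyMeasurable ((ae_restrict_iff' measurableSet_Ioo).2
        (Eventually.of_forall fun s h => hK s (Ioo_subset_Icc_self h)))
    have ftc : ∀ s ∈ Icc α β, ∫ u in Ioo α s, b u * m u = P s := fun s hs => by
      rw [← integral_Ioc_eq_integral_Ioo, ← intervalIntegral.integral_of_le hs.1,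
        intervalIntegral.integral_eq_sub_of_hasDerivAt_of_le hs.1 (Pc.mono (Icc_subset_Icc_right hs.2))
          (fun u hu => hP u ⟨hu.1, hu.2.trans_le hs.2⟩), Pa, sub_zero]
      rw [intervalIntegrable_iff_integrableOn_Ioo_of_le hs.1]
      exact bmi.mono_set (Ioo_subset_Ioo_right hs.2)
    have z1 : ∫ s, b s ∂ν = 0 := by rw [νint, ftc β ⟨hαβ.le, le_rfl⟩, Pb]
    have z2 : ∫ s, b s * (Iio τ).indicator (1 : ℝ → ℝ) s ∂ν = P τ := by
      rw [νint, ← ftc τ (Ioo_subset_Icc_self hτ)]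
      have : ∀ s, b s * (Iio τ).indicator (1 : ℝ → ℝ) s * m s = (Iio τ).indicator (fun s => b s * m s) s := fun s => by
        by_cases h : s ∈ Iio τ <;> simp [h]
      simp_rw [this]
      rw [setIntegral_indicator measurableSet_Iio]
      congr 2; ext s; simp only [mem_inter_iff, mem_Ioo, mem_Iio]
      exact ⟨fun h => ⟨h.1.1, h.2⟩, fun h => ⟨⟨h.1, h.2.trans hτ.2⟩, h.2⟩⟩
    rw [← ofReal_integral_eq_lintegral_ofReal h.1, h.2, z1, z2]
    · congr 1; ring
    · have hp : ∀ᵐ z ∂(ν.prod ν), z.1 ∈ Ioo α β ∧ z.2 ∈ Ioo α β :=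
        (Measure.quasiMeasurePreserving_fst.ae νae).and (Measure.quasiMeasurePreserving_snd.ae νae)
      refine hp.mono fun z hz => ?_
      have mono : ∀ t ∈ Ioo α β, ∀ s ∈ Ioo α β, t ≤ s → 0 ≤ b t - b s := fun t ht s hs hts =>
        (var_pt ht hs hts hb hd hx hv hv0 hvm).2
      simp only [Pi.zero_apply]
      by_cases h1 : z.1 < τ <;> by_cases h2 : z.2 < τ <;> simp [h1, h2]
      · have := mono _ hz.1 _ hz.2 (h1.le.trans (not_lt.1 h2)); linarith
      · have := mono _ hz.2 _ hz.1 (h2.le.trans (not_lt.1 h1)); linarith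
  have ptw : ∀ t ∈ Ioo α β, ∀ s ∈ Ioo α β, ofReal ((d t - d s) * (d t - d s)) ≤
      ∫⁻ τ in Ioo α β, ofReal (x τ ^ 2 / v τ) *
        ofReal ((b t - b s) * ((Iio τ).indicator 1 t - (Iio τ).indicator 1 s)) := fun t ht s hs => by
    wlog hts : t ≤ s generalizing t s
    · have := this s hs t ht (not_le.1 hts).le
      refine (le_of_eq (by congr 1; ring)).trans (this.trans (le_of_eq ?_))
      congr 1; ext τ; congr 2; ring
    have h := (var_pt ht hs hts hb hd hx hv hv0 hvm).1
    rw [← sq]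
    refine h.trans ?_
    have h1 : ∀ τ ∈ Ioo t s, (b t - b s) * ((Iio τ).indicator 1 t - (Iio τ).indicator 1 s) = b t - b s := fun τ h => by
      simp [h.1, h.2.le]
    rw [← lcmul, setLIntegral_congr Ioo_ae_eq_Ioc.symm]
    refine le_trans (le_of_eq (setLIntegral_congr_fun measurableSet_Ioo fun τ h => ?_))
      (lintegral_mono_set (Ioo_subset_Ioo ht.1.le hs.2.le))
    rw [h1 τ h, mul_comm]
  have ym : Measurable fun τ => ofReal (x τ ^ 2 / v τ) := ((hx.measurable.pow_const 2).div hvm).ennreal_ofReal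
  have km : Measurable fun z : (T2) × ℝ => ofReal ((b z.1.1 - b z.1.2) *
      ((Iio z.2).indicator (1 : ℝ → ℝ) z.1.1 - (Iio z.2).indicator (1 : ℝ → ℝ) z.1.2)) := by
    have i1 : Measurable fun z : (T2) × ℝ => (Iio z.2).indicator (1 : ℝ → ℝ) z.1.1 :=
      measurable_one.indicator (s := {z : (T2) × ℝ | z.1.1 < z.2}) (measurableSet_lt (by fun_prop) (by fun_prop))
    have i2 : Measurable fun z : (T2) × ℝ => (Iio z.2).indicator (1 : ℝ → ℝ) z.1.2 :=
      measurable_one.indicator (s := {z : (T2) × ℝ | z.1.2 < z.2}) (measurableSet_lt (by fun_prop) (by fun_prop))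
    have := bc.measurable
    exact (Measurable.mul (by fun_prop) (i1.sub i2)).ennreal_ofReal
  have main : ofReal (2 * M * ∫ s, (d s + -(D / M)) ^ 2 ∂ν) ≤
      ofReal (2 * M) * ∫⁻ s in Ioo α β, ofReal (x s ^ 2 / v s * P s) := by
    rw [← e1, ofReal_integral_eq_lintegral_ofReal c1.1 (Eventually.of_forall fun z => mul_self_nonneg _)]
    have hp : ∀ᵐ z ∂(ν.prod ν), z.1 ∈ Ioo α β ∧ z.2 ∈ Ioo α β :=
      (Measure.quasiMeasurePreserving_fst.ae νae).and (Measure.quasiMeasurePreserving_snd.ae νae)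
    refine (lintegral_mono_ae (hp.mono fun z hz => ptw z.1 hz.1 z.2 hz.2)).trans ?_
    rw [lintegral_lintegral_swap ((ym.comp measurable_snd).mul km).aemeasurable,
      ← lcmul]
    refine le_of_eq (setLIntegral_congr_fun measurableSet_Ioo fun τ hτ => ?_)
    rw [lcmul, c2 τ hτ, ofReal_mul (by positivity : 0 ≤ 2 * M),
      ofReal_mul (div_nonneg (sq_nonneg _) (hv0 τ hτ).le)]
    ring
  rw [ofReal_mul (by positivity), ENNReal.mul_le_mul_iff_right (by simpa using M0) ofReal_ne_top] at main
  refine le_trans (le_of_eq ?_) main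
  have dd : Continuous fun s => (d s + -(D / M)) ^ 2 := by fun_prop
  rw [ofReal_integral_eq_lintegral_ofReal (ci _ dd) (Eventually.of_forall fun _ => sq_nonneg _),
    νlint _ dd.measurable.ennreal_ofReal]
  refine lintegral_congr fun s => ?_
  rw [ofReal_mul (sq_nonneg _), mul_comm]


def XX (G : T3 → ℝ) (e l s : ℝ) : ℝ := e + UF G s - l * s ^ 2 / 2

structure Orb (G : T3 → ℝ) (e l α β : ℝ) : Prop where
  l0 : 0 < l
  a0 : 0 < α
  ab : α < β
  xa : XX G e l α = 0
  xb : XX G e l β = 0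
  inn : ∀ s ∈ Icc α β, l / 2 * ((s - α) * (β - s)) ≤ XX G e l s
  out : ∀ s, s ∉ Ioo α β → XX G e l s ≤ l / 2 * ((s - α) * (β - s))

lemma XX_cont {G} (hG : RF G) (e l : ℝ) : Continuous (XX G e l) := by
  have := UF_cont hG; unfold XX; fun_prop

lemma UF_le {G} (hG : RF G) {s : ℝ} (hs : 0 ≤ s) : UF G s ≤ pF G 0 * s := by
  have : UF G s ≤ ∫ _t in (0:ℝ)..s, pF G 0 := intervalIntegral.integral_mono_on hs
    ((pF_cont hG).intervalIntegrable _ _) intervalIntegrable_const fun t ht => pF_anti hG ht.1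
  simpa [mul_comm] using this

lemma orb_exists {G ρ E e₀ Φ R} (hB : BG G ρ E e₀ Φ R) {e l s : ℝ} (he1 : e ≤ e₀)
    (hl : 0 < l) (hs : 0 < s) (hX : 0 < XX G e l s) : ∃ α β, Orb G e l α β ∧ s ∈ Ioo α β := by
  have hG := hB.rm.toRF
  have e0 := hB.e0
  have c := XX_cont hG e l
  have hΦ : 0 ≤ Φ := (UF_nonneg hG le_rfl).trans (hB.UΦ 0 le_rfl)
  have x0 : XX G e l 0 < 0 := by simp [XX, UF]; linarith
  obtain ⟨α, hα, xa⟩ := intermediate_value_Ioo hs.le c.continuousOn ⟨x0, hX⟩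
  have xT : XX G e l (s + 2 * Φ / l + 1) < 0 := by
    set T := s + 2 * Φ / l + 1 with hT
    have h1 : 0 ≤ 2 * Φ / l := by positivity
    have h2 := hB.UΦ T (by linarith)
    have h3 : 2 * Φ / l * l = 2 * Φ := by field_simp
    have h4 : 2 * Φ / l ≤ T ^ 2 := by nlinarith
    have h5 : 2 * Φ ≤ l * T ^ 2 := by nlinarith
    unfold XX; linarith
  have h0 : 0 ≤ 2 * Φ / l := by positivity
  obtain ⟨β, hβ, xb⟩ := intermediate_value_Ioo' (by linarith : s ≤ s + 2 * Φ / l + 1) c.continuousOn ⟨xT, hX⟩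
  have hab : α < β := hα.2.trans hβ.1
  have conc : ConcaveOn ℝ univ fun s => XX G e l s - l / 2 * ((s - α) * (β - s)) := by
    have h : ∀ s, HasDerivAt (fun s => XX G e l s - l / 2 * ((s - α) * (β - s))) (pF G s - l / 2 * (α + β)) s := fun s => by
      have h1 := (((hasDerivAt_const s e).add (UF_deriv hG s)).sub (((hasDerivAt_pow 2 s).const_mul l).div_const 2)).sub
        ((((hasDerivAt_id s).sub_const α).mul ((hasDerivAt_id s).const_sub β)).const_mul (l / 2))
      refine h1.congr_deriv ?_
      simp; ring
    refine Antitone.concaveOn_univ_of_deriv (fun s => (h s).differentiableAt) ?_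
    rw [funext fun s => (h s).deriv]
    exact fun a b hab => by have := pF_anti hG hab; linarith
  refine ⟨α, β, ⟨hl, hα.1, hab, xa, xb, fun s hs => ?_, fun s hs => ?_⟩, hα.2, hβ.1⟩
  · have := conc.2 (mem_univ α) (mem_univ β)
      (show 0 ≤ (β - s) / (β - α) from div_nonneg (by linarith [hs.2]) (by linarith)) (show 0 ≤ (s - α) / (β - α) from div_nonneg (by linarith [hs.1]) (by linarith))
      (by rw [← add_div, div_eq_one_iff_eq (by linarith)]; ring)
    simp only [smul_eq_mul, xa, xb] at this
    have es : (β - s) / (β - α) * α + (s - α) / (β - α) * β = s := by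
      have : β - α ≠ 0 := by linarith
      field_simp; ring
    rw [es] at this
    nlinarith
  · rcases le_or_gt s α with h | h
    · rcases h.eq_or_lt with rfl | h
      · simp [xa]
      have := conc.2 (mem_univ s) (mem_univ β)
        (show 0 ≤ (β - α) / (β - s) from div_nonneg (by linarith) (by linarith)) (show 0 ≤ (α - s) / (β - s) from div_nonneg (by linarith) (by linarith))
        (by rw [← add_div, div_eq_one_iff_eq (by linarith)]; ring)
      have es : (β - α) / (β - s) * s + (α - s) / (β - s) * β = α := by
        have : β - s ≠ 0 := by linarith
        field_simp; ring
      simp only [smul_eq_mul] at this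
      rw [es] at this
      simp only [xa, xb, sub_self, mul_zero, zero_mul, add_zero] at this
      have hp : 0 < (β - α) / (β - s) := div_pos (by linarith) (by linarith)
      nlinarith
    · have h' : β ≤ s := not_lt.1 fun h2 => hs ⟨h, h2⟩
      rcases h'.eq_or_lt with rfl | h'
      · simp [xb]
      have := conc.2 (mem_univ α) (mem_univ s)
        (show 0 ≤ (s - β) / (s - α) from div_nonneg (by linarith) (by linarith)) (show 0 ≤ (β - α) / (s - α) from div_nonneg (by linarith) (by linarith))
        (by rw [← add_div, div_eq_one_iff_eq (by linarith)]; ring)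
      have es : (s - β) / (s - α) * α + (β - α) / (s - α) * s = β := by
        have : s - α ≠ 0 := by linarith
        field_simp; ring
      simp only [smul_eq_mul] at this
      rw [es] at this
      simp only [xa, xb, sub_self, mul_zero, zero_mul, zero_add] at this
      have hp : 0 < (β - α) / (s - α) := div_pos (by linarith) (by linarith)
      nlinarith

lemma orb_pos {G e l α β} (o : Orb G e l α β) {s : ℝ} (hs : s ∈ Ioo α β) : 0 < XX G e l s :=
  lt_of_lt_of_le (mul_pos (half_pos o.l0) (mul_pos (sub_pos.2 hs.1) (sub_pos.2 hs.2))) (o.inn s (Ioo_subset_Icc_self hs))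

lemma orb_neg {G e l α β} (o : Orb G e l α β) {s : ℝ} (hs : s ∉ Ioo α β) : XX G e l s ≤ 0 := by
  refine (o.out s hs).trans (mul_nonpos_of_nonneg_of_nonpos (half_pos o.l0).le ?_)
  rcases le_or_gt s α with h | h
  · exact mul_nonpos_of_nonpos_of_nonneg (by linarith) (by linarith [o.ab])
  · exact mul_nonpos_of_nonneg_of_nonpos (by linarith) (by linarith [not_lt.1 fun h2 => hs ⟨h, h2⟩])

lemma inv_sqrt_le {X l q : ℝ} (hl : 0 < l) (hq : 0 < q) (h : l / 2 * q ≤ X) :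
    (√(2 * X))⁻¹ ≤ (√l)⁻¹ * q ^ (-1 / 2 : ℝ) := by
  have : q ^ (-1 / 2 : ℝ) = (√q)⁻¹ := by
    rw [Real.sqrt_eq_rpow, ← Real.rpow_neg hq.le]; norm_num
  rw [this, ← mul_inv, ← Real.sqrt_mul hl.le]
  exact inv_anti₀ (Real.sqrt_pos.2 (mul_pos hl hq)) (Real.sqrt_le_sqrt (by linarith))

lemma inv_34_le {X l q : ℝ} (hl : 0 < l) (hq : 0 < q) (h : l * q ≤ X) :
    (√√X ^ 3)⁻¹ ≤ (√√l ^ 3)⁻¹ * q ^ (-3 / 4 : ℝ) := by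
  have : q ^ (-3 / 4 : ℝ) = (√√q ^ 3)⁻¹ := by
    rw [Real.sqrt_eq_rpow, Real.sqrt_eq_rpow, ← Real.rpow_mul hq.le, ← Real.rpow_natCast, ← Real.rpow_mul hq.le, ← Real.rpow_neg hq.le]
    norm_num
  rw [this, ← mul_inv, ← mul_pow, ← Real.sqrt_mul (by positivity), ← Real.sqrt_mul hl.le]
  exact inv_anti₀ (by positivity) (by gcongr)

lemma beta_half {α β : ℝ} (h : α < β) :
    ∫⁻ s in Ioo α β, ofReal (((s - α) * (β - s)) ^ (-1 / 2 : ℝ)) ≤ ofReal 6 := by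
  refine (beta_lint (by norm_num) (by norm_num) h).trans (ofReal_le_ofReal ?_)
  have hp : 0 < β - α := by linarith
  rw [Real.div_rpow hp.le (by norm_num)]
  have h1 : (β - α) ^ (-1 / 2 : ℝ) * (β - α) ^ (-1 / 2 + 1 : ℝ) = 1 := by
    rw [← Real.rpow_add hp]; norm_num
  have h2 : (2:ℝ) ^ (-1 / 2 : ℝ) = (√2)⁻¹ := by
    rw [Real.sqrt_eq_rpow, ← Real.rpow_neg (by norm_num)]; norm_num
  rw [h2]
  have h3 : √2 ≤ 3 / 2 := Real.sqrt_le_iff.2 (by norm_num)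
  calc _ = ((β - α) ^ (-1 / 2 : ℝ) * (β - α) ^ (-1 / 2 + 1 : ℝ)) * (4 * √2) := by field_simp; norm_num
    _ ≤ 6 := by rw [h1]; linarith

lemma orb_var {G ρ E e₀ Φ R} (hB : BG G ρ E e₀ Φ R) {e l α β : ℝ} (o : Orb G e l α β)
    (hρ : ∀ s ∈ Ioo α β, 0 < ρ s) {g} (hg : RF g) {C : ℝ} (hC : ∀ s ∈ Ioo α β, |UF g s - UF G s| ≤ C) :
    ∃ μ, |μ| ≤ C ∧ ∫⁻ s in Ioo α β, ofReal ((UF g s - UF G s + μ) ^ 2 * (s ^ 2 * √(2 * XX G e l s))⁻¹) ≤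
      ∫⁻ s in Ioo α β, ofReal ((pF g s - pF G s) ^ 2 / (pF G s + ρ s / s ^ 3) * (√(2 * XX G e l s) / s)) := by
  have hG := hB.rm.toRF
  have Xc := XX_cont hG e l
  have pc := pF_cont hG
  have Uc := UF_cont hG
  have gc := pF_cont hg
  have hp : ∀ s ∈ Ioo α β, 0 < s := fun s h => o.a0.trans h.1
  have rc : ContinuousOn ρ (Ioo α β) := hB.rc.mono fun s h => hp s h
  have mm : Measurable fun s => (s ^ 2 * √(2 * XX G e l s))⁻¹ := by
    have := Xc.measurable; fun_prop
  refine variance (b := fun s => s * pF G s - 2 * UF G s - 2 * e) o.ab mm (fun s h => ?_) ?_ (fun s h => ?_)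
    (fun s => (UF_deriv hg s).sub (UF_deriv hG s)) (by fun_prop) (gc.sub pc) ?_ (fun s h => ?_) ?_ ?_ ?_ ?_ (fun s h => ?_) hC
  · have := orb_pos o h; have := hp s h; positivity
  · refine ⟨mm.aestronglyMeasurable, ?_⟩
    refine lt_of_le_of_lt ?_ (ENNReal.mul_lt_top (ofReal_lt_top (r := (α ^ 2)⁻¹ * (√l)⁻¹))
      ((beta_half o.ab).trans_lt ofReal_lt_top))
    rw [← lcmul]
    refine setLIntegral_mono' measurableSet_Ioo fun s h => ?_
    have h0 := hp s h
    have ha := o.a0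
    rw [← ofReal_norm, ← ofReal_mul (by positivity), Real.norm_of_nonneg (by positivity)]
    refine ofReal_le_ofReal ?_
    beta_reduce
    rw [mul_inv, mul_assoc]
    gcongr
    · exact h.1.le
    · exact inv_sqrt_le o.l0 (mul_pos (sub_pos.2 h.1) (sub_pos.2 h.2)) (o.inn s (Ioo_subset_Icc_self h))
  · have h0 := hp s h
    refine ((((hasDerivAt_id s).mul (hB.dp s h0)).sub ((UF_deriv hG s).const_mul 2)).sub_const (2 * e)).congr_deriv ?_
    simp; field_simp; ring
  · exact pc.continuousOn.add (rc.div (by fun_prop) fun s h => (pow_pos (hp s h) 3).ne')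
  · have := hp s h; have := hρ s h; have := pF_nonneg hG s; positivity
  · have := hB.rmeas; have := pc.measurable; fun_prop
  · exact ContinuousOn.div (by fun_prop) continuousOn_id fun s h => (o.a0.trans_le h.1).ne'
  · simp [o.xa]
  · simp [o.xb]
  · have h0 := hp s h
    have hX := orb_pos o h
    have hs : 0 < √(2 * XX G e l s) := by positivity
    have d1 : HasDerivAt (XX G e l) (pF G s - l * s) s := by
      refine (((hasDerivAt_const s e).add (UF_deriv hG s)).sub (((hasDerivAt_pow 2 s).const_mul l).div_const 2)).congr_deriv ?_
      simp; ring
    refine (((d1.const_mul 2).sqrt (by positivity)).div (hasDerivAt_id s) h0.ne').congr_deriv ?_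
    have h2 : √(2 * XX G e l s) ^ 2 = 2 * XX G e l s := Real.sq_sqrt (by positivity)
    simp only [id]
    field_simp
    rw [h2, XX]; ring


def sI (X k : ℝ → ℝ) (s : ℝ) : ℝ≥0∞ := ofReal (s ^ 2)⁻¹ * ∫⁻ w, ofReal (T0 (X s) (k s) w)

lemma tail_min {a c : ℝ} (ha : 0 ≤ a) (hc : 0 < c) :
    ∫⁻ u in Ioi (0:ℝ), ofReal (min a (c ^ 2 / u ^ 2)) ≤ ofReal (a * c + c) := by
  rw [← Ioc_union_Ioi_eq_Ioi hc.le, ofReal_add (by positivity) hc.le]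
  refine (lintegral_union_le _ _ _).trans (add_le_add ?_ ?_)
  · refine (lintegral_mono fun u => ofReal_le_ofReal (min_le_left _ _)).trans (le_of_eq ?_)
    rw [setLIntegral_const, Real.volume_Ioc, sub_zero, ofReal_mul ha]
  · refine (lintegral_mono fun u => ofReal_le_ofReal (min_le_right _ _)).trans (le_of_eq ?_)
    simp_rw [div_eq_mul_inv, ofReal_mul (sq_nonneg c)]
    rw [lcmul, lint_inv_sq hc, ← ofReal_mul (sq_nonneg c)]
    congr 1; field_simp

lemma outer {α β s0 n c : ℝ} {X k : ℝ → ℝ} (h0 : 0 < s0) (hc : 0 < c) (hn : 0 ≤ n)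
    (hX : ∀ s, s ∉ Ioo α β → X s ≤ 0)
    (h : ∀ s, 0 < s → s ∉ Ioo α β → 0 < X s + k s → s0 ≤ s ∧ k s ≤ n * √s ∧
      (s ≤ α → (α - s) ^ 2 ≤ c ^ 2 * s) ∧ (β ≤ s → (s - β) ^ 2 ≤ c ^ 2 * s)) :
    ∫⁻ s in Ioi 0 \ Ioo α β, sI X k s ≤ ofReal (2 * (3 * (n * √n) / √√s0 * (s0⁻¹ * c + c))) := by
  set K := 3 * (n * √n) / √√s0 with hK
  have K0 : 0 ≤ K := by positivity
  have pt : ∀ s u : ℝ, 0 < s → s ∉ Ioo α β → 0 < u → (0 < X s + k s → u ^ 2 ≤ c ^ 2 * s) →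
      sI X k s ≤ ofReal K * ofReal (min s0⁻¹ (c ^ 2 / u ^ 2)) := fun s u hs hns hu hu2 => by
    have h1 := I_neg (k := k s) (hX s hns)
    by_cases hp : 0 < X s + k s
    swap
    · rw [if_neg hp] at h1
      rw [sI, le_zero_iff.1 h1, mul_zero]; exact zero_le
    rw [if_pos hp] at h1
    obtain ⟨hs0, hk, -, -⟩ := h s hs hns hp
    have hk0 : 0 < k s := by linarith [hX s hns]
    have hu2 := hu2 hp
    refine (mul_le_mul_right h1 _).trans ?_
    rw [← ofReal_mul (by positivity), ← ofReal_mul K0]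
    refine ofReal_le_ofReal ?_
    have hs2 : (√s) ^ 2 = s := Real.sq_sqrt hs.le
    have hs4 : (√√s) ^ 2 = √s := Real.sq_sqrt (by positivity)
    have e1 : 2 * k s * √(2 * k s) ≤ 3 * (n * √n) * (√s * √√s) := by
      have a1 : √(2 * k s) ≤ √2 * (√n * √√s) := by
        rw [← Real.sqrt_mul hn, ← Real.sqrt_mul (by norm_num)]; exact Real.sqrt_le_sqrt (by linarith)
      have a2 : √2 ≤ 3 / 2 := Real.sqrt_le_iff.2 (by norm_num)
      calc _ ≤ 2 * (n * √s) * (3 / 2 * (√n * √√s)) := by gcongr; exact a1.trans (by gcongr)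
        _ = _ := by ring
    have e2 : √s * √√s ≤ s / √√s0 := by
      rw [le_div_iff₀ (by positivity)]
      calc √s * √√s * √√s0 ≤ √s * √√s * √√s := by gcongr
        _ = s := by rw [mul_assoc, ← sq, hs4, ← sq, hs2]
    have e3 : (s ^ 2)⁻¹ * (2 * k s * √(2 * k s)) ≤ K * s⁻¹ := by
      calc _ ≤ (s ^ 2)⁻¹ * (3 * (n * √n) * (s / √√s0)) :=
          mul_le_mul_of_nonneg_left (e1.trans (mul_le_mul_of_nonneg_left e2 (by positivity))) (by positivity)
        _ = K * s⁻¹ := by rw [hK]; field_simp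
    refine e3.trans (mul_le_mul_of_nonneg_left (le_min (inv_anti₀ h0 hs0) ?_) K0)
    rw [le_div_iff₀ (by positivity), inv_mul_le_iff₀ hs]; linarith
  have hsub : Ioi 0 \ Ioo α β ⊆ (Ioc 0 α) ∪ (Ioi 0 ∩ Ici β) := fun s hs => by
    rcases le_or_gt s α with h | h
    · exact Or.inl ⟨hs.1, h⟩
    · exact Or.inr ⟨hs.1, not_lt.1 fun h2 => hs.2 ⟨h, h2⟩⟩
  refine (lintegral_mono_set hsub).trans ((lintegral_union_le _ _ _).trans ?_)
  rw [two_mul, ofReal_add (by positivity) (by positivity), ofReal_mul K0]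
  refine add_le_add ?_ ?_
  · refine le_trans ?_ (mul_le_mul_right (tail_min (inv_nonneg.2 h0.le) hc) _)
    have : ∫⁻ u in Ioi (0:ℝ), ofReal (min s0⁻¹ (c ^ 2 / u ^ 2)) =
        ∫⁻ s in Iio α, ofReal (min s0⁻¹ (c ^ 2 / (α - s) ^ 2)) := by
      rw [← lintegral_indicator measurableSet_Ioi, ← lintegral_indicator measurableSet_Iio,
        ← lintegral_sub_left_eq_self _ α]
      congr 1; ext s; classical simp [indicator_apply]
    rw [this, ← lcmul, ← setLIntegral_congr Ioo_ae_eq_Ioc]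
    refine (setLIntegral_mono' measurableSet_Ioo fun s hs => ?_).trans (lintegral_mono_set (fun s hs => hs.2 : Ioo 0 α ⊆ Iio α))
    have hn : s ∉ Ioo α β := fun h => lt_asymm h.1 hs.2
    exact pt s (α - s) hs.1 hn (by linarith [hs.2]) fun hp => (h s hs.1 hn hp).2.2.1 hs.2.le
  · refine le_trans ?_ (mul_le_mul_right (tail_min (inv_nonneg.2 h0.le) hc) _)
    have : ∫⁻ u in Ioi (0:ℝ), ofReal (min s0⁻¹ (c ^ 2 / u ^ 2)) =
        ∫⁻ s in Ioi β, ofReal (min s0⁻¹ (c ^ 2 / (s - β) ^ 2)) := by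
      rw [← lintegral_indicator measurableSet_Ioi, ← lintegral_indicator measurableSet_Ioi,
        ← lintegral_sub_right_eq_self _ β]
      congr 1; ext s; classical simp [indicator_apply]
    have e : (Ioi 0 ∩ Ici β : Set ℝ) =ᵐ[volume] (Ioi 0 ∩ Ioi β : Set ℝ) :=
      (ae_eq_refl _).inter Ioi_ae_eq_Ici.symm
    rw [this, ← lcmul, setLIntegral_congr e]
    refine (setLIntegral_mono' (measurableSet_Ioi.inter measurableSet_Ioi) fun s hs => ?_).trans
      (lintegral_mono_set inter_subset_right)
    have hn : s ∉ Ioo α β := fun h => lt_asymm h.2 hs.2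
    exact pt s (s - β) hs.1 hn (by linarith [mem_Ioi.1 hs.2]) fun hp => (h s hs.1 hn hp).2.2.2 (mem_Ioi.1 hs.2).le

lemma exists_s0 {G ρ E e₀ Φ R} (hB : BG G ρ E e₀ Φ R) : ∃ s0, 0 < s0 ∧ pF G 0 * s0 + √s0 < -e₀ / 2 := by
  have c : Continuous fun s => pF G 0 * s + √s := by fun_prop
  have h := (c.tendsto 0).eventually_lt_const (u := -e₀ / 2) (by simp; linarith [hB.e0])
  obtain ⟨s, h1, h2⟩ := ((h.filter_mono nhdsWithin_le_nhds).and (self_mem_nhdsWithin (a := (0:ℝ)) (s := Ioi 0))).exists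
  exact ⟨s, h2, h1⟩

lemma s0_low {G ρ E e₀ Φ R} (hB : BG G ρ E e₀ Φ R) {s0 : ℝ} (h : pF G 0 * s0 + √s0 < -e₀ / 2) {e l s k n : ℝ}
    (he : e ≤ e₀) (hl : 0 ≤ l) (hs : 0 ≤ s) (hn : n ≤ 1) (hk : k ≤ n * √s - e₀ / 2) (hX : 0 ≤ XX G e l s + k) : s0 ≤ s := by
  by_contra hc
  have h1 := UF_le hB.rm.toRF hs
  have h2 : pF G 0 * s ≤ pF G 0 * s0 := mul_le_mul_of_nonneg_left (not_le.1 hc).le (pF_nonneg hB.rm.toRF 0)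
  have h3 : n * √s ≤ √s0 := (mul_le_of_le_one_left (by positivity) hn).trans (Real.sqrt_le_sqrt (not_le.1 hc).le)
  have h4 : 0 ≤ l * s ^ 2 := by positivity
  unfold XX at hX; linarith

lemma orb_low {G ρ E e₀ Φ R} (hB : BG G ρ E e₀ Φ R) {s0 : ℝ} (h : pF G 0 * s0 + √s0 < -e₀ / 2) {e l α β : ℝ}
    (he : e ≤ e₀) (o : Orb G e l α β) : s0 ≤ α :=
  s0_low hB h (k := 0) (n := 1) he o.l0.le o.a0.le le_rfl
    (by have := Real.sqrt_nonneg α; linarith [hB.e0]) (by rw [o.xa, add_zero])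

lemma sI_split {α β : ℝ} (hα : 0 < α) (X k : ℝ → ℝ) :
    ∫⁻ s in Ioi 0, sI X k s = (∫⁻ s in Ioo α β, sI X k s) + ∫⁻ s in Ioi 0 \ Ioo α β, sI X k s := by
  rw [← lintegral_inter_add_sdiff _ _ (measurableSet_Ioo (a := α) (b := β)),
    inter_eq_right.2 (show Ioo α β ⊆ Ioi 0 from fun s hs => hα.trans hs.1)]

lemma bad_orb {G ρ E e₀ Φ R} (hB : BG G ρ E e₀ Φ R) {s0 : ℝ} (h0 : 0 < s0) (h : pF G 0 * s0 + √s0 < -e₀ / 2) :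
    ∃ C, 0 ≤ C ∧ ∀ (e l α β N : ℝ) (d : ℝ → ℝ), e ≤ e₀ → Orb G e l α β → 0 < N → N ≤ 1 →
      (∀ s, 0 ≤ s → |d s| ≤ N * √s) → ∫⁻ s in Ioi 0, sI (XX G e l) d s ≤ ofReal (C * (N ^ 2 * (√l)⁻¹)) := by
  refine ⟨3 / 2 * s0⁻¹ * 6 + 2 * (3 / √√s0 * (s0⁻¹ + 1) * √(2 / √s0)), by positivity, fun e l α β N d he o hN hN1 hd => ?_⟩
  have hl := o.l0
  have la := orb_low hB h he o
  rw [sI_split o.a0, add_mul, ofReal_add (by positivity) (by positivity)]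
  refine add_le_add ?_ ?_
  · have : 3 / 2 * s0⁻¹ * 6 * (N ^ 2 * (√l)⁻¹) = (3 / 2 * s0⁻¹ * N ^ 2 * (√l)⁻¹) * 6 := by ring
    rw [this, ofReal_mul (by positivity)]
    refine le_trans ?_ (mul_le_mul_right (beta_half o.ab) _)
    rw [← lcmul]
    refine setLIntegral_mono' measurableSet_Ioo fun s hs => ?_
    have hs0 : s0 ≤ s := la.trans hs.1.le
    have sp := h0.trans_le hs0
    rw [← ofReal_mul (by positivity)]
    refine (mul_le_mul_right (I_pos1 (orb_pos o hs)) _).trans ?_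
    rw [← ofReal_mul (by positivity)]
    refine ofReal_le_ofReal ?_
    have h1 : d s ^ 2 ≤ N ^ 2 * s := by
      have := pow_le_pow_left₀ (abs_nonneg _) (hd s sp.le) 2
      rwa [sq_abs, mul_pow, Real.sq_sqrt sp.le] at this
    have h2 := inv_sqrt_le o.l0 (mul_pos (sub_pos.2 hs.1) (sub_pos.2 hs.2)) (o.inn s (Ioo_subset_Icc_self hs))
    calc _ = 3 / 2 * ((s ^ 2)⁻¹ * d s ^ 2) * (√(2 * XX G e l s))⁻¹ := by ring
      _ ≤ 3 / 2 * (s0⁻¹ * N ^ 2) * ((√l)⁻¹ * ((s - α) * (β - s)) ^ (-1 / 2 : ℝ)) := by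
        have : (s ^ 2)⁻¹ * d s ^ 2 ≤ s0⁻¹ * N ^ 2 := calc
          (s ^ 2)⁻¹ * d s ^ 2 ≤ (s ^ 2)⁻¹ * (N ^ 2 * s) := by gcongr
          _ = s⁻¹ * N ^ 2 := by field_simp
          _ ≤ _ := by gcongr
        exact mul_le_mul (by linarith) h2 (by positivity) (by positivity)
      _ = _ := by ring
  · set c := √(2 / √s0) * √N * (√l)⁻¹ with hc
    have c2 : c ^ 2 = 2 * N / (l * √s0) := by
      rw [hc, mul_pow, mul_pow, inv_pow, Real.sq_sqrt (by positivity), Real.sq_sqrt hN.le, Real.sq_sqrt hl.le]; field_simp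
    refine (outer (n := N) (c := c) h0 (by positivity) hN.le (fun s hs => orb_neg o hs) fun s hs hns hp => ?_).trans
      (le_of_eq ?_)
    · have hk := (le_abs_self _).trans (hd s hs.le)
      have hs0 := s0_low hB h he hl.le hs.le hN1 (by linarith [hB.e0]) hp.le
      have ho := o.out s hns
      have key : ∀ u, u ^ 2 ≤ -((s - α) * (β - s)) → u ^ 2 ≤ c ^ 2 * s := fun u hu => by
        rw [c2, div_mul_eq_mul_div, le_div_iff₀ (by positivity)]
        have h1 : l * u ^ 2 ≤ 2 * (N * √s) := by nlinarith
        have h2 : √s * √s0 ≤ s := by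
          calc √s * √s0 ≤ √s * √s := by gcongr
            _ = s := Real.mul_self_sqrt hs.le
        calc u ^ 2 * (l * √s0) = l * u ^ 2 * √s0 := by ring
          _ ≤ 2 * (N * √s) * √s0 := by gcongr
          _ = 2 * N * (√s * √s0) := by ring
          _ ≤ _ := by gcongr
      have := o.ab
      exact ⟨hs0, hk, fun h => key _ (by nlinarith), fun h => key _ (by nlinarith)⟩
    · congr 1
      have : √N * √N = N := Real.mul_self_sqrt hN.le
      rw [hc]
      calc _ = 2 * (3 / √√s0 * (s0⁻¹ + 1) * √(2 / √s0)) * (N * (√N * √N) * (√l)⁻¹) := by ring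
        _ = _ := by rw [this]; ring

lemma good_orb {G ρ E e₀ Φ R} (hB : BG G ρ E e₀ Φ R) {s0 : ℝ} (h0 : 0 < s0) (h : pF G 0 * s0 + √s0 < -e₀ / 2)
    {B l0 L0 : ℝ} (hBp : 0 < B) (hl0 : 0 < l0) (hL0 : 0 < L0) :
    ∃ C, 0 ≤ C ∧ ∀ (e l α β N : ℝ) (g : T3 → ℝ), e ≤ e₀ → Orb G e l α β → (∀ s ∈ Ioo α β, 0 < ρ s) → RF g →
      0 < N → N ≤ 1 → N * √B ≤ -e₀ / 2 → β ≤ B → l0 ≤ l → L0 ≤ β - α → (∀ s, 0 ≤ s → |UF g s - UF G s| ≤ N * √s) →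
      ∃ μ, |μ| ≤ √B ∧ ∫⁻ s in Ioi 0, sI (XX G e l) (fun s => UF g s - UF G s + μ) s ≤
        (∫⁻ s in Ioo α β, ofReal ((pF g s - pF G s) ^ 2 / (pF G s + ρ s / s ^ 3) * (√(2 * XX G e l s) / s))) +
          ofReal (C * (N ^ 2 * √√N)) := by
  set K := 2 * √B with hK
  set b0 := (L0 / 2) ^ (-3 / 4 : ℝ) * (2 * (B ^ (-3 / 4 + 1 : ℝ) / (-3 / 4 + 1))) with hb0
  set m := 1 + √(B / s0) with hm
  have b00 : 0 ≤ b0 := by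
    have : (0:ℝ) ≤ B ^ (-3 / 4 + 1 : ℝ) / (-3 / 4 + 1) := div_nonneg (by positivity) (by norm_num)
    positivity
  refine ⟨(s0 ^ 2)⁻¹ * (2 * K ^ 2 * √√K) * (√√(l0 / 2) ^ 3)⁻¹ * b0 +
    2 * (3 * (m * √m) / √√s0 * (s0⁻¹ + 1) * (2 * m / (l0 * L0))), by positivity, ?_⟩
  intro e l α β N g he o hρ hg hN hN1 hNB hβ hl hL hd
  have lp := o.l0
  have la := orb_low hB h he o
  obtain ⟨μ, hμ, hvar⟩ := orb_var hB o hρ hg (C := N * √B) fun s hs =>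
    (hd s (o.a0.trans hs.1).le).trans (by gcongr; exact hs.2.le.trans hβ)
  refine ⟨μ, hμ.trans (mul_le_of_le_one_left (by positivity) hN1), ?_⟩
  rw [sI_split o.a0, add_mul, ofReal_add (by positivity) (by positivity), ← add_assoc]
  refine add_le_add (le_trans ?_ (add_le_add hvar le_rfl)) ?_
  · have : (s0 ^ 2)⁻¹ * (2 * K ^ 2 * √√K) * (√√(l0 / 2) ^ 3)⁻¹ * b0 * (N ^ 2 * √√N) =
      (s0 ^ 2)⁻¹ * (2 * K ^ 2 * √√K) * (√√(l0 / 2) ^ 3)⁻¹ * (N ^ 2 * √√N) * b0 := by ring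
    rw [this, ofReal_mul (by positivity)]
    have hbeta : ∫⁻ s in Ioo α β, ofReal (((s - α) * (β - s)) ^ (-3 / 4 : ℝ)) ≤ ofReal b0 := by
      refine (beta_lint (by norm_num) (by norm_num) o.ab).trans (ofReal_le_ofReal ?_)
      have h1 : ((β - α) / 2) ^ (-3 / 4 : ℝ) ≤ (L0 / 2) ^ (-3 / 4 : ℝ) :=
        Real.rpow_le_rpow_of_nonpos (by positivity) (by linarith) (by norm_num)
      have h2 : (β - α) ^ (-3 / 4 + 1 : ℝ) ≤ B ^ (-3 / 4 + 1 : ℝ) :=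
        Real.rpow_le_rpow (by linarith [o.ab]) (by linarith [o.a0]) (by norm_num)
      have h3 : 0 ≤ (β - α) ^ (-3 / 4 + 1 : ℝ) := Real.rpow_nonneg (by linarith [o.ab]) _
      rw [hb0]
      refine mul_le_mul h1 ?_ (by norm_num; linarith) (by positivity)
      norm_num at *; linarith
    refine le_trans ?_ (add_le_add le_rfl (mul_le_mul_right hbeta _))
    have Xm := (XX_cont hB.rm.toRF e l).measurable
    have Um := (UF_cont hB.rm.toRF).measurable
    have Ug := (UF_cont hg).measurable
    rw [← lcmul, ← lintegral_add_left (by fun_prop)]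
    refine setLIntegral_mono' measurableSet_Ioo fun s hs => ?_
    have hs0 : s0 ≤ s := la.trans hs.1.le
    have sp := h0.trans_le hs0
    refine (mul_le_mul_right (I_pos2 (orb_pos o hs)) _).trans ?_
    set k := UF g s - UF G s + μ with hk
    have hk1 : |k| ≤ K * N := by
      have h1 := hd s sp.le
      have h2 : √s ≤ √B := Real.sqrt_le_sqrt (hs.2.le.trans hβ)
      calc |k| ≤ N * √s + N * √B := (abs_add_le _ _).trans (add_le_add h1 hμ)
        _ ≤ N * √B + N * √B := by gcongr
        _ = K * N := by rw [hK]; ring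
    have h2 := inv_34_le (half_pos hl0) (mul_pos (sub_pos.2 hs.1) (sub_pos.2 hs.2))
      ((mul_le_mul_of_nonneg_right (by linarith) (mul_pos (sub_pos.2 hs.1) (sub_pos.2 hs.2)).le).trans
        (o.inn s (Ioo_subset_Icc_self hs)))
    have q0 : 0 ≤ ((s - α) * (β - s)) ^ (-3 / 4 : ℝ) :=
      Real.rpow_nonneg (mul_pos (sub_pos.2 hs.1) (sub_pos.2 hs.2)).le _
    rw [← ofReal_mul (by positivity), ← ofReal_mul (by positivity), ← ofReal_add (by positivity) (by positivity)]
    refine ofReal_le_ofReal ?_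
    rw [mul_add]
    refine add_le_add (le_of_eq (by rw [mul_inv]; ring)) ?_
    have k1 : k ^ 2 ≤ K ^ 2 * N ^ 2 := by rw [← sq_abs, ← mul_pow]; gcongr
    have k2 : √√|k| ≤ √√K * √√N := by
      rw [← Real.sqrt_mul (by positivity), ← Real.sqrt_mul (by positivity)]; gcongr
    calc _ ≤ (s0 ^ 2)⁻¹ * (2 * (K ^ 2 * N ^ 2) * (√√K * √√N) * ((√√(l0 / 2) ^ 3)⁻¹ * ((s - α) * (β - s)) ^ (-3 / 4 : ℝ))) := by
          refine mul_le_mul (by gcongr) (mul_le_mul ?_ h2 (by positivity) (by positivity)) (by positivity) (by positivity)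
          exact mul_le_mul (by linarith) k2 (by positivity) (by positivity)
      _ = _ := by ring
  · have n0 : 0 < m * N := by positivity
    refine (outer (n := m * N) (c := 2 * (m * N) / (l0 * L0)) h0 (by positivity) n0.le (fun s hs => orb_neg o hs)
      fun s hs hns hp => ?_).trans (ofReal_le_ofReal ?_)
    · have hk : UF g s - UF G s + μ ≤ N * √s + N * √B :=
        add_le_add ((le_abs_self _).trans (hd s hs.le)) ((le_abs_self _).trans hμ)
      have hs0 := s0_low hB h he lp.le hs.le hN1 (by linarith) hp.le
      have ho := o.out s hns
      have e1 : √B ≤ √(B / s0) * √s := by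
        rw [← Real.sqrt_mul (by positivity), div_mul_eq_mul_div]
        exact Real.sqrt_le_sqrt ((le_div_iff₀ h0).2 (by gcongr))
      have hk2 : UF g s - UF G s + μ ≤ m * N * √s := by
        have : N * √B ≤ N * (√(B / s0) * √s) := by gcongr
        rw [hm]; linarith
      have hs2 : √s ^ 2 = s := Real.sq_sqrt hs.le
      have key : ∀ u, 0 ≤ u → u * (β - α) ≤ -((s - α) * (β - s)) → u ^ 2 ≤ (2 * (m * N) / (l0 * L0)) ^ 2 * s := fun u hu0 hu => by
        have : u ≤ 2 * (m * N) / (l0 * L0) * √s := by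
          rw [div_mul_eq_mul_div, le_div_iff₀ (by positivity)]
          have h1 : l * (u * (β - α)) ≤ 2 * (m * N * √s) := by nlinarith
          calc u * (l0 * L0) ≤ u * (l * (β - α)) := by gcongr
            _ ≤ _ := by linarith
        calc u ^ 2 ≤ (2 * (m * N) / (l0 * L0) * √s) ^ 2 := by gcongr
          _ = _ := by rw [mul_pow, hs2]
      have := o.ab
      exact ⟨hs0, hk2, fun h => key _ (by linarith) (by nlinarith), fun h => key _ (by linarith) (by nlinarith)⟩
    · have e1 : √N ≤ √√N := Real.sqrt_le_sqrt (by
        rw [Real.le_sqrt hN.le hN.le]; nlinarith)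
      rw [Real.sqrt_mul (by positivity)]
      calc _ = 2 * (3 * (m * √m) / √√s0 * (s0⁻¹ + 1) * (2 * m / (l0 * L0))) * (N ^ 2 * √N) := by ring
        _ ≤ _ := by gcongr


def DS (G : T3 → ℝ) (E : T2 → ℝ) : Set (T2) :=
  {y | 0 < y.1 ∧ 0 < y.2 ∧ ∃ q : ℚ, 0 < (q:ℝ) ∧ 0 < XX G (E y) y.2 q}

section
variable {G : T3 → ℝ} {ρ : ℝ → ℝ} {E : T2 → ℝ} {e₀ Φ R : ℝ}

lemma XX_meas (hB : BG G ρ E e₀ Φ R) : Measurable fun z : (T2) × ℝ => XX G (E z.1) z.1.2 z.2 := by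
  have h1 := hB.Em
  have h2 := (UF_cont hB.rm.toRF).measurable
  unfold XX
  fun_prop

lemma XX_meas1 (hB : BG G ρ E e₀ Φ R) (s : ℝ) : Measurable fun y : T2 => XX G (E y) y.2 s :=
  (XX_meas hB).comp (g := fun z : (T2) × ℝ => XX G (E z.1) z.1.2 z.2) (f := fun y => (y, s)) (by fun_prop)

lemma DS_meas (hB : BG G ρ E e₀ Φ R) : MeasurableSet (DS G E) := by
  have : DS G E = {y | 0 < y.1} ∩ ({y | 0 < y.2} ∩ ⋃ q : ℚ, {y | 0 < (q:ℝ) ∧ 0 < XX G (E y) y.2 q}) := by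
    ext y; simp [DS]
  rw [this]
  exact (measurableSet_lt measurable_const measurable_fst).inter ((measurableSet_lt measurable_const measurable_snd).inter
    (MeasurableSet.iUnion fun q => (MeasurableSet.const _).inter (measurableSet_lt measurable_const (XX_meas1 hB q))))

lemma orb_D (hB : BG G ρ E e₀ Φ R) {y : T2} (hy : y ∈ DS G E) : ∃ α β, Orb G (E y) y.2 α β ∧ (∀ s ∈ Ioo α β, 0 < ρ s) ∧
    0 < pF G β ∧ y.2 * β ^ 2 ≤ 2 * Φ ∧ y.1 < R := by
  obtain ⟨h1, h2, q, hq, hX⟩ := hy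
  obtain ⟨α, β, o, hs⟩ := orb_exists hB (hB.E2 y) h2 hq hX
  have hG : ∀ s ∈ Ioo α β, y.1 < G (y.2, (s, 0)) := fun s hs =>
    (hB.lev y.1 y.2 s 0 h1 h2 (o.a0.trans hs.1)).2 (by simpa [XX] using orb_pos o hs)
  have hβ : 0 < β := o.a0.trans o.ab
  have hGβ : y.1 ≤ G (y.2, (β, 0)) := by
    have hc : ContinuousAt (fun s : ℝ => G (y.2, (s, 0))) β :=
      ((hB.gc y.2).continuousAt ((isOpen_Ioi.prod isOpen_univ).mem_nhds (show (β, (0:ℝ)) ∈ _ from ⟨hβ, mem_univ _⟩))).comp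
        (f := fun s : ℝ => (s, (0:ℝ))) (x := β) (by fun_prop)
    refine ge_of_tendsto (hc.tendsto.mono_left nhdsWithin_le_nhds : Tendsto _ (𝓝[<] β) _) ?_
    filter_upwards [Ioo_mem_nhdsLT o.ab] with s hs
    exact (hG s hs).le
  refine ⟨α, β, o, fun s hs => hB.rpos s y.2 0 (o.a0.trans hs.1) h2 (h1.trans (hG s hs)), ?_, ?_,
    (hG q hs).trans_le (hB.le _)⟩
  · have hp := pF_nonneg hB.rm.toRF
    refine lt_of_le_of_ne (hp β) fun h0 => ?_
    have hm : IsLocalMin (pF G) β := Eventually.of_forall fun s => by rw [← h0]; exact hp s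
    have := hm.hasDerivAt_eq_zero (hB.dp β hβ)
    have h3 : 0 < ρ β / β ^ 4 := div_pos (hB.rpos β y.2 0 hβ h2 (h1.trans_le hGβ)) (by positivity)
    linarith
  · have h3 := o.xb
    have h4 := hB.UΦ β hβ.le
    have h5 := hB.E2 y
    have h6 := hB.e0
    unfold XX at h3
    linarith

lemma sum_sqrt (hB : BG G ρ E e₀ Φ R) {s : ℝ} (hs : 0 < s) :
    ∫⁻ y, ofReal √(2 * XX G (E y) y.2 s) ∂(HM.prod HM) = ofReal (ρ s / (2 * π * s ^ 2)) := by
  have e1 : ∀ X : ℝ, ofReal (2 * √(2 * X)) = ∫⁻ w, {w : ℝ | w ^ 2 / 2 < X}.indicator 1 w := by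
    intro X
    have hm : {w : ℝ | w ^ 2 / 2 < X} = Ioo (-√(2 * X)) √(2 * X) := by
      ext w
      rw [mem_Ioo, ← abs_lt, Real.lt_sqrt (abs_nonneg w), sq_abs, mem_ofPred_eq]
      constructor <;> intro h <;> linarith
    rw [hm, lintegral_indicator_one measurableSet_Ioo, Real.volume_Ioo]
    congr 1; ring
  have hms : MeasurableSet {z : (T2) × ℝ | z.2 ^ 2 / 2 < XX G (E z.1) z.1.2 s} :=
    measurableSet_lt (by fun_prop) ((XX_meas1 hB s).comp measurable_fst)
  have h2 : ofReal 2 * ∫⁻ y, ofReal √(2 * XX G (E y) y.2 s) ∂(HM.prod HM) =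
      ofReal (ρ s / (π * s ^ 2)) := by
    rw [← lcmul, ← hB.rint s hs]
    simp only [← ofReal_mul zero_le_two, e1]
    rw [lintegral_lintegral_swap (f := fun y w => {w : ℝ | w ^ 2 / 2 < XX G (E y) y.2 s}.indicator (1 : ℝ → ℝ≥0∞) w)
      (by exact (measurable_one.indicator hms).aemeasurable)]
    refine lintegral_congr fun w => ?_
    rw [lintegral_prod_symm' (μ := HM) (ν := HM) (fun y : T2 => {w : ℝ | w ^ 2 / 2 < XX G (E y) y.2 s}.indicator (1 : ℝ → ℝ≥0∞) w)
      (by exact (measurable_one.indicator hms).comp (measurable_id.prodMk measurable_const : Measurable fun y : T2 => (y, w)))]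
    refine slcongr fun l hl => ?_
    have e3 : ∀ σ ∈ Ioi (0:ℝ), {w : ℝ | w ^ 2 / 2 < XX G (E (σ, l)) (σ, l).2 s}.indicator (1 : ℝ → ℝ≥0∞) w =
        (Iio (G (l, (s, w)))).indicator 1 σ := fun σ hσ => by
      have := hB.lev σ l s w hσ hl hs
      by_cases h : σ < G (l, (s, w))
      · rw [indicator_of_mem (show w ∈ {w | w ^ 2 / 2 < XX G (E (σ, l)) (σ, l).2 s} from this.1 h), indicator_of_mem (show σ ∈ Iio _ from h)]; rfl
      · rw [indicator_of_notMem (show w ∉ {w | w ^ 2 / 2 < XX G (E (σ, l)) (σ, l).2 s} from fun h' => h (this.2 h')), indicator_of_notMem (show σ ∉ Iio _ from h)]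
    rw [HM, slcongr e3, lintegral_indicator_one measurableSet_Iio,
      Measure.restrict_apply measurableSet_Iio, inter_comm, Ioi_inter_Iio, Real.volume_Ioo, sub_zero]
  have h3 : ρ s / (π * s ^ 2) = 2 * (ρ s / (2 * π * s ^ 2)) := by field_simp
  rw [h3, ofReal_mul zero_le_two] at h2
  exact (ENNReal.mul_right_inj (by simp) (by simp)).1 h2

lemma rho_low (hB : BG G ρ E e₀ Φ R) {s0 s : ℝ} (h : pF G 0 * s0 + √s0 < -e₀ / 2) (hs : 0 < s) (hr : 0 < ρ s) : s0 ≤ s := by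
  by_contra hn
  have h1 := sum_sqrt hB hs
  have h2 : ∫⁻ y, ofReal √(2 * XX G (E y) y.2 s) ∂(HM.prod HM) = 0 := by
    rw [HM, Measure.prod_restrict, ← lintegral_zero (μ := ((volume : Measure ℝ).prod volume).restrict (Ioi (0:ℝ) ×ˢ Ioi (0:ℝ)))]
    refine setLIntegral_congr_fun (measurableSet_Ioi.prod measurableSet_Ioi) fun y hy => ?_
    rw [ENNReal.ofReal_eq_zero, Real.sqrt_eq_zero_of_nonpos]
    by_contra h3
    exact hn (s0_low hB h (hB.E2 y) (le_of_lt hy.2) hs.le (n := 0) zero_le_one (k := 0) (by linarith [hB.e0]) (by linarith))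
  rw [h2] at h1
  have := ENNReal.ofReal_eq_zero.1 h1.symm
  have h4 : 0 < ρ s / (2 * π * s ^ 2) := by positivity
  linarith

def lead (G : T3 → ℝ) (ρ : ℝ → ℝ) (E : T2 → ℝ) (g : T3 → ℝ) (y : T2) (s : ℝ) : ℝ≥0∞ :=
  ofReal ((pF g s - pF G s) ^ 2 / (pF G s + ρ s / s ^ 3) * (√(2 * XX G (E y) y.2 s) / s))

lemma lead_meas (hB : BG G ρ E e₀ Φ R) {g} (hg : RF g) : Measurable fun z : (T2) × ℝ => lead G ρ E g z.1 z.2 := by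
  have h1 := (pF_cont hg).measurable
  have h2 := (pF_cont hB.rm.toRF).measurable
  have h3 := XX_meas hB
  have h4 := hB.rmeas
  unfold lead
  fun_prop

lemma lead_sum (hB : BG G ρ E e₀ Φ R) {g} (hg : RF g) {T : Set ℝ} (hT : MeasurableSet T) (hT0 : T ⊆ Ioi 0) :
    ofReal (4 * π ^ 2) * ∫⁻ y, (∫⁻ s in T, lead G ρ E g y s) ∂(HM.prod HM) =
      ofReal (2 * π) * ∫⁻ s in T, ofReal (ρ s / (ρ s + s ^ 3 * pF G s) * (pF g s - pF G s) ^ 2) := by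
  rw [lintegral_lintegral_swap (lead_meas hB hg).aemeasurable, ← lcmul,
    ← lcmul]
  refine setLIntegral_congr_fun hT fun s hs => ?_
  have hs : 0 < s := hT0 hs
  have hp := pF_nonneg hB.rm.toRF s
  have hr := hB.r0 s
  have e : ∀ y, lead G ρ E g y s = ofReal ((pF g s - pF G s) ^ 2 / (pF G s + ρ s / s ^ 3) / s) *
      ofReal √(2 * XX G (E y) y.2 s) := fun y => by
    rw [lead, ← ofReal_mul (by positivity)]; congr 1; ring
  simp only [e]
  rw [lcmul, sum_sqrt hB hs, ← ofReal_mul (by positivity),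
    ← ofReal_mul (by positivity), ← ofReal_mul (by positivity)]
  congr 1
  have : pF G s + ρ s / s ^ 3 = (ρ s + s ^ 3 * pF G s) / s ^ 3 := by field_simp; ring
  rw [this]
  rcases eq_or_ne (ρ s + s ^ 3 * pF G s) 0 with h | h
  · rw [h]; simp
  · field_simp; ring

def WM (G : T3 → ℝ) (E : T2 → ℝ) : Measure (T2) :=
  ((HM.prod HM).restrict (DS G E)).withDensity fun y => ofReal (√y.2)⁻¹

lemma D_fin (hB : BG G ρ E e₀ Φ R) : (HM.prod HM) (DS G E) < ⊤ ∧ WM G E univ < ⊤ := by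
  obtain ⟨s0, h0, h⟩ := exists_s0 hB
  have hsub : DS G E ⊆ Ioc 0 R ×ˢ Ioc 0 (2 * Φ / s0 ^ 2) := fun y hy => by
    obtain ⟨α, β, o, -, -, h3, h4⟩ := orb_D hB hy
    refine ⟨⟨hy.1, h4.le⟩, hy.2.1, ?_⟩
    rw [le_div_iff₀ (by positivity)]
    have := (orb_low hB h (hB.E2 y) o).trans o.ab.le
    have : s0 ^ 2 ≤ β ^ 2 := by gcongr
    nlinarith [hy.2.1]
  have hH : ∀ c, HM (Ioc 0 c) < ⊤ := fun c =>
    (Measure.restrict_apply_le _ _).trans_lt (by simp)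
  have hsub2 := Measure.restrict_mono_set (HM.prod HM) hsub
  constructor
  · refine (measure_mono hsub).trans_lt ?_
    rw [Measure.prod_prod]
    exact ENNReal.mul_lt_top (hH _) (hH _)
  · rw [WM, withDensity_apply _ MeasurableSet.univ, Measure.restrict_univ]
    refine (lintegral_mono' hsub2 le_rfl).trans_lt ?_
    rw [← Measure.prod_restrict, lintegral_prod _ (by fun_prop)]
    simp only [lintegral_const, Measure.restrict_apply MeasurableSet.univ, univ_inter]
    refine ENNReal.mul_lt_top ?_ (hH _)
    have hi : IntervalIntegrable (fun x : ℝ => x ^ (-1/2 : ℝ)) volume 0 (2 * Φ / s0 ^ 2) :=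
      intervalIntegral.intervalIntegrable_rpow' (by norm_num)
    refine (lintegral_mono' (Measure.restrict_mono_measure Measure.restrict_le_self _) le_rfl).trans_lt ?_
    have h2 := hi.1.2
    rw [hasFiniteIntegral_iff_norm] at h2
    refine lt_of_eq_of_lt (setLIntegral_congr_fun measurableSet_Ioc fun x hx => ?_) h2
    have hx : 0 < x := hx.1
    rw [Real.norm_of_nonneg (by positivity), Real.sqrt_eq_rpow, ← Real.rpow_neg hx.le]
    norm_num

lemma W_small (hB : BG G ρ E e₀ Φ R) {Z : ℕ → Set (T2)} (hZ : ∀ n, MeasurableSet (Z n)) (ha : Antitone Z)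
    (h : ∀ y ∈ DS G E, ∃ n, y ∉ Z n) {ε : ℝ} (hε : 0 < ε) : ∃ n, WM G E (Z n) ≤ ofReal ε := by
  have h1 := tendsto_measure_iInter_atTop (μ := WM G E) (fun n => (hZ n).nullMeasurableSet) ha
    ⟨0, ((measure_mono (subset_univ _)).trans_lt (D_fin hB).2).ne⟩
  have h2 : WM G E (⋂ n, Z n) = 0 := by
    rw [WM]
    refine withDensity_absolutelyContinuous _ _ ?_
    rw [Measure.restrict_apply (MeasurableSet.iInter hZ)]
    refine measure_mono_null (t := ∅) (fun y hy => ?_) measure_empty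
    obtain ⟨n, hn⟩ := h y hy.2
    exact (hn (mem_iInter.1 hy.1 n)).elim
  rw [h2] at h1
  exact (h1.eventually (ge_mem_nhds (ENNReal.ofReal_pos.2 hε))).exists

end


section
variable {G : T3 → ℝ} {ρ : ℝ → ℝ} {E : T2 → ℝ} {e₀ Φ R : ℝ}

lemma CP_sum (hB : BG G ρ E e₀ Φ R) {g} (hg : RF g) {S : Set (T2)} {T : Set ℝ} (hS : MeasurableSet S)
    (hT : MeasurableSet T) (hT0 : T ⊆ Ioi 0) {a b Λ : ℝ} (hb : 0 ≤ b) (hΛ : 0 ≤ Λ)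
    (good : ∀ y ∈ S ∩ DS G E, ∃ μ, |μ| ≤ Λ ∧ ∫⁻ s in Ioi 0, sI (XX G (E y) y.2) (fun s => UF g s - UF G s + μ) s ≤
      (∫⁻ s in T, lead G ρ E g y s) + ofReal a)
    (bad : ∀ y ∈ DS G E, ∫⁻ s in Ioi 0, sI (XX G (E y) y.2) (fun s => UF g s - UF G s) s ≤ ofReal (b * (√y.2)⁻¹)) :
    ∃ P : T2 → ℝ≥0∞, Measurable P ∧ (∀ y ∈ DS G E, ∃ μ, |μ| ≤ Λ ∧
      ∫⁻ s in Ioi 0, sI (XX G (E y) y.2) (fun s => UF g s - UF G s + μ) s ≤ P y) ∧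
      ofReal (4 * π ^ 2) * ∫⁻ y in DS G E, P y ∂(HM.prod HM) ≤
      ofReal (2 * π) * (∫⁻ s in T, ofReal (ρ s / (ρ s + s ^ 3 * pF G s) * (pF g s - pF G s) ^ 2)) +
      ofReal (4 * π ^ 2) * (ofReal a * (HM.prod HM) (DS G E) + ofReal b * WM G E Sᶜ) := by
  classical
  have hlm : Measurable fun y => ∫⁻ s in T, lead G ρ E g y s := (lead_meas hB hg).lintegral_prod_right'
  set P : T2 → ℝ≥0∞ := fun y => if y ∈ S then (∫⁻ s in T, lead G ρ E g y s) + ofReal a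
    else ofReal (b * (√y.2)⁻¹) with hP
  refine ⟨P, Measurable.ite hS (hlm.add measurable_const) (by fun_prop), fun y hy => ?_, ?_⟩
  · by_cases h : y ∈ S
    · simp only [hP, if_pos h]; exact good y ⟨h, hy⟩
    · simp only [hP, if_neg h]
      exact ⟨0, by simpa using hΛ, by simpa using bad y hy⟩
  · rw [← lead_sum hB hg hT hT0, ← mul_add]
    refine mul_le_mul_right ?_ _
    have h1 : ∀ y, P y ≤ (∫⁻ s in T, lead G ρ E g y s) + (ofReal a + Sᶜ.indicator (fun y => ofReal (b * (√y.2)⁻¹)) y) := by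
      intro y
      by_cases h : y ∈ S
      · simp only [hP, if_pos h]; exact add_le_add le_rfl le_self_add
      · simp only [hP, if_neg h]
        rw [indicator_of_mem (show y ∈ Sᶜ from h)]
        exact le_add_self.trans le_add_self
    refine (lintegral_mono h1).trans ?_
    rw [lintegral_add_left hlm, lintegral_add_left measurable_const]
    refine add_le_add (setLIntegral_le_lintegral _ _) (add_le_add ?_ ?_)
    · rw [lintegral_const, Measure.restrict_apply MeasurableSet.univ, univ_inter]
    · rw [lintegral_indicator hS.compl, WM, withDensity_apply _ hS.compl, ← lcmul]
      simp only [ofReal_mul hb, le_refl]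

lemma theta_le (hB : BG G ρ E e₀ Φ R) {s0 c s : ℝ} (h0 : 0 < s0) (h : pF G 0 * s0 + √s0 < -e₀ / 2) (hc : 0 < c)
    (hs : 0 < s) (hp : c ≤ pF G s) : ρ s / (ρ s + s ^ 3 * pF G s) ≤ R / (R + s0 ^ 3 * c) := by
  have hr := hB.r0 s
  have hR := hr.trans (hB.rR s)
  have hp0 := hc.trans_le hp
  rw [div_le_div_iff₀ (by positivity) (by positivity)]
  rcases hr.eq_or_lt with h1 | h1
  · rw [← h1]; simp only [zero_mul, zero_add]; positivity
  · have h2 := rho_low hB h hs h1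
    have h3 : s0 ^ 3 * c ≤ s ^ 3 * pF G s := by gcongr
    have h4 := hB.rR s
    have : 0 ≤ s0 ^ 3 * c := by positivity
    nlinarith [mul_le_mul h4 h3 this hR]

def goodS (G : T3 → ℝ) (E : T2 → ℝ) (n : ℕ) : Set (T2) :=
  {y | 1 / ((n:ℝ) + 1) ≤ y.2} ∩ ⋃ q : ℚ, ⋃ q' : ℚ, {_y | 0 < (q:ℝ) ∧ (q:ℝ) + 1 / ((n:ℝ) + 1) ≤ q'} ∩
    ({y | 0 < XX G (E y) y.2 q} ∩ {y | 0 < XX G (E y) y.2 q'})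

def badS (G : T3 → ℝ) (E : T2 → ℝ) (n : ℕ) : Set (T2) :=
  ⋃ q : ℚ, {_y | 0 < (q:ℝ) ∧ pF G q < 1 / ((n:ℝ) + 1)} ∩ {y | 0 < XX G (E y) y.2 q}

lemma goodS_meas (hB : BG G ρ E e₀ Φ R) (n : ℕ) : MeasurableSet (goodS G E n) :=
  (measurableSet_le measurable_const measurable_snd).inter (MeasurableSet.iUnion fun q => MeasurableSet.iUnion fun q' =>
    (MeasurableSet.const _).inter ((measurableSet_lt measurable_const (XX_meas1 hB q)).inter
      (measurableSet_lt measurable_const (XX_meas1 hB q'))))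

lemma badS_meas (hB : BG G ρ E e₀ Φ R) (n : ℕ) : MeasurableSet (badS G E n) :=
  MeasurableSet.iUnion fun q => (MeasurableSet.const _).inter (measurableSet_lt measurable_const (XX_meas1 hB q))

lemma goodS_small (hB : BG G ρ E e₀ Φ R) {ε : ℝ} (hε : 0 < ε) : ∃ n, WM G E (goodS G E n)ᶜ ≤ ofReal ε := by
  refine W_small hB (fun n => (goodS_meas hB n).compl) (fun n m h => compl_subset_compl.2 ?_) (fun y hy => ?_) hε
  · have h1 : 1 / ((m:ℝ) + 1) ≤ 1 / ((n:ℝ) + 1) := one_div_le_one_div_of_le (by positivity) (by exact_mod_cast Nat.succ_le_succ h)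
    refine inter_subset_inter (fun y (hy : _ ≤ _) => h1.trans hy) (iUnion_mono fun q => iUnion_mono fun q' =>
      inter_subset_inter_left _ fun y hy => ⟨hy.1, by linarith [hy.2]⟩)
  · obtain ⟨α, β, o, -⟩ := orb_D hB hy
    obtain ⟨q, h1, h2⟩ := exists_rat_btwn o.ab
    obtain ⟨q', h3, h4⟩ := exists_rat_btwn h2
    obtain ⟨n, hn⟩ := exists_nat_one_div_lt (lt_min hy.2.1 (sub_pos.2 h3))
    refine ⟨n, fun h => h ⟨(hn.le.trans (min_le_left _ _)), mem_iUnion₂.2 ⟨q, q', ⟨o.a0.trans h1, ?_⟩,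
      orb_pos o ⟨h1, h2⟩, orb_pos o ⟨h1.trans h3, h4⟩⟩⟩⟩
    linarith [min_le_right y.2 ((q':ℝ) - q)]

lemma badS_small (hB : BG G ρ E e₀ Φ R) {ε : ℝ} (hε : 0 < ε) : ∃ n, WM G E (badS G E n) ≤ ofReal ε := by
  refine W_small hB (badS_meas hB) (fun n m h => ?_) (fun y hy => ?_) hε
  · have h1 : 1 / ((m:ℝ) + 1) ≤ 1 / ((n:ℝ) + 1) := one_div_le_one_div_of_le (by positivity) (by exact_mod_cast Nat.succ_le_succ h)
    exact iUnion_mono fun q => inter_subset_inter_left _ fun y hy => ⟨hy.1, hy.2.trans_le h1⟩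
  · obtain ⟨α, β, o, -, hp, -⟩ := orb_D hB hy
    obtain ⟨n, hn⟩ := exists_nat_one_div_lt hp
    refine ⟨n, fun h => ?_⟩
    obtain ⟨q, ⟨h1, h2⟩, h3⟩ := mem_iUnion.1 h
    have h4 : (q:ℝ) ∈ Ioo α β := by
      by_contra h5
      exact absurd h3 (not_lt.2 (orb_neg o h5))
    linarith [pF_anti hB.rm.toRF h4.2.le]

set_option maxHeartbeats 1000000 in
lemma CP (hB : BG G ρ E e₀ Φ R) : ∃ κ δ0 Λ : ℝ, 0 < κ ∧ 0 < δ0 ∧ δ0 ≤ 1 ∧ 0 ≤ Λ ∧ ∀ N g, 0 < N → N ≤ δ0 → RF g →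
    (∀ s, 0 ≤ s → |UF g s - UF G s| ≤ N * √s) →
    ∫⁻ s in Ioi 0, ofReal ((pF g s - pF G s) ^ 2) ≤ ofReal (N ^ 2) →
    ∃ P : T2 → ℝ≥0∞, Measurable P ∧ (∀ y ∈ DS G E, ∃ μ, |μ| ≤ Λ ∧
      ∫⁻ s in Ioi 0, sI (XX G (E y) y.2) (fun s => UF g s - UF G s + μ) s ≤ P y) ∧
      ofReal (4 * π ^ 2) * ∫⁻ y in DS G E, P y ∂(HM.prod HM) ≤ ofReal (2 * π * ((1 - κ) * N ^ 2)) := by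
  obtain ⟨s0, h0, h⟩ := exists_s0 hB
  obtain ⟨C, hC0, hC⟩ := bad_orb hB h0 h
  have hπ := Real.pi_pos
  have hR : 0 ≤ R := (hB.r0 0).trans (hB.rR 0)
  have hΦ : 0 < Φ := by linarith [hB.E1 0, hB.E2 0, hB.e0]
  obtain ⟨j, hj⟩ := badS_small hB (ε := 1 / 8 / (2 * π * (C + 1))) (by positivity)
  set c : ℝ := 1 / ((j:ℝ) + 1) with hc
  have c0 : 0 < c := by positivity
  set θ := R / (R + s0 ^ 3 * c) with hθ
  have θ0 : 0 ≤ θ := by positivity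
  have θ1 : θ < 1 := (div_lt_one (by positivity)).2 (by linarith [show 0 < s0 ^ 3 * c by positivity])
  set κ := min ((1 - θ) / 6) (1 / 16) with hκ
  have κ0 : 0 < κ := lt_min (by linarith) (by norm_num)
  have κ1 : κ ≤ (1 - θ) / 6 := min_le_left _ _
  have κ2 : κ ≤ 1 / 16 := min_le_right _ _
  obtain ⟨i, hi⟩ := goodS_small hB (ε := κ / (2 * π * (C + 1))) (by positivity)
  set B := √(2 * Φ * (i + 1)) with hBB
  have B0 : 0 < B := Real.sqrt_pos.2 (by positivity)
  have i0 : (0:ℝ) < 1 / ((i:ℝ) + 1) := by positivity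
  obtain ⟨C', hC0', hC'⟩ := good_orb hB h0 h B0 i0 i0
  set V := ((HM.prod HM) (DS G E)).toReal with hV
  have hV0 : 0 ≤ V := ENNReal.toReal_nonneg
  have hVe : (HM.prod HM) (DS G E) = ofReal V := (ofReal_toReal (D_fin hB).1.ne).symm
  set δ1 := κ / (2 * π * (C' * V + 1)) with hδ1
  have δ10 : 0 < δ1 := by positivity
  set δ0 := min (min 1 (-e₀ / 2 / √B)) (δ1 ^ 4) with hδ0
  have δ00 : 0 < δ0 := by
    have := hB.e0
    have : 0 < √B := Real.sqrt_pos.2 B0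
    refine lt_min (lt_min one_pos (div_pos (by linarith) this)) (by positivity)
  have δ01 : δ0 ≤ 1 := (min_le_left _ _).trans (min_le_left _ _)
  refine ⟨κ, δ0, √B, κ0, δ00, δ01, Real.sqrt_nonneg _, fun N g hN hNδ hg hd hx => ?_⟩
  have hN1 : N ≤ 1 := hNδ.trans δ01
  have hNB : N * √B ≤ -e₀ / 2 := by
    rw [← le_div_iff₀ (Real.sqrt_pos.2 B0)]
    exact hNδ.trans ((min_le_left _ _).trans (min_le_right _ _))
  have hNq : √√N ≤ δ1 := by
    rw [Real.sqrt_le_left δ10.le, Real.sqrt_le_left (by positivity)]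
    refine (hNδ.trans (min_le_right _ _)).trans (le_of_eq (by ring))
  have bad : ∀ y ∈ DS G E, ∫⁻ s in Ioi 0, sI (XX G (E y) y.2) (fun s => UF g s - UF G s) s ≤
      ofReal (C * N ^ 2 * (√y.2)⁻¹) := fun y hy => by
    obtain ⟨α, β, o, -⟩ := orb_D hB hy
    rw [mul_assoc]
    exact hC _ _ α β N _ (hB.E2 y) o hN hN1 hd
  have good : ∀ y ∈ goodS G E i ∩ DS G E, ∃ α β μ, Orb G (E y) y.2 α β ∧ |μ| ≤ √B ∧
      ∫⁻ s in Ioi 0, sI (XX G (E y) y.2) (fun s => UF g s - UF G s + μ) s ≤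
        (∫⁻ s in Ioo α β, lead G ρ E g y s) + ofReal (C' * (N ^ 2 * √√N)) := by
    rintro y ⟨⟨h1, h2⟩, hy⟩
    have h1 : 1 / ((i:ℝ) + 1) ≤ y.2 := h1
    obtain ⟨α, β, o, hρ, -, hb, -⟩ := orb_D hB hy
    obtain ⟨q, q', ⟨hq, hqq⟩, hX, hX'⟩ := mem_iUnion₂.1 h2
    have hmem : ∀ r : ℝ, 0 < XX G (E y) y.2 r → r ∈ Ioo α β := fun r hr => by
      by_contra h5
      exact absurd hr (not_lt.2 (orb_neg o h5))
    have m1 := (hmem _ hX).1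
    have m2 := (hmem _ hX').2
    have hβ : β ≤ B := by
      refine Real.le_sqrt_of_sq_le ?_
      have : β ^ 2 * (1 / ((i:ℝ) + 1)) ≤ 2 * Φ := by nlinarith [sq_nonneg β]
      rwa [mul_one_div, div_le_iff₀ (by positivity)] at this
    obtain ⟨μ, m3, m4⟩ := hC' _ _ α β N g (hB.E2 y) o hρ hg hN hN1 hNB hβ h1 (by linarith) hd
    exact ⟨α, β, μ, o, m3, m4⟩
  set T : Set ℝ := {s | 0 < s ∧ c ≤ pF G s} with hT
  have hTm : MeasurableSet T := (measurableSet_lt measurable_const measurable_id).inter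
    (measurableSet_le measurable_const (pF_cont hB.rm.toRF).measurable)
  have hT0 : T ⊆ Ioi 0 := fun s hs => hs.1
  set x2 : ℝ → ℝ := fun s => (pF g s - pF G s) ^ 2 with hx2
  set A := (∫⁻ s in T, ofReal (x2 s)).toReal
  set A' := (∫⁻ s in Ioi 0 \ T, ofReal (x2 s)).toReal
  have hAA : (∫⁻ s in T, ofReal (x2 s)) + (∫⁻ s in Ioi 0 \ T, ofReal (x2 s)) ≤ ofReal (N ^ 2) := by
    refine le_of_eq_of_le ?_ hx
    rw [← lintegral_inter_add_sdiff (fun s => ofReal (x2 s)) (Ioi 0) hTm, inter_eq_right.2 hT0]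
  have eA : ∫⁻ s in T, ofReal (x2 s) = ofReal A :=
    (ofReal_toReal ((le_self_add.trans hAA).trans_lt ofReal_lt_top).ne).symm
  have eA' : ∫⁻ s in Ioi 0 \ T, ofReal (x2 s) = ofReal A' :=
    (ofReal_toReal ((le_add_self.trans hAA).trans_lt ofReal_lt_top).ne).symm
  have A0 : 0 ≤ A := ENNReal.toReal_nonneg
  have A0' : 0 ≤ A' := ENNReal.toReal_nonneg
  rw [eA, eA', ← ofReal_add A0 A0', ofReal_le_ofReal_iff (by positivity)] at hAA
  have lT : ∫⁻ s in T, ofReal (ρ s / (ρ s + s ^ 3 * pF G s) * (pF g s - pF G s) ^ 2) ≤ ofReal (θ * A) := by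
    rw [ofReal_mul θ0, ← eA, ← lcmul]
    refine setLIntegral_mono' hTm fun s hs => ?_
    rw [← ofReal_mul θ0]
    exact ofReal_le_ofReal (mul_le_mul_of_nonneg_right (theta_le hB h0 h c0 hs.1 hs.2) (sq_nonneg _))
  have err : ∀ {S : Set (T2)} {η L : ℝ}, WM G E Sᶜ ≤ ofReal (η / (2 * π * (C + 1))) → 0 ≤ η → 0 ≤ L →
      L + (η + κ) * N ^ 2 ≤ (1 - κ) * N ^ 2 → ofReal (2 * π) * ofReal L +
      ofReal (4 * π ^ 2) * (ofReal (C' * (N ^ 2 * √√N)) * (HM.prod HM) (DS G E) +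
        ofReal (C * N ^ 2) * WM G E Sᶜ) ≤ ofReal (2 * π * ((1 - κ) * N ^ 2)) := by
    intro S η L hW hη hL hle
    refine (add_le_add le_rfl (mul_le_mul_right (add_le_add le_rfl (mul_le_mul_right hW _)) _)).trans ?_
    rw [hVe, ← ofReal_mul (by positivity), ← ofReal_mul (by positivity), ← ofReal_mul (by positivity),
      ← ofReal_add (by positivity) (by positivity), ← ofReal_mul (by positivity),
      ← ofReal_add (by positivity) (by positivity)]
    refine ofReal_le_ofReal ?_
    have e1 : 2 * π * (C' * (N ^ 2 * √√N) * V) ≤ κ * N ^ 2 := by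
      have h1 : C' * V * √√N ≤ (C' * V + 1) * δ1 := by
        have : 0 ≤ C' * V := by positivity
        nlinarith [Real.sqrt_nonneg √N]
      have h2 : (C' * V + 1) * δ1 * (2 * π) = κ := by rw [hδ1]; field_simp
      nlinarith [mul_le_mul_of_nonneg_right h1 (show 0 ≤ 2 * π * N ^ 2 by positivity)]
    have e2 : 2 * π * (C * N ^ 2 * (η / (2 * π * (C + 1)))) ≤ η * N ^ 2 := by
      have : 2 * π * (C * N ^ 2 * (η / (2 * π * (C + 1)))) = C / (C + 1) * (η * N ^ 2) := by field_simp
      rw [this]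
      exact mul_le_of_le_one_left (by positivity) ((div_le_one (by positivity)).2 (by linarith))
    refine le_of_eq_of_le (b := 2 * π * (L + (2 * π * (C' * (N ^ 2 * √√N) * V) +
      2 * π * (C * N ^ 2 * (η / (2 * π * (C + 1))))))) (by ring) (mul_le_mul_of_nonneg_left ?_ (by positivity))
    linarith
  have hN2 : 0 < N ^ 2 := by positivity
  rcases le_total (N ^ 2 / 2) A with hA | hA
  · obtain ⟨P, p1, p2, p3⟩ := CP_sum hB hg (goodS_meas hB i) measurableSet_Ioi Subset.rfl (a := C' * (N ^ 2 * √√N))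
      (b := C * N ^ 2) (by positivity) (Real.sqrt_nonneg B) (fun y hy => by
        obtain ⟨α, β, μ, o, m1, m2⟩ := good y hy
        exact ⟨μ, m1, m2.trans (add_le_add (lintegral_mono_set fun s hs => o.a0.trans hs.1) le_rfl)⟩) bad
    refine ⟨P, p1, p2, p3.trans (le_trans (add_le_add (mul_le_mul_right ?_ _) le_rfl)
      (err (L := θ * A + A') hi κ0.le (by positivity) (by nlinarith)))⟩
    rw [← lintegral_inter_add_sdiff _ (Ioi 0) hTm, inter_eq_right.2 hT0, ofReal_add (by positivity) A0', ← eA']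
    refine add_le_add lT (setLIntegral_mono' (measurableSet_Ioi.diff hTm) fun s hs => ?_)
    refine ofReal_le_ofReal (mul_le_of_le_one_left (sq_nonneg _) (div_le_one_of_le₀ ?_ ?_))
    all_goals
      have h1 : 0 < s := hs.1
      have := mul_nonneg (pow_pos h1 3).le (pF_nonneg hB.rm.toRF s)
      linarith [hB.r0 s]
  · obtain ⟨P, p1, p2, p3⟩ := CP_sum hB hg ((goodS_meas hB i).diff (badS_meas hB j)) hTm hT0 (a := C' * (N ^ 2 * √√N))
      (b := C * N ^ 2) (by positivity) (Real.sqrt_nonneg B) (fun y hy => by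
        obtain ⟨α, β, μ, o, m1, m2⟩ := good y ⟨hy.1.1, hy.2⟩
        refine ⟨μ, m1, m2.trans (add_le_add (lintegral_mono_set fun s hs => ⟨o.a0.trans hs.1, ?_⟩) le_rfl)⟩
        by_contra hn
        obtain ⟨q, q1, q2⟩ := exists_rat_btwn hs.2
        refine hy.1.2 (mem_iUnion.2 ⟨q, ⟨o.a0.trans (hs.1.trans q1), ?_⟩, orb_pos o ⟨hs.1.trans q1, q2⟩⟩)
        exact (pF_anti hB.rm.toRF q1.le).trans_lt (not_le.1 hn)) bad
    refine ⟨P, p1, p2, p3.trans (le_trans (add_le_add (mul_le_mul_right lT _) le_rfl)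
      (err (L := θ * A) (η := κ + 1 / 8) ?_ (by positivity) (by positivity) (by nlinarith)))⟩
    rw [sdiff_eq, compl_inter, compl_compl, add_div, ofReal_add (by positivity) (by positivity)]
    exact (measure_union_le _ _).trans (add_le_add hi hj)

end


def ch (g : T3 → ℝ) (z : T4) : ℝ := if z.1.1 < g (z.1.2, z.2) then 1 else 0

def NM : Measure (T4) := (HM.prod HM).prod PM
instance : SigmaFinite NM := by unfold NM; infer_instance

lemma ch_meas {g} (hg : Measurable g) : Measurable (ch g) :=
  Measurable.ite (measurableSet_lt (by fun_prop) (hg.comp (by fun_prop))) measurable_const measurable_const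

lemma ch_01 (g z) : ch g z = 0 ∨ ch g z = 1 := by unfold ch; split_ifs <;> simp

lemma mp_as : MeasurePreserving (MeasurableEquiv.prodAssoc : T4 ≃ᵐ ℝ × (T3)) NM (HM.prod KM) :=
  measurePreserving_prodAssoc HM HM PM

lemma lay_l {k : T3 → ℝ≥0∞} (hk : Measurable k) {g g'} (hg : Measurable g) (hg' : Measurable g') (h0 : ∀ q, 0 ≤ g' q) :
    ∫⁻ z, k (z.1.2, z.2) * ofReal (ch g z - ch g' z) ∂NM = ∫⁻ q, k q * ofReal (g q - g' q) ∂KM := by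
  have hc : Measurable fun x : ℝ × (T3) => k x.2 * ofReal (ch g ((x.1, x.2.1), x.2.2) - ch g' ((x.1, x.2.1), x.2.2)) :=
    (hk.comp measurable_snd).mul (((ch_meas hg).comp (by fun_prop)).sub ((ch_meas hg').comp (by fun_prop))).ennreal_ofReal
  have h1 := mp_as.lintegral_comp hc
  refine Eq.trans h1 ?_
  rw [lintegral_prod_symm _ hc.aemeasurable]
  refine lintegral_congr fun q => ?_
  have : ∀ σ, k q * ofReal (ch g ((σ, q.1), q.2) - ch g' ((σ, q.1), q.2)) = k q * {σ | σ < g q ∧ ¬ σ < g' q}.indicator 1 σ := by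
    intro σ
    classical
    simp only [ch, indicator_apply, mem_ofPred_eq, Pi.one_apply]
    by_cases a : σ < g q <;> by_cases b : σ < g' q <;> simp [a, b]
  simp only [this]
  rw [lintegral_const_mul _ (measurable_one.indicator (by measurability))]
  rw [HM, vol_ico _ _ (h0 q)]

lemma NM_pos : ∀ᵐ z ∂NM, 0 < z.1.1 ∧ 0 < z.1.2 ∧ 0 < z.2.1 := by
  have h1 : ∀ᵐ σ ∂HM, 0 < σ := ae_restrict_mem measurableSet_Ioi
  have h2 := (Measure.quasiMeasurePreserving_fst (μ := HM) (ν := KM)).ae h1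
  have h3 := (Measure.quasiMeasurePreserving_snd (μ := HM) (ν := KM)).ae KM_pos
  filter_upwards [mp_as.quasiMeasurePreserving.ae h2, mp_as.quasiMeasurePreserving.ae h3] with z a b
  exact ⟨a, b⟩

lemma lay_i {a : T3 → ℝ} (ha : Measurable a) {g} (hg : RF g) (hi : Integrable (fun q => a q * g q) KM) :
    Integrable (fun z => a (z.1.2, z.2) * ch g z) NM ∧ ∫ z, a (z.1.2, z.2) * ch g z ∂NM = ∫ q, a q * g q ∂KM := by
  have hm : Measurable fun z : T4 => a (z.1.2, z.2) * ch g z := (ha.comp (by fun_prop)).mul (ch_meas hg.meas)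
  have key : ∀ {a : T3 → ℝ}, Measurable a → ∫⁻ z, ofReal (a (z.1.2, z.2) * ch g z) ∂NM = ∫⁻ q, ofReal (a q * g q) ∂KM := by
    intro a ha
    have := lay_l ha.ennreal_ofReal hg.meas (measurable_const (a := (0:ℝ))) (fun _ => le_rfl)
    rw [show (∫⁻ q, ofReal (a q * g q) ∂KM) = ∫⁻ q, ofReal (a q) * ofReal (g q - 0) ∂KM from
      lintegral_congr fun q => by rw [sub_zero, ENNReal.ofReal_mul' (hg.nonneg q)], ← this]
    refine lintegral_congr_ae ?_
    filter_upwards [NM_pos] with z hz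
    rw [show ch (fun _ => 0) z = 0 by simp [ch, hz.1.le], sub_zero, ENNReal.ofReal_mul']
    rcases ch_01 g z with h | h <;> simp [h]
  have hI : Integrable (fun z => a (z.1.2, z.2) * ch g z) NM := by
    refine ⟨hm.aestronglyMeasurable, ?_⟩
    have h2 := hi.abs.lintegral_lt_top
    rw [hasFiniteIntegral_iff_norm]
    refine lt_of_eq_of_lt ?_ h2
    rw [show (fun q => ofReal |a q * g q|) = fun q => ofReal (|a q| * g q) from
      funext fun q => by rw [abs_mul, abs_of_nonneg (hg.nonneg q)], ← key (a := fun q => |a q|) (by fun_prop)]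
    refine lintegral_congr fun z => ?_
    rw [norm_mul, norm_eq_abs, norm_eq_abs]
    rcases ch_01 g z with h | h <;> simp [h]
  refine ⟨hI, ?_⟩
  rw [integral_eq_lintegral_pos_part_sub_lintegral_neg_part hI, integral_eq_lintegral_pos_part_sub_lintegral_neg_part hi, key ha]
  congr 2
  have := key (a := fun q => - a q) ha.neg
  simpa only [neg_mul] using this

lemma ofReal_int_le {α : Type*} [MeasurableSpace α] {μ : Measure α} {f : α → ℝ} (hf : Integrable f μ) :
    ofReal (∫ x, f x ∂μ) ≤ ∫⁻ x, ofReal (f x) ∂μ := by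
  refine ENNReal.ofReal_le_of_le_toReal ?_
  rw [integral_eq_lintegral_pos_part_sub_lintegral_neg_part hf]
  linarith [ENNReal.toReal_nonneg (a := ∫⁻ x, ofReal (-f x) ∂μ)]

lemma ch_mu {g} (hg : RF g) : ∀ᵐ y ∂(HM.prod HM), mu g y.1 y.2 < ⊤ ∧ Integrable (fun p => ch g (y, p)) PM ∧
    ∫ p, ch g (y, p) ∂PM = (mu g y.1 y.2).toReal := by
  have h := lay_i (a := fun _ => 1) measurable_const hg (by simpa using hg.int)
  simp only [one_mul] at h
  have h2 := h.1.prod_right_ae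
  have hl : ∀ y, ∫⁻ p, ofReal (ch g (y, p)) ∂PM = mu g y.1 y.2 := by
    intro y
    have hms : MeasurableSet {p | y.1 < g (y.2, p)} := measurableSet_lt measurable_const (hg.meas.comp (by fun_prop))
    rw [mu, ← lintegral_indicator_one hms]
    refine lintegral_congr fun p => ?_
    classical
    simp only [ch, indicator_apply, mem_ofPred_eq, Pi.one_apply]
    split_ifs <;> simp
  filter_upwards [h2] with y hy
  have h0 : ∀ p, 0 ≤ ch g (y, p) := fun p => by rcases ch_01 g (y, p) with h | h <;> simp [h]
  refine ⟨?_, hy, ?_⟩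
  · rw [← hl]; exact hy.lintegral_lt_top
  · rw [integral_eq_lintegral_of_nonneg_ae (ae_of_all _ h0) hy.1, hl]

lemma DD_eq {g g'} (hg : Measurable g) (hg' : Measurable g') : DD g g' =
    ∫⁻ y, ((mu g y.1 y.2 - mu g' y.1 y.2) + (mu g' y.1 y.2 - mu g y.1 y.2)) ∂(HM.prod HM) := by
  have := mu_meas hg
  have := mu_meas hg'
  rw [lintegral_prod_symm _ (by fun_prop)]; rfl

lemma toReal_dd {a b : ℝ≥0∞} (ha : a < ⊤) (hb : b < ⊤) {c C : ℝ} (h : |c| ≤ C) :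
    ofReal (c * (a.toReal - b.toReal)) ≤ ofReal C * ((a - b) + (b - a)) := by
  lift a to ℝ≥0 using ha.ne
  lift b to ℝ≥0 using hb.ne
  have hC : 0 ≤ C := (abs_nonneg _).trans h
  rw [← ENNReal.coe_sub, ← ENNReal.coe_sub, ← ENNReal.coe_add, ENNReal.coe_toReal, ENNReal.coe_toReal,
    ← ofReal_coe_nnreal, ← ofReal_mul hC]
  refine ofReal_le_ofReal ?_
  have : |(a:ℝ) - b| ≤ ((a - b + (b - a) : ℝ≥0) : ℝ) := by
    rcases le_total a b with h | h
    · rw [tsub_eq_zero_of_le h, zero_add, NNReal.coe_sub h, abs_sub_comm, abs_of_nonneg (sub_nonneg.2 (by exact_mod_cast h))]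
    · rw [tsub_eq_zero_of_le h, add_zero, NNReal.coe_sub h, abs_of_nonneg (sub_nonneg.2 (by exact_mod_cast h))]
  calc c * ((a:ℝ) - b) ≤ |c * ((a:ℝ) - b)| := le_abs_self _
    _ = |c| * |(a:ℝ) - b| := abs_mul _ _
    _ ≤ _ := by gcongr


section
variable {G : T3 → ℝ} {ρ : ℝ → ℝ} {E : T2 → ℝ} {e₀ Φ R : ℝ}

def eU (g : T3 → ℝ) (q : T3) : ℝ := kin q / 2 - UF g q.2.1

lemma eU_meas {g} (hg : RF g) : Measurable (eU g) :=
  (measurable_kin.div_const 2).sub ((UF_cont hg).measurable.comp (by fun_prop))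

lemma eU_int {g M g' M'} (hg : RM g M) (hg' : RM g' M') : Integrable (fun q => eU g q * g' q) KM ∧
    ∫ q, eU g q * g' q ∂KM = (∫ q, kin q * g' q ∂KM) / 2 - 4 * π * ∫ t in Ioi 0, pF g t * pF g' t := by
  have h1 := hg'.kint.div_const 2
  have h2 := U_int hg hg'
  have e : (fun q => eU g q * g' q) = fun q => kin q * g' q / 2 - UF g q.2.1 * g' q := by
    funext q; rw [eU]; ring
  rw [e]
  refine ⟨h1.sub h2.1, ?_⟩
  rw [integral_sub h1 h2.1, h2.2, integral_div]

lemma notDS (hB : BG G ρ E e₀ Φ R) {y : T2} (h1 : 0 < y.1) (h2 : 0 < y.2) (hy : y ∉ DS G E) {s : ℝ} (hs : 0 < s) (w : ℝ) :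
    ¬ y.1 < G (y.2, (s, w)) := by
  intro h
  have h3 := (hB.lev y.1 y.2 s w h1 h2 hs).1 h
  have h4 : 0 < XX G (E y) y.2 s := by
    have : XX G (E y) y.2 s = E (y.1, y.2) + UF G s - y.2 * s ^ 2 / 2 := rfl
    rw [this]; nlinarith [sq_nonneg w]
  have hc : Continuous (XX G (E y) y.2) := XX_cont hB.rm.toRF _ _
  have ho : IsOpen ({s | 0 < XX G (E y) y.2 s} ∩ Ioi 0) := (isOpen_lt continuous_const hc).inter isOpen_Ioi
  obtain ⟨q, hq⟩ := Rat.denseRange_cast.exists_mem_open ho ⟨s, h4, hs⟩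
  exact hy ⟨h1, h2, q, hq.2, hq.1⟩

lemma T0_meas {X k : ℝ → ℝ} (hX : Measurable X) (hk : Measurable k) : Measurable fun p : T2 => T0 (X p.1) (k p.1) p.2 := by
  unfold T0
  refine Measurable.sub (by fun_prop) (Measurable.ite (measurableSet_lt (by fun_prop) (by fun_prop)) (by fun_prop) measurable_const)

lemma T0_PM {X k : ℝ → ℝ} (hX : Measurable X) (hk : Measurable k) :
    ∫⁻ p, ofReal (T0 (X p.1) (k p.1) p.2) ∂PM = ofReal (4 * π ^ 2) * ∫⁻ s in Ioi 0, sI X k s := by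
  rw [lint_PM _ (T0_meas hX hk).ennreal_ofReal, ← lcmul]
  refine lintegral_congr fun s => ?_
  rw [sI, ← mul_assoc, ← ofReal_mul (by positivity), div_eq_mul_inv]

set_option maxHeartbeats 1000000 in
lemma dual (hB : BG G ρ E e₀ Φ R) {g M} (hg : RM g M) {N Λ c : ℝ} (hN : 0 ≤ N) (hN1 : N ≤ 1) (hΛ : 0 ≤ Λ)
    (hd : ∀ s, 0 ≤ s → |UF g s - UF G s| ≤ N * √s) {P : T2 → ℝ≥0∞} (hP : Measurable P)
    (hP1 : ∀ y ∈ DS G E, ∃ μ, |μ| ≤ Λ ∧ ∫⁻ s in Ioi 0, sI (XX G (E y) y.2) (fun s => UF g s - UF G s + μ) s ≤ P y)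
    (hP2 : ofReal (4 * π ^ 2) * ∫⁻ y in DS G E, P y ∂(HM.prod HM) ≤ ofReal c) {S : ℝ} (hS : 0 < S) :
    ofReal ((∫ q, eU g q * G q ∂KM) - ∫ q, eU g q * g q ∂KM) ≤ ofReal c +
      ofReal (Λ + Φ + √S) * DD G g + ofReal (8 * π ^ 2 * M / S + (∫ q, kin q * g q ∂KM) / √S) := by
  have hΦ : 0 ≤ Φ := by have := hB.UΦ 0 le_rfl; simpa [UF] using this
  have i1 := lay_i (eU_meas hg.toRF) hB.rm.toRF (eU_int hg hB.rm).1
  have i2 := lay_i (eU_meas hg.toRF) hg.toRF (eU_int hg hg).1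
  have iF : Integrable (fun z : T4 => eU g (z.1.2, z.2) * ch G z - eU g (z.1.2, z.2) * ch g z) ((HM.prod HM).prod PM) := i1.1.sub i2.1
  have hgm := hg.meas
  have hchg := ch_meas hgm
  rw [← i1.2, ← i2.2, ← integral_sub i1.1 i2.1]
  rw [NM, integral_prod _ iF]
  refine (ofReal_int_le iF.integral_prod_left).trans ?_
  set tl : T4 → ℝ≥0∞ := fun z => {q : T3 | S < q.2.1}.indicator (fun q => ofReal √q.2.1) (z.1.2, z.2) * ofReal (ch g z - ch (fun _ => 0) z) with htl
  have hkm : Measurable ({q : T3 | S < q.2.1}.indicator (fun q => ofReal √q.2.1)) :=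
    Measurable.indicator (by fun_prop) (meas_half S)
  have htlm : Measurable tl := by
    have := ch_meas (g := fun _ => 0) measurable_const
    rw [htl]; fun_prop
  have htl2 : ∫⁻ y, ∫⁻ p, tl (y, p) ∂PM ∂(HM.prod HM) ≤ ofReal (8 * π ^ 2 * M / S + (∫ q, kin q * g q ∂KM) / √S) := by
    rw [← lintegral_prod _ htlm.aemeasurable]
    refine le_of_eq_of_le (lay_l hkm hgm measurable_const (fun _ => le_rfl)) (le_of_eq_of_le ?_ (tail_lint hg hS))
    refine lintegral_congr fun q => ?_
    classical
    simp only [indicator_apply, sub_zero]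
    split_ifs
    · rw [ofReal_mul (sqrt_nonneg _)]
    · simp
  have hmain : ∀ᵐ y ∂(HM.prod HM), ofReal (∫ p, (eU g (y.2, p) * ch G (y, p) - eU g (y.2, p) * ch g (y, p)) ∂PM) ≤
      (DS G E).indicator (fun y => ofReal (4 * π ^ 2) * P y) y + ofReal (Λ + Φ + √S) *
        ((mu G y.1 y.2 - mu g y.1 y.2) + (mu g y.1 y.2 - mu G y.1 y.2)) + ∫⁻ p, tl (y, p) ∂PM := by
    have hpos : ∀ᵐ y ∂(HM.prod HM), 0 < y.1 ∧ 0 < y.2 := by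
      have h1 : ∀ᵐ σ ∂HM, 0 < σ := ae_restrict_mem measurableSet_Ioi
      exact ((Measure.quasiMeasurePreserving_fst (μ := HM) (ν := HM)).ae h1).and
        ((Measure.quasiMeasurePreserving_snd (μ := HM) (ν := HM)).ae h1)
    have hPMpos : ∀ᵐ p ∂PM, 0 < p.1 := by
      have h1 : ∀ᵐ s ∂((volume.restrict (Ioi (0:ℝ))).withDensity (fun s => ofReal (4 * π ^ 2 / s ^ 2))), 0 < s :=
        (withDensity_absolutelyContinuous _ _).ae_le (ae_restrict_mem measurableSet_Ioi)
      exact (Measure.quasiMeasurePreserving_fst (μ := _) (ν := (volume : Measure ℝ))).ae h1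
    filter_upwards [ch_mu hB.rm.toRF, ch_mu hg.toRF, iF.prod_right_ae, hpos] with y cG cg hF hy
    by_cases hD : y ∈ DS G E
    · rw [indicator_of_mem hD]
      by_cases hT : P y = ⊤
      · rw [hT, ENNReal.mul_top (by positivity)]; simp
      obtain ⟨μ, hμ, hI⟩ := hP1 y hD
      set k : ℝ → ℝ := fun s => UF g s - UF G s + μ with hk
      have hXm : Measurable (XX G (E y) y.2) := (XX_cont hB.rm.toRF _ _).measurable
      have hkm : Measurable k := (((UF_cont hg.toRF).sub (UF_cont hB.rm.toRF)).add continuous_const).measurable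
      have hT0 := T0_PM hXm hkm
      have hle : ∫⁻ p, ofReal (T0 (XX G (E y) y.2 p.1) (k p.1) p.2) ∂PM ≤ ofReal (4 * π ^ 2) * P y := by
        rw [hT0]; exact mul_le_mul_right hI _
      have h0 : ∀ p : T2, 0 ≤ T0 (XX G (E y) y.2 p.1) (k p.1) p.2 := fun p => by
        unfold T0; split_ifs
        · exact sub_nonneg.2 (le_max_left _ _)
        · rw [sub_zero]; exact le_max_right _ _
      have hTi : Integrable (fun p : T2 => T0 (XX G (E y) y.2 p.1) (k p.1) p.2) PM := by
        refine ⟨(T0_meas hXm hkm).aestronglyMeasurable, ?_⟩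
        rw [hasFiniteIntegral_iff_ofReal (ae_of_all _ h0)]
        exact lt_of_le_of_lt hle (ENNReal.mul_lt_top ofReal_lt_top (lt_top_iff_ne_top.2 hT))
      have hci : Integrable (fun p => (E y + μ) * (ch G (y, p) - ch g (y, p))) PM := (cG.2.1.sub cg.2.1).const_mul (E y + μ)
      have hb : ∫ p, (eU g (y.2, p) * ch G (y, p) - eU g (y.2, p) * ch g (y, p)) ∂PM ≤
          (∫ p, T0 (XX G (E y) y.2 p.1) (k p.1) p.2 ∂PM) + (E y + μ) * ((mu G y.1 y.2).toReal - (mu g y.1 y.2).toReal) := by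
        rw [← cG.2.2, ← cg.2.2, ← integral_sub cG.2.1 cg.2.1, ← integral_const_mul, ← integral_add hTi hci]
        refine integral_mono_ae hF (hTi.add hci) ?_
        filter_upwards [hPMpos] with p hp
        have hlev := hB.lev y.1 y.2 p.1 p.2 hy.1 hy.2 hp
        have hG1 : ch G (y, p) = if p.2 ^ 2 / 2 < XX G (E y) y.2 p.1 then 1 else 0 := by
          simp only [ch]; exact if_congr hlev rfl rfl
        have hlam : XX G (E y) y.2 p.1 + k p.1 - p.2 ^ 2 / 2 = E y + μ - eU g (y.2, p) := by
          simp only [XX, hk, eU, kin]; ring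
        rw [hG1, T0, hlam]
        have m1 := le_max_left (E y + μ - eU g (y.2, p)) 0
        have m2 := le_max_right (E y + μ - eU g (y.2, p)) 0
        rcases ch_01 g (y, p) with h | h <;> rw [h] <;> split_ifs <;> linarith
      refine (ofReal_le_ofReal hb).trans (ENNReal.ofReal_add_le.trans ?_)
      refine le_trans (add_le_add ?_ ?_) le_self_add
      · refine le_trans ?_ hle
        exact ofReal_int_le hTi
      · refine toReal_dd cG.1 cg.1 ?_
        have := hB.E1 y; have := hB.E2 y; have := hB.e0
        have := abs_le.1 hμ
        have := sqrt_nonneg S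
        exact abs_le.2 ⟨by linarith, by linarith⟩
    · rw [indicator_of_notMem hD, zero_add]
      have hG0 : ∀ p : T2, 0 < p.1 → ch G (y, p) = 0 := fun p hp => by
        simp only [ch]; exact if_neg (notDS hB hy.1 hy.2 hD hp p.2)
      have hmG : mu G y.1 y.2 = 0 := by
        rw [mu, ← compl_compl {p | y.1 < G (y.2, p)}]
        refine mem_ae_iff.1 ?_
        filter_upwards [hPMpos] with p hp
        exact notDS hB hy.1 hy.2 hD hp p.2
      rw [hmG, tsub_zero, zero_tsub, zero_add]
      have hmg : mu g y.1 y.2 = ∫⁻ p, ofReal (ch g (y, p)) ∂PM := by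
        rw [← ofReal_integral_eq_lintegral_ofReal cg.2.1 (ae_of_all _ fun p => by rcases ch_01 g (y, p) with h | h <;> simp [h]),
          cg.2.2, ofReal_toReal cg.1.ne]
      rw [hmg, ← lcmul, ← lintegral_add_left' ]
      · refine (ofReal_int_le hF).trans (lintegral_mono_ae ?_)
        filter_upwards [hPMpos] with p hp
        have hc0 : ch (fun _ => 0) (y, p) = 0 := by simp [ch, hy.1.le]
        rw [hG0 p hp, htl]
        beta_reduce
        rw [hc0, sub_zero, mul_zero, zero_sub]
        rcases ch_01 g (y, p) with h | h
        · rw [h]; simp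
        rw [h, ENNReal.ofReal_one, mul_one, mul_one, mul_one]
        have hk := kin_nonneg (q := (y.2, p)) hy.2
        have hU := hB.UΦ p.1 hp.le
        have hd1 := (abs_le.1 (hd p.1 hp.le)).2
        have hd2 : N * √p.1 ≤ √p.1 := mul_le_of_le_one_left (sqrt_nonneg _) hN1
        have hle : -eU g (y.2, p) ≤ Φ + √p.1 := by unfold eU; simp only; linarith
        classical
        simp only [indicator_apply, mem_ofPred_eq]
        split_ifs with hS1
        · rw [← ofReal_add (by positivity) (by positivity)]
          exact ofReal_le_ofReal (by linarith [sqrt_nonneg S])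
        · rw [add_zero]
          exact ofReal_le_ofReal (by linarith [sqrt_le_sqrt (not_lt.1 hS1)])
      · exact ((hchg.comp (by fun_prop)).ennreal_ofReal.const_mul _).aemeasurable
  refine (lintegral_mono_ae hmain).trans ?_
  have m1 := mu_meas hB.rm.meas
  have m2 := mu_meas hgm
  have hDS := DS_meas hB
  rw [lintegral_add_left, lintegral_add_left, lintegral_indicator hDS, lcmul,
    lcmul, ← DD_eq hB.rm.meas hgm]
  · exact add_le_add (add_le_add hP2 le_rfl) htl2
  · exact (hP.const_mul _).indicator hDS
  · have := (hP.const_mul (ofReal (4 * π ^ 2))).indicator hDS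
    fun_prop
end


section
variable {G : T3 → ℝ} {ρ : ℝ → ℝ} {E : T2 → ℝ} {e₀ Φ R : ℝ}

lemma w_int {X c d : ℝ} (hd : 0 ≤ d) (hc : 0 ≤ c) :
    ∫⁻ w, {w : ℝ | w ^ 2 / 2 < X}.indicator (fun w => ofReal (c * w ^ 2 + d)) w =
      ofReal (c * (2 * √(2 * X) ^ 3 / 3) + 2 * √(2 * X) * d) := by
  have hset : {w : ℝ | w ^ 2 / 2 < X} = Ioo (-√(2 * X)) √(2 * X) := by
    ext w
    rw [mem_Ioo, ← abs_lt, Real.lt_sqrt (abs_nonneg w), sq_abs, mem_ofPred_eq]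
    constructor <;> intro h <;> linarith
  have ha := sqrt_nonneg (2 * X)
  rw [hset, lintegral_indicator measurableSet_Ioo, restrict_Ioo_eq_restrict_Ioc, ← ofReal_integral_eq_lintegral_ofReal,
    ← intervalIntegral.integral_of_le (by linarith)]
  · congr 1
    rw [intervalIntegral.integral_add (Continuous.intervalIntegrable (by fun_prop) _ _) intervalIntegrable_const, intervalIntegral.integral_const_mul, integral_pow, intervalIntegral.integral_const, smul_eq_mul]
    push_cast; ring
  · exact (Continuous.integrableOn_Icc (by fun_prop)).mono_set Ioc_subset_Icc_self
  · exact ae_of_all _ fun w => by positivity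

lemma vir1 (hB : BG G ρ E e₀ Φ R) {e l α β : ℝ} (o : Orb G e l α β) :
    ∫ s in α..β, (s ^ 2)⁻¹ * (1 * (2 * √(2 * XX G e l s) ^ 3 / 3) + 2 * √(2 * XX G e l s) * (l * s ^ 2)) =
    ∫ s in α..β, (s ^ 2)⁻¹ * (0 * (2 * √(2 * XX G e l s) ^ 3 / 3) + 2 * √(2 * XX G e l s) * (s * pF G s)) := by
  have hc := XX_cont hB.rm.toRF e l
  have hp := pF_cont hB.rm.toRF
  have hn : ∀ s ∈ uIcc α β, s ≠ 0 := fun s hs => by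
    rw [uIcc_of_le o.ab.le] at hs; exact (o.a0.trans_le hs.1).ne'
  have c1 : ContinuousOn (fun s => (s ^ 2)⁻¹ * (1 * (2 * √(2 * XX G e l s) ^ 3 / 3) + 2 * √(2 * XX G e l s) * (l * s ^ 2))) (uIcc α β) :=
    ContinuousOn.mul (ContinuousOn.inv₀ (by fun_prop) fun s hs => pow_ne_zero _ (hn s hs)) (by fun_prop)
  have c2 : ContinuousOn (fun s => (s ^ 2)⁻¹ * (0 * (2 * √(2 * XX G e l s) ^ 3 / 3) + 2 * √(2 * XX G e l s) * (s * pF G s))) (uIcc α β) :=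
    ContinuousOn.mul (ContinuousOn.inv₀ (by fun_prop) fun s hs => pow_ne_zero _ (hn s hs)) (by fun_prop)
  rw [← sub_eq_zero, ← intervalIntegral.integral_sub c1.intervalIntegrable c2.intervalIntegrable]
  rw [intervalIntegral.integral_eq_sub_of_hasDerivAt_of_le (f := fun s => -(2 / 3) * (√(2 * XX G e l s) ^ 3 * s⁻¹)) o.ab.le]
  · simp [o.xa, o.xb]
  · exact ContinuousOn.mul continuousOn_const (ContinuousOn.mul (by fun_prop) (ContinuousOn.inv₀ (by fun_prop) fun s hs => (o.a0.trans_le hs.1).ne'))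
  · intro s hs
    have hs0 : s ≠ 0 := (o.a0.trans hs.1).ne'
    have hX := orb_pos o hs
    have hd : HasDerivAt (XX G e l) (pF G s - l * s) s := by
      have h1 := ((UF_deriv hB.rm.toRF s).const_add e).sub ((((hasDerivAt_id s).pow 2).const_mul l).div_const 2)
      exact h1.congr_deriv (by simp; ring)
    have h2 := ((((hd.const_mul 2).sqrt (by positivity)).pow 3).mul (hasDerivAt_inv hs0)).const_mul (-(2/3))
    refine h2.congr_deriv ?_
    simp only [Pi.pow_apply]
    have hq : 0 < √(2 * XX G e l s) := by positivity
    field_simp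
    ring
  · exact (c1.sub c2).intervalIntegrable

set_option maxHeartbeats 400000 in
lemma vir2 (hB : BG G ρ E e₀ Φ R) {y : T2} (h1 : 0 < y.1) (h2 : 0 < y.2) :
    ∫⁻ p, ofReal (kin (y.2, p)) * ofReal (ch G (y, p)) ∂PM =
    ∫⁻ p, ofReal (p.1 * pF G p.1) * ofReal (ch G (y, p)) ∂PM := by
  have hcm := ch_meas hB.rm.meas
  have hp := (pF_cont hB.rm.toRF).measurable
  have hkm := measurable_kin
  have hX : ∀ (c : ℝ) (d : ℝ → ℝ), ∀ s ∈ Ioi (0:ℝ), ∫⁻ w, ofReal (c * w ^ 2 + d s) * ofReal (ch G (y, (s, w))) =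
      ∫⁻ w, {w : ℝ | w ^ 2 / 2 < XX G (E y) y.2 s}.indicator (fun w => ofReal (c * w ^ 2 + d s)) w := by
    intro c d s hs
    refine lintegral_congr fun w => ?_
    have hG1 : ch G (y, (s, w)) = if w ^ 2 / 2 < XX G (E y) y.2 s then 1 else 0 := by
      simp only [ch]; exact if_congr (hB.lev y.1 y.2 s w h1 h2 hs) rfl rfl
    classical
    simp only [hG1, indicator_apply, mem_ofPred_eq]; split_ifs <;> simp
  rw [lint_PM _ (by fun_prop), lint_PM _ (by fun_prop)]
  have e1 : ∀ s ∈ Ioi (0:ℝ), ofReal (4 * π ^ 2 / s ^ 2) * ∫⁻ w, ofReal (kin (y.2, (s, w))) * ofReal (ch G (y, (s, w))) =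
      ofReal (4 * π ^ 2 / s ^ 2) * ∫⁻ w, {w : ℝ | w ^ 2 / 2 < XX G (E y) y.2 s}.indicator (fun w => ofReal (1 * w ^ 2 + y.2 * s ^ 2)) w :=
    fun s hs => by rw [← hX 1 (fun s => y.2 * s ^ 2) s hs]; simp only [kin, one_mul]
  have e2 : ∀ s ∈ Ioi (0:ℝ), ofReal (4 * π ^ 2 / s ^ 2) * ∫⁻ w, ofReal (s * pF G s) * ofReal (ch G (y, (s, w))) =
      ofReal (4 * π ^ 2 / s ^ 2) * ∫⁻ w, {w : ℝ | w ^ 2 / 2 < XX G (E y) y.2 s}.indicator (fun w => ofReal (0 * w ^ 2 + s * pF G s)) w :=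
    fun s hs => by rw [← hX 0 (fun s => s * pF G s) s hs]; simp only [zero_mul, zero_add]
  rw [slcongr e1, slcongr e2]
  have hneg : ∀ s, XX G (E y) y.2 s ≤ 0 → ∀ F : ℝ → ℝ≥0∞, ∫⁻ w, {w : ℝ | w ^ 2 / 2 < XX G (E y) y.2 s}.indicator F w = 0 := by
    intro s hs F
    rw [← lintegral_zero (μ := volume) (α := ℝ)]
    exact lintegral_congr fun w => indicator_apply_eq_zero.2 fun h => absurd (show w ^ 2 / 2 < XX G (E y) y.2 s from h) (by nlinarith [sq_nonneg w])
  by_cases hD : y ∈ DS G E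
  · obtain ⟨α, β, o, -⟩ := orb_D hB hD
    have hsub : Ioo α β ⊆ Ioi 0 := fun s hs => o.a0.trans hs.1
    have key : ∀ (c : ℝ) (d : ℝ → ℝ), 0 ≤ c → (∀ s, 0 < s → 0 ≤ d s) → Continuous d →
        ∫⁻ s in Ioi 0, ofReal (4 * π ^ 2 / s ^ 2) * ∫⁻ w, {w : ℝ | w ^ 2 / 2 < XX G (E y) y.2 s}.indicator (fun w => ofReal (c * w ^ 2 + d s)) w =
        ofReal (4 * π ^ 2) * ofReal (∫ s in α..β, (s ^ 2)⁻¹ * (c * (2 * √(2 * XX G (E y) y.2 s) ^ 3 / 3) + 2 * √(2 * XX G (E y) y.2 s) * d s)) := by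
      intro c d hc hd hdc
      have hXc := XX_cont hB.rm.toRF (E y) y.2
      rw [intervalIntegral.integral_of_le o.ab.le, ← restrict_Ioo_eq_restrict_Ioc, ofReal_integral_eq_lintegral_ofReal,
        ← lcmul]
      · rw [← lintegral_indicator measurableSet_Ioi, ← lintegral_indicator measurableSet_Ioo]
        refine lintegral_congr fun s => ?_
        by_cases hs : s ∈ Ioo α β
        · have hs0 : 0 < s := hsub hs
          rw [indicator_of_mem hs, indicator_of_mem (hsub hs), w_int (hd s hs0), ← ofReal_mul (by positivity), ← ofReal_mul (by positivity)]
          · congr 1; ring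
          · exact hc
        · rw [indicator_of_notMem hs]
          refine indicator_apply_eq_zero.2 fun _ => ?_
          rw [hneg s (orb_neg o hs), mul_zero]
      · refine IntegrableOn.mono_set (ContinuousOn.integrableOn_Icc ?_) Ioo_subset_Icc_self
        exact ContinuousOn.mul (ContinuousOn.inv₀ (by fun_prop) fun s hs => pow_ne_zero _ (o.a0.trans_le hs.1).ne') (by fun_prop)
      · refine (ae_restrict_iff' measurableSet_Ioo).2 (ae_of_all _ fun s hs => ?_)
        have := hd s (hsub hs)
        show 0 ≤ _
        positivity
    rw [key 1 (fun s => y.2 * s ^ 2) zero_le_one (fun s _ => by positivity) (by fun_prop),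
      key 0 (fun s => s * pF G s) le_rfl (fun s hs => mul_nonneg hs.le (pF_nonneg hB.rm.toRF s)) (continuous_id.mul (pF_cont hB.rm.toRF)), vir1 hB o]
  · refine slcongr fun s hs => ?_
    have hs : 0 < s := hs
    have : XX G (E y) y.2 s ≤ 0 := by
      by_contra h
      refine notDS hB h1 h2 hD hs 0 ((hB.lev y.1 y.2 s 0 h1 h2 hs).2 ?_)
      simpa [XX] using h
    beta_reduce
    rw [hneg s this, hneg s this]

lemma vir3 (hB : BG G ρ E e₀ Φ R) : ∫⁻ q, ofReal (kin q * G q) ∂KM = ∫⁻ q, ofReal (q.2.1 * pF G q.2.1 * G q) ∂KM := by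
  have hp := (pF_cont hB.rm.toRF).measurable
  have hcm := ch_meas hB.rm.meas
  have hkm := measurable_kin
  have key : ∀ k : T3 → ℝ, Measurable k → ∫⁻ q, ofReal (k q * G q) ∂KM =
      ∫⁻ y, ∫⁻ p, ofReal (k (y.2, p)) * ofReal (ch G (y, p)) ∂PM ∂(HM.prod HM) := by
    intro k hk
    have h := lay_l hk.ennreal_ofReal hB.rm.meas (measurable_const (a := (0:ℝ))) (fun _ => le_rfl)
    rw [← lintegral_prod (fun z => ofReal (k (z.1.2, z.2)) * ofReal (ch G z)) (by fun_prop)]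
    rw [show (∫⁻ q, ofReal (k q * G q) ∂KM) = ∫⁻ q, ofReal (k q) * ofReal (G q - 0) ∂KM from
      lintegral_congr fun q => by rw [sub_zero, ENNReal.ofReal_mul' (hB.rm.nonneg q)], ← h]
    refine lintegral_congr_ae (μ := NM) ?_
    filter_upwards [NM_pos] with z hz
    rw [show ch (fun _ => 0) z = 0 by simp [ch, hz.1.le], sub_zero]
  rw [key _ measurable_kin, key (fun q => q.2.1 * pF G q.2.1) (by fun_prop)]
  refine lintegral_congr_ae ?_
  have h1 : ∀ᵐ σ ∂HM, 0 < σ := ae_restrict_mem measurableSet_Ioi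
  filter_upwards [(Measure.quasiMeasurePreserving_fst (μ := HM) (ν := HM)).ae h1, (Measure.quasiMeasurePreserving_snd (μ := HM) (ν := HM)).ae h1] with y a b
  exact vir2 hB a b

lemma U_gt (hB : BG G ρ E e₀ Φ R) {s : ℝ} (hs : 0 < s) : s * pF G s ≤ UF G s ∧ (0 < ρ s → s * pF G s < UF G s) := by
  have hg := hB.rm.toRF
  have hii : ∀ a b, IntervalIntegrable (pF G) volume a b := fun a b => (pF_cont hg).intervalIntegrable a b
  have low : ∀ a b c, a ≤ b → b ≤ c → (b - a) * pF G c ≤ ∫ t in a..b, pF G t := by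
    intro a b c h h'
    have := intervalIntegral.integral_mono_on h (intervalIntegrable_const (c := pF G c)) (hii a b) fun t ht => pF_anti hg (ht.2.trans h')
    simpa using this
  refine ⟨by simpa [UF] using low 0 s s hs.le le_rfl, fun hr => ?_⟩
  have : ∃ t, 0 < t ∧ t < s ∧ pF G s < pF G t := by
    by_contra! hcon
    have hd : HasDerivWithinAt (pF G) 0 (Ioo 0 s) s := by
      refine (hasDerivWithinAt_const s _ (pF G s)).congr (fun t ht => ?_) rfl
      exact le_antisymm (hcon t ht.1 ht.2) (pF_anti hg ht.2.le)
    have hu : UniqueDiffWithinAt ℝ (Ioo 0 s) s := uniqueDiffWithinAt_convex (convex_Ioo _ _) (by simpa using hs) (by rw [closure_Ioo hs.ne]; exact ⟨hs.le, le_rfl⟩)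
    have := hu.eq_deriv _ hd (hB.dp s hs).hasDerivWithinAt
    have : 0 < ρ s / s ^ 4 := by positivity
    linarith
  obtain ⟨t, t0, ts, hlt⟩ := this
  have h1 := low 0 t t t0.le le_rfl
  have h2 := low t s s ts.le le_rfl
  have h3 : UF G s = (∫ u in (0:ℝ)..t, pF G u) + ∫ u in t..s, pF G u := (intervalIntegral.integral_add_adjacent_intervals (hii _ _) (hii _ _)).symm
  nlinarith

lemma ham_neg (hB : BG G ρ E e₀ Φ R) (h0 : 0 < ∫ q, G q ∂KM) :
    (∫ q, kin q * G q ∂KM) / 2 - 2 * π * ∫ s in Ioi (0:ℝ), pF G s ^ 2 < 0 := by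
  have hU := U_int hB.rm hB.rm
  have hp := (pF_cont hB.rm.toRF).measurable
  have hGm := hB.rm.meas
  have hk0 : ∀ᵐ q ∂KM, 0 ≤ kin q * G q := by
    filter_upwards [KM_pos] with q hq using mul_nonneg (kin_nonneg hq.1) (hB.rm.nonneg q)
  have hs0 : ∀ᵐ q ∂KM, 0 ≤ q.2.1 * pF G q.2.1 * G q := by
    filter_upwards [KM_pos] with q hq using mul_nonneg (mul_nonneg hq.2.le (pF_nonneg hB.rm.toRF _)) (hB.rm.nonneg q)
  have his : Integrable (fun q : T3 => q.2.1 * pF G q.2.1 * G q) KM := by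
    refine ⟨by fun_prop, ?_⟩
    rw [hasFiniteIntegral_iff_ofReal hs0, ← vir3 hB]
    exact hB.rm.kint.lintegral_lt_top
  have heq : ∫ q, kin q * G q ∂KM = ∫ q, q.2.1 * pF G q.2.1 * G q ∂KM := by
    rw [integral_eq_lintegral_of_nonneg_ae hk0 hB.rm.kint.1, integral_eq_lintegral_of_nonneg_ae hs0 his.1, vir3 hB]
  have hpos : 0 < ∫ q, (UF G q.2.1 * G q - q.2.1 * pF G q.2.1 * G q) ∂KM := by
    have hnn : ∀ᵐ q ∂KM, 0 ≤ UF G q.2.1 * G q - q.2.1 * pF G q.2.1 * G q := by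
      filter_upwards [KM_pos] with q hq
      have := (U_gt hB hq.2).1
      nlinarith [hB.rm.nonneg q]
    refine lt_of_le_of_ne (integral_nonneg_of_ae hnn) fun h => ?_
    have h1 := (integral_eq_zero_iff_of_nonneg_ae hnn (hU.1.sub his)).1 h.symm
    have h2 : ∀ᵐ q ∂KM, G q = 0 := by
      filter_upwards [h1, KM_pos] with q hq hq2
      by_contra hne
      have hGp : 0 < G q := lt_of_le_of_ne (hB.rm.nonneg q) (Ne.symm hne)
      have h3 := (U_gt hB hq2.2).2 (hB.rpos q.2.1 q.1 q.2.2 hq2.2 hq2.1 hGp)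
      simp only [Pi.zero_apply] at hq
      nlinarith
    rw [integral_congr_ae h2] at h0
    simp at h0
  rw [integral_sub hU.1 his, ← heq, hU.2] at hpos
  simp only [pow_two]
  linarith
end

lemma Q_pos {Q F e₀} (hQ : AssumptionA Q F e₀) : 0 < ∫ q, red Q q ∂KM := by
  have hm := Q_mem hQ
  rw [← integral_Psi (measurable_red hm.1.1), ← integral_congr_ae (sph_red_ae hm.2)]
  obtain ⟨z, hz⟩ := Function.ne_iff.1 hQ.nonzero
  exact hQ.contQ.integral_pos_of_hasCompactSupport_nonneg_nonzero hQ.cpt hQ.nonneg hz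


section
variable {G : T3 → ℝ} {ρ : ℝ → ℝ} {E : T2 → ℝ} {e₀ Φ R : ℝ}

def x2 (g G : T3 → ℝ) : ℝ := ∫ s in Ioi (0:ℝ), (pF g s - pF G s) ^ 2
def Hm (g : T3 → ℝ) : ℝ := (∫ q, kin q * g q ∂KM) / 2 - 2 * π * ∫ s in Ioi (0:ℝ), pF g s ^ 2

lemma x2_nonneg (g G) : 0 ≤ x2 g G := setIntegral_nonneg measurableSet_Ioi fun _ _ => sq_nonneg _

lemma x2_exp {g M G R} (hg : RM g M) (hG : RM G R) : x2 g G = (∫ s in Ioi (0:ℝ), pF g s ^ 2) - 2 * (∫ s in Ioi (0:ℝ), pF g s * pF G s) + ∫ s in Ioi (0:ℝ), pF G s ^ 2 := by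
  have h1 := p2_int hg
  have h2 := p2_int hG
  have h3 := (pp_int hg hG).const_mul 2
  have h4 : Integrable (fun s => pF g s ^ 2 - 2 * (pF g s * pF G s)) (volume.restrict (Ioi 0)) := h1.sub h3
  rw [x2, ← integral_const_mul, ← integral_sub h1 h3, ← integral_add h4 h2]
  exact integral_congr_ae (ae_of_all _ fun s => by ring)

lemma H_id1 {g M G R} (hg : RM g M) (hG : RM G R) :
    (∫ q, eU g q * G q ∂KM) - ∫ q, eU g q * g q ∂KM = 2 * π * x2 g G - (Hm g - Hm G) := by
  rw [(eU_int hg hG).2, (eU_int hg hg).2, x2_exp hg hG, Hm, Hm]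
  simp only [← pow_two]; ring

lemma H_id2 {g M G R} (hg : RM g M) (hG : RM G R) :
    (∫ q, eU G q * g q ∂KM) - ∫ q, eU G q * G q ∂KM = 2 * π * x2 g G + (Hm g - Hm G) := by
  rw [(eU_int hG hG).2, (eU_int hG hg).2, x2_exp hg hG, Hm, Hm]
  simp only [← pow_two, mul_comm (pF G _) (pF g _)]; ring

lemma K_le {g M G R} (hg : RM g M) (hG : RM G R) :
    ∫ q, kin q * g q ∂KM ≤ 2 * Hm g + 8 * π * ((∫ s in Ioi (0:ℝ), pF G s ^ 2) + x2 g G) := by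
  have h1 := p2_int hg
  have h2 := p2_int hG
  have h3 := x2_int hg hG
  have : ∫ s in Ioi (0:ℝ), pF g s ^ 2 ≤ 2 * ((∫ s in Ioi (0:ℝ), pF G s ^ 2) + x2 g G) := by
    rw [x2, ← integral_add h2 h3, ← integral_const_mul]
    refine integral_mono h1 ((h2.add h3).const_mul 2) fun s => ?_
    simp only
    nlinarith [sq_nonneg (pF g s - 2 * pF G s)]
  have := mul_le_mul_of_nonneg_left this (show 0 ≤ 4 * π by positivity)
  rw [Hm]; linarith

lemma U_diff {g M G R} (hg : RM g M) (hG : RM G R) (h0 : 0 < x2 g G) {s : ℝ} (hs : 0 ≤ s) :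
    |UF g s - UF G s| ≤ √(x2 g G) * √s := by
  rcases hs.eq_or_lt with rfl | hs
  · simp [UF]
  have hi := (x2_int hg hG)
  have ii : ∀ {g}, RF g → IntervalIntegrable (pF g) volume 0 s := fun h => (pF_cont h).intervalIntegrable _ _
  have hle : ∫ t in (0:ℝ)..s, (pF g t - pF G t) ^ 2 ≤ x2 g G := by
    rw [intervalIntegral.integral_of_le hs.le]
    exact setIntegral_mono_set hi (ae_of_all _ fun _ => sq_nonneg _) Ioc_subset_Ioi_self.eventuallyLE
  have hc1 := pF_cont hg.toRF
  have hc2 := pF_cont hG.toRF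
  have hc := hc1.sub hc2
  set t := √s / √(x2 g G) with ht
  have hA : 0 < √(x2 g G) := by positivity
  have hS : 0 < √s := by positivity
  have ht0 : 0 < t := by positivity
  rw [UF, UF, ← intervalIntegral.integral_sub (ii hg.toRF) (ii hG.toRF)]
  refine (intervalIntegral.abs_integral_le_integral_abs hs.le).trans ?_
  have h1 : ∫ u in (0:ℝ)..s, |pF g u - pF G u| ≤ ∫ u in (0:ℝ)..s, (t / 2 * (pF g u - pF G u) ^ 2 + 1 / (2 * t)) := by
    refine intervalIntegral.integral_mono_on hs.le (hc.abs.intervalIntegrable _ _) (Continuous.intervalIntegrable (by fun_prop) _ _) fun u _ => ?_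
    have e : t / 2 * (pF g u - pF G u) ^ 2 + 1 / (2 * t) - |pF g u - pF G u| = (t * |pF g u - pF G u| - 1) ^ 2 / (2 * t) := by
      rw [← sq_abs (pF g u - pF G u)]; field_simp; ring
    have : 0 ≤ (t * |pF g u - pF G u| - 1) ^ 2 / (2 * t) := by positivity
    linarith
  refine h1.trans ?_
  rw [intervalIntegral.integral_add (Continuous.intervalIntegrable (by fun_prop) _ _) intervalIntegrable_const, intervalIntegral.integral_const_mul,
    intervalIntegral.integral_const, smul_eq_mul, sub_zero]
  have h2 := mul_le_mul_of_nonneg_left hle (show 0 ≤ t / 2 by positivity)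
  have e1 : t / 2 * x2 g G = √(x2 g G) * √s / 2 := by
    rw [ht, ← sq_sqrt h0.le, sqrt_sq hA.le]; field_simp
  have e2 : s * (1 / (2 * t)) = √(x2 g G) * √s / 2 := by
    rw [ht]; nth_rewrite 1 [← sq_sqrt hs.le]; field_simp
  linarith

lemma coer (hB : BG G ρ E e₀ Φ R) : ∃ κ δ0 C, 0 < κ ∧ 0 < δ0 ∧ δ0 ≤ 1 ∧ 0 ≤ C ∧ ∀ g M, RM g M → 0 < x2 g G → √(x2 g G) ≤ δ0 →
    ∀ d, 0 ≤ d → DD G g = ofReal d → ∀ S, 0 < S →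
      κ * x2 g G ≤ Hm g - Hm G + (C + √S) * d + (8 * π ^ 2 * M / S + (∫ q, kin q * g q ∂KM) / √S) := by
  obtain ⟨κ, δ0, Λ, hκ, hδ, hδ1, hΛ, H⟩ := CP hB
  have hΦ : 0 ≤ Φ := by have := hB.UΦ 0 le_rfl; simpa [UF] using this
  refine ⟨min (2 * π * κ) (2 * π), δ0, Λ + Φ, by positivity, hδ, hδ1, by positivity, ?_⟩
  intro g M hg h0 hx d hd hD S hS
  obtain ⟨P, hP, hP1, hP2⟩ := H _ g (sqrt_pos.2 h0) hx hg.toRF (fun s hs => U_diff hg hB.rm h0 hs) (by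
    rw [← ofReal_integral_eq_lintegral_ofReal (x2_int hg hB.rm) (ae_of_all _ fun _ => sq_nonneg _), sq_sqrt h0.le]; rfl)
  have h := dual hB hg (sqrt_nonneg _) (hx.trans hδ1) hΛ (fun s hs => U_diff hg hB.rm h0 hs) hP hP1 hP2 hS
  have hK : 0 ≤ ∫ q, kin q * g q ∂KM := integral_nonneg_of_ae (by
    filter_upwards [KM_pos] with q hq using mul_nonneg (kin_nonneg hq.1) (hg.nonneg q))
  have hM := hg.M0
  have h1 : 0 ≤ 8 * π ^ 2 * M / S + (∫ q, kin q * g q ∂KM) / √S := by positivity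
  have h2 : 0 ≤ (Λ + Φ + √S) * d := by positivity
  rw [sq_sqrt h0.le, H_id1 hg hB.rm, hD, ← ofReal_mul (by positivity)] at h
  have hm1 := mul_le_mul_of_nonneg_right (min_le_left (2 * π * κ) (2 * π)) h0.le
  have hm2 := mul_le_mul_of_nonneg_right (min_le_right (2 * π * κ) (2 * π)) h0.le
  rcases le_or_gt 1 κ with hk | hk
  · have h3 : ofReal (2 * π * ((1 - κ) * x2 g G)) = 0 := ofReal_of_nonpos
      (mul_nonpos_of_nonneg_of_nonpos (by positivity) (mul_nonpos_of_nonpos_of_nonneg (by linarith) h0.le))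
    rw [h3, zero_add, ← ofReal_add h2 h1, ofReal_le_ofReal_iff (add_nonneg h2 h1)] at h
    linarith
  · have h3 : 0 ≤ 2 * π * ((1 - κ) * x2 g G) := mul_nonneg (by positivity) (mul_nonneg (by linarith) h0.le)
    rw [← ofReal_add h3 h2, ← ofReal_add (add_nonneg h3 h2) h1, ofReal_le_ofReal_iff (by linarith)] at h
    linarith

lemma x2_small (hB : BG G ρ E e₀ Φ R) : ∃ δ, 0 < δ ∧ ∀ (g : ℕ → T3 → ℝ) M, (∀ n, RM (g n) M) → (∀ n, √(x2 (g n) G) ≤ δ) →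
    (∀ ε > 0, ∀ᶠ n in atTop, Hm (g n) ≤ Hm G + ε) → ∀ d : ℕ → ℝ, (∀ n, 0 ≤ d n) → (∀ n, DD G (g n) = ofReal (d n)) →
    Tendsto d atTop (𝓝 0) → ∀ η > 0, ∀ᶠ n in atTop, x2 (g n) G < η := by
  obtain ⟨κ, δ, C, hκ, hδ, hδ1, hC, H⟩ := coer hB
  refine ⟨δ, hδ, fun g M hg hx hH d hd hD hdt η hη => ?_⟩
  set K := 2 * (Hm G + 1) + 8 * π * ((∫ s in Ioi (0:ℝ), pF G s ^ 2) + 1) with hK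
  have hc : 0 < κ * η / 4 := by positivity
  have ht : Tendsto (fun S : ℝ => 8 * π ^ 2 * M / S + K / √S) atTop (𝓝 0) := by
    have h1 : Tendsto (fun S : ℝ => 8 * π ^ 2 * M / S) atTop (𝓝 0) := tendsto_const_nhds.div_atTop tendsto_id
    have h2 : Tendsto (fun S : ℝ => K / √S) atTop (𝓝 0) := tendsto_const_nhds.div_atTop tendsto_sqrt_atTop
    simpa using h1.add h2
  obtain ⟨S, hS, hS0⟩ := ((ht.eventually (gt_mem_nhds hc)).and (eventually_gt_atTop 0)).exists
  have hdt2 : Tendsto (fun n => (C + √S) * d n) atTop (𝓝 0) := by simpa using hdt.const_mul (C + √S)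
  filter_upwards [hH 1 one_pos, hH _ hc, hdt2.eventually (gt_mem_nhds hc)] with n h1 h2 h3
  by_contra hcon
  have hcon : η ≤ x2 (g n) G := not_lt.1 hcon
  have h4 := H (g n) M (hg n) (hη.trans_le hcon) (hx n) (d n) (hd n) (hD n) S hS0
  have h5 := K_le (hg n) hB.rm
  have h6 : x2 (g n) G ≤ 1 := by
    have := hx n
    rw [sqrt_le_left hδ.le] at this
    nlinarith
  have h7 : ∫ q, kin q * g n q ∂KM ≤ K := by
    have := mul_le_mul_of_nonneg_left h6 (show 0 ≤ 8 * π by positivity)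
    rw [hK]; linarith
  have h8 : (∫ q, kin q * g n q ∂KM) / √S ≤ K / √S := by gcongr
  have h9 : κ * η ≤ κ * x2 (g n) G := by gcongr
  linarith
end


section
variable {G : T3 → ℝ} {ρ : ℝ → ℝ} {E : T2 → ℝ} {e₀ Φ R : ℝ}

def ED (G : T3 → ℝ) (E : T2 → ℝ) (z : T4) : ℝ := E z.1 - eU G (z.1.2, z.2)

lemma ED_meas (hB : BG G ρ E e₀ Φ R) : Measurable (ED G E) :=
  (hB.Em.comp measurable_fst).sub ((eU_meas hB.rm.toRF).comp (by fun_prop))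

lemma Z_est (hB : BG G ρ E e₀ Φ R) {g M} (hg : RM g M) {d : ℝ} (hd : 0 ≤ d) (hD : DD G g = ofReal d) :
    ∫⁻ z, ofReal (|ED G E z| * |ch G z - ch g z|) ∂NM ≤
      ofReal (Φ * d) + ofReal ((∫ q, eU G q * g q ∂KM) - ∫ q, eU G q * G q ∂KM) := by
  have hΦ : 0 ≤ Φ := by have := hB.UΦ 0 le_rfl; simpa [UF] using this
  have i1 := lay_i (eU_meas hB.rm.toRF) hB.rm.toRF (eU_int hB.rm hB.rm).1
  have i2 := lay_i (eU_meas hB.rm.toRF) hg.toRF (eU_int hB.rm hg).1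
  have j : ∀ {g M}, RM g M → Integrable (ch g) NM := fun h => by
    have := (lay_i (a := fun _ => 1) measurable_const h.toRF (by simpa using h.int)).1
    simpa using this
  have hEb : ∀ y, |E y| ≤ Φ := fun y => abs_le.2 ⟨hB.E1 y, by linarith [hB.E2 y, hB.e0]⟩
  have iE : Integrable (fun z : T4 => E z.1 * (ch G z - ch g z)) NM :=
    ((j hB.rm).sub (j hg)).bdd_mul (c := Φ) (hB.Em.comp measurable_fst).aestronglyMeasurable (ae_of_all _ fun z => hEb z.1)
  have iEE : Integrable (fun z : T4 => eU G (z.1.2, z.2) * ch g z - eU G (z.1.2, z.2) * ch G z) NM := i2.1.sub i1.1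
  have hpt : ∀ᵐ z ∂NM, |ED G E z| * |ch G z - ch g z| = E z.1 * (ch G z - ch g z) + (eU G (z.1.2, z.2) * ch g z - eU G (z.1.2, z.2) * ch G z) := by
    filter_upwards [NM_pos] with z hz
    have hlev := hB.lev z.1.1 z.1.2 z.2.1 z.2.2 hz.1 hz.2.1 hz.2.2
    have hG1 : ch G z = if 0 < ED G E z then 1 else 0 := by
      refine if_congr (hlev.trans ?_) rfl rfl
      have : ED G E z = E (z.1.1, z.1.2) + UF G z.2.1 - z.1.2 * z.2.1 ^ 2 / 2 - z.2.2 ^ 2 / 2 := by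
        simp only [ED, eU, kin]; ring
      rw [this, sub_pos]
    have e : E z.1 * (ch G z - ch g z) + (eU G (z.1.2, z.2) * ch g z - eU G (z.1.2, z.2) * ch G z) = ED G E z * (ch G z - ch g z) := by
      simp only [ED]; ring
    rw [e, hG1]
    rcases ch_01 g z with h | h <;> rw [h] <;> split_ifs with h1
    · rw [abs_of_pos h1]; simp
    · simp
    · simp
    · rw [abs_of_nonpos (not_lt.1 h1)]; simp
  have hnn : 0 ≤ᵐ[NM] fun z => E z.1 * (ch G z - ch g z) + (eU G (z.1.2, z.2) * ch g z - eU G (z.1.2, z.2) * ch G z) := by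
    filter_upwards [hpt] with z hz
    rw [← hz]; exact mul_nonneg (abs_nonneg _) (abs_nonneg _)
  have iS : Integrable (fun z : T4 => E z.1 * (ch G z - ch g z) + (eU G (z.1.2, z.2) * ch g z - eU G (z.1.2, z.2) * ch G z)) NM := iE.add iEE
  rw [lintegral_congr_ae (hpt.mono fun z hz => by rw [hz]), ← ofReal_integral_eq_lintegral_ofReal iS hnn,
    integral_add iE iEE, integral_sub i2.1 i1.1, i1.2, i2.2]
  refine ENNReal.ofReal_add_le.trans (add_le_add ?_ le_rfl)
  rw [ofReal_mul hΦ, ← hD, DD_eq hB.rm.meas hg.meas, ← lcmul, NM, integral_prod _ iE]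
  refine (ofReal_int_le iE.integral_prod_left).trans (lintegral_mono_ae ?_)
  filter_upwards [ch_mu hB.rm.toRF, ch_mu hg.toRF] with y a b
  rw [integral_const_mul, integral_sub a.2.1 b.2.1, a.2.2, b.2.2]
  exact toReal_dd a.1 b.1 (hEb y)

def ZZ (G : T3 → ℝ) (E : T2 → ℝ) (M η : ℝ) : Set (T4) :=
  {z | (z.1.1 < M ∧ 0 < z.1.1 ∧ 0 < z.1.2 ∧ 0 < z.2.1) ∧ |ED G E z| < η}

lemma ZZ_meas (hB : BG G ρ E e₀ Φ R) (M η : ℝ) : MeasurableSet (ZZ G E M η) := by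
  have := ED_meas hB
  have h1 : MeasurableSet {z : T4 | |ED G E z| < η} := measurableSet_lt (by fun_prop) measurable_const
  have ha : MeasurableSet {z : T4 | z.1.1 < M} := measurableSet_lt (by fun_prop) measurable_const
  have hb : MeasurableSet {z : T4 | 0 < z.1.1} := measurableSet_lt measurable_const (by fun_prop)
  have hc : MeasurableSet {z : T4 | 0 < z.1.2} := measurableSet_lt measurable_const (by fun_prop)
  have hd : MeasurableSet {z : T4 | 0 < z.2.1} := measurableSet_lt measurable_const (by fun_prop)
  exact (ha.inter (hb.inter (hc.inter hd))).inter h1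

lemma ZZ_fin (hB : BG G ρ E e₀ Φ R) (M : ℝ) : NM (ZZ G E M (-e₀ / 2)) ≠ ⊤ := by
  have he := hB.e0
  have hp0 := pF_nonneg hB.rm.toRF 0
  set s1 := -e₀ / (2 * (pF G 0 + 1)) with hs1
  have hs1p : 0 < s1 := div_pos (by linarith) (by positivity)
  have hsub : ZZ G E M (-e₀ / 2) ⊆ (Iio M ×ˢ Iio (2 * Φ / s1 ^ 2)) ×ˢ (Ioi s1 ×ˢ Icc (-√(2 * Φ)) √(2 * Φ)) := by
    rintro z ⟨⟨h1, h2, h3, h4⟩, h5⟩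
    have h6 := (abs_lt.1 h5).1
    simp only [ED, eU, kin] at h6
    have h7 := hB.E2 z.1
    have h8 := UF_le hB.rm.toRF h4.le
    have h9 := hB.UΦ z.2.1 h4.le
    have hw := sq_nonneg z.2.2
    have hl : 0 ≤ z.1.2 * z.2.1 ^ 2 := by positivity
    have hs : s1 < z.2.1 := by
      rw [hs1, div_lt_iff₀ (by positivity)]
      nlinarith
    refine ⟨⟨h1, ?_⟩, ⟨hs, ?_⟩⟩
    · show z.1.2 < _
      rw [lt_div_iff₀ (by positivity)]
      have : z.1.2 * s1 ^ 2 ≤ z.1.2 * z.2.1 ^ 2 := by gcongr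
      linarith
    · rw [mem_Icc, ← abs_le]
      refine Real.abs_le_sqrt (by linarith)
  have hH : ∀ a, HM (Iio a) ≠ ⊤ := fun a => by
    rw [HM, Measure.restrict_apply measurableSet_Iio, Iio_inter_Ioi]; simp
  have hP : PM (Ioi s1 ×ˢ Icc (-√(2 * Φ)) √(2 * Φ)) ≠ ⊤ := by
    rw [PM, Measure.prod_prod]
    refine ENNReal.mul_ne_top ?_ (by simp)
    rw [withDensity_apply _ measurableSet_Ioi, Measure.restrict_restrict measurableSet_Ioi, inter_eq_left.2 (Ioi_subset_Ioi hs1p.le)]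
    have : ∀ s : ℝ, ofReal (4 * π ^ 2 / s ^ 2) = ofReal (4 * π ^ 2) * ofReal (s ^ 2)⁻¹ := fun s => by
      rw [← ofReal_mul (by positivity), div_eq_mul_inv]
    simp only [this]
    rw [lcmul, lint_inv_sq hs1p]
    exact ENNReal.mul_ne_top ofReal_ne_top ofReal_ne_top
  refine ne_top_of_le_ne_top ?_ (measure_mono hsub)
  rw [NM, Measure.prod_prod, Measure.prod_prod]
  exact ENNReal.mul_ne_top (ENNReal.mul_ne_top (hH _) (hH _)) hP

lemma ED_ne (hB : BG G ρ E e₀ Φ R) : ∀ᵐ z ∂NM, ED G E z ≠ 0 := by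
  have hw : ∀ᵐ z ∂NM, z.2.2 ≠ 0 := by
    have h1 : ∀ᵐ w : ℝ, w ≠ 0 := by simp [ae_iff]
    have h2 : ∀ᵐ p ∂PM, p.2 ≠ 0 := (Measure.quasiMeasurePreserving_snd (ν := (volume : Measure ℝ))).ae h1
    exact (Measure.quasiMeasurePreserving_snd (μ := HM.prod HM) (ν := PM)).ae h2
  have hG : ∀ᵐ z ∂NM, z.1.1 ≠ G (z.1.2, z.2) := by
    have hm : MeasurableSet {x : ℝ × (T3) | x.1 = G x.2} := measurableSet_eq_fun (by fun_prop) (hB.rm.meas.comp measurable_snd)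
    have h1 : ∀ᵐ x ∂(HM.prod KM), x.1 ≠ G x.2 := by
      rw [ae_iff]
      simp only [not_not]
      rw [Measure.prod_apply_symm hm]
      refine (lintegral_congr fun q => ?_).trans lintegral_zero
      have : (fun x => (x, q)) ⁻¹' {x : ℝ × (T3) | x.1 = G x.2} = {G q} := by ext; simp
      rw [this, HM]
      exact measure_mono_null Subset.rfl ((Measure.absolutelyContinuous_of_le Measure.restrict_le_self) (by simp))
    exact mp_as.quasiMeasurePreserving.ae h1
  filter_upwards [NM_pos, hw, hG] with z hz hw hG h0
  have e : ED G E z = E (z.1.1, z.1.2) + UF G z.2.1 - z.1.2 * z.2.1 ^ 2 / 2 - z.2.2 ^ 2 / 2 := by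
    simp only [ED, eU, kin]; ring
  rw [h0] at e
  have hlev := fun w => hB.lev z.1.1 z.1.2 z.2.1 w hz.1 hz.2.1 hz.2.2
  refine hG (le_antisymm ?_ ?_)
  · have hc : ContinuousAt (fun t : ℝ => G (z.1.2, (z.2.1, t * z.2.2))) 1 := by
      have h1 := (hB.gc z.1.2).continuousAt (x := (z.2.1, 1 * z.2.2)) ((isOpen_Ioi.prod isOpen_univ).mem_nhds ⟨hz.2.2, mem_univ _⟩)
      exact ContinuousAt.comp (f := fun t : ℝ => (z.2.1, t * z.2.2)) h1 (by fun_prop)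
    have h2 : Tendsto (fun t : ℝ => G (z.1.2, (z.2.1, t * z.2.2))) (𝓝[<] 1) (𝓝 (G (z.1.2, z.2))) := by
      have := hc.tendsto.mono_left (nhdsWithin_le_nhds (s := Iio 1))
      simpa using this
    refine ge_of_tendsto h2 ?_
    filter_upwards [Ioo_mem_nhdsLT (show (0:ℝ) < 1 by norm_num)] with t ht
    refine ((hlev _).2 ?_).le
    have h3 : 0 < z.2.2 ^ 2 := by positivity
    have h4 : t ^ 2 < 1 := by nlinarith [ht.1, ht.2]
    nlinarith
  · by_contra hcon
    have := (hlev z.2.2).1 (not_le.1 hcon)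
    linarith

lemma ZZ_tend (hB : BG G ρ E e₀ Φ R) (M : ℝ) : Tendsto (fun η => NM (ZZ G E M η)) (𝓝[>] 0) (𝓝 0) := by
  have h := tendsto_measure_biInter_gt (μ := NM) (s := ZZ G E M) (a := 0) (fun r _ => (ZZ_meas hB M r).nullMeasurableSet)
    (fun i j _ hij z hz => ⟨hz.1, hz.2.trans_le hij⟩) ⟨_, by linarith [hB.e0], ZZ_fin hB M⟩
  have h0 : NM (⋂ r > (0:ℝ), ZZ G E M r) = 0 := by
    refine measure_mono_null (fun z hz => ?_) (ED_ne hB)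
    rw [mem_iInter₂] at hz
    have : |ED G E z| ≤ 0 := le_of_forall_pos_le_add fun r hr => by
      have := (hz r hr).2; linarith
    simpa using this
  rwa [h0] at h

lemma l1_est (hB : BG G ρ E e₀ Φ R) {g M} (hg : RM g M) {d : ℝ} (hd : 0 ≤ d) (hD : DD G g = ofReal d) {η : ℝ} (hη : 0 < η) :
    ofReal (∫ q, |g q - G q| ∂KM) ≤ NM (ZZ G E (max M R) η) + ofReal η⁻¹ *
      (ofReal (Φ * d) + ofReal ((∫ q, eU G q * g q ∂KM) - ∫ q, eU G q * G q ∂KM)) := by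
  have hab : ∀ a b : ℝ, ofReal |a - b| = ofReal (a - b) + ofReal (b - a) := by
    intro a b
    rcases le_total a b with h | h
    · rw [ofReal_of_nonpos (p := a - b) (by linarith), zero_add, abs_of_nonpos (by linarith)]; congr 1; ring
    · rw [ofReal_of_nonpos (p := b - a) (by linarith), add_zero, abs_of_nonneg (by linarith)]
  have hGm := hB.rm.meas
  have hgm := hg.meas
  have mG := ch_meas hGm
  have mg := ch_meas hgm
  have mE := ED_meas hB
  have h1 := lay_l (k := fun _ => 1) measurable_const hgm hGm hB.rm.nonneg
  have h2 := lay_l (k := fun _ => 1) measurable_const hGm hgm hg.nonneg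
  simp only [one_mul] at h1 h2
  have hi : Integrable (fun q => |g q - G q|) KM := (hg.int.sub hB.rm.int).abs
  rw [ofReal_integral_eq_lintegral_ofReal hi (ae_of_all _ fun _ => abs_nonneg _)]
  have h3 : ∫⁻ q, ofReal |g q - G q| ∂KM = ∫⁻ z, ofReal |ch G z - ch g z| ∂NM := by
    simp only [hab]
    rw [lintegral_add_left (by fun_prop), lintegral_add_left (by fun_prop), h1, h2, add_comm]
  refine le_of_eq_of_le h3 ?_
  have hae : ∀ᵐ z ∂NM, ofReal |ch G z - ch g z| ≤ (ZZ G E (max M R) η).indicator 1 z + ofReal η⁻¹ * ofReal (|ED G E z| * |ch G z - ch g z|) := by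
    have hgM : ∀ᵐ z ∂NM, g (z.1.2, z.2) ≤ M :=
      mp_as.quasiMeasurePreserving.ae ((Measure.quasiMeasurePreserving_snd (μ := HM) (ν := KM)).ae hg.le)
    filter_upwards [NM_pos, hgM] with z hz hz2
    by_cases hc : ch G z = ch g z
    · rw [hc]; simp
    have hM : z.1.1 < max M R := by
      by_contra hcon
      have hcon := not_lt.1 hcon
      have a1 := le_max_left M R
      have a2 := le_max_right M R
      have a3 := hB.le (z.1.2, z.2)
      refine hc ?_
      rw [ch, ch, if_neg (by linarith), if_neg (by linarith)]
    have h1 : |ch G z - ch g z| = 1 := by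
      rcases ch_01 g z with h | h <;> rcases ch_01 G z with h' | h' <;> rw [h, h'] at hc ⊢ <;> simp at hc ⊢
    rw [h1, mul_one]
    by_cases hZ : |ED G E z| < η
    · rw [indicator_of_mem (show z ∈ ZZ G E (max M R) η from ⟨⟨hM, hz⟩, hZ⟩)]
      simp
    · refine le_trans ?_ le_add_self
      rw [← ofReal_mul (by positivity)]
      refine ofReal_le_ofReal ?_
      rw [inv_mul_eq_div, le_div_iff₀ hη]; linarith
  refine (lintegral_mono_ae hae).trans ?_
  rw [lintegral_add_left (measurable_one.indicator (ZZ_meas hB _ _)), lintegral_indicator_one (ZZ_meas hB _ _),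
    lcmul]
  exact add_le_add le_rfl (mul_le_mul_right (Z_est hB hg hd hD) _)

lemma v2_est (hB : BG G ρ E e₀ Φ R) {g M} (hg : RM g M) : ∫ q, kin q * |g q - G q| ∂KM ≤
    2 * ((∫ q, eU G q * g q ∂KM) - ∫ q, eU G q * G q ∂KM) + 6 * Φ * ∫ q, |g q - G q| ∂KM := by
  have hi := (hg.int.sub hB.rm.int).abs
  have i1 := (eU_int hB.rm hg).1
  have i2 := (eU_int hB.rm hB.rm).1
  have hk : Integrable (fun q => kin q * |g q - G q|) KM := by
    refine (hg.kint.sub hB.rm.kint).abs.congr ?_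
    filter_upwards [KM_pos] with q hq
    simp only [Pi.sub_apply]
    rw [← mul_sub, abs_mul, abs_of_nonneg (kin_nonneg hq.1)]
  have i3 : Integrable (fun q => 2 * (eU G q * g q - eU G q * G q)) KM := (i1.sub i2).const_mul 2
  have i4 : Integrable (fun q => 6 * Φ * |g q - G q|) KM := hi.const_mul _
  rw [← integral_sub i1 i2, ← integral_const_mul, ← integral_const_mul, ← integral_add i3 i4]
  refine integral_mono_ae hk (i3.add i4) ?_
  filter_upwards [KM_pos] with q hq
  have hU := hB.UΦ q.2.1 hq.2.le
  have hU0 := UF_nonneg hB.rm.toRF hq.2.le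
  have hk0 := kin_nonneg hq.1
  have e : 2 * (eU G q * g q - eU G q * G q) = kin q * (g q - G q) - 2 * UF G q.2.1 * (g q - G q) := by rw [eU]; ring
  have e1 : UF G q.2.1 * (g q - G q) ≤ Φ * |g q - G q| :=
    (mul_le_mul_of_nonneg_left (le_abs_self _) hU0).trans (mul_le_mul_of_nonneg_right hU (abs_nonneg _))
  have e2 : kin q * |g q - G q| ≤ kin q * (g q - G q) + 4 * Φ * |g q - G q| := by
    rcases le_total (G q) (g q) with h | h
    · rw [abs_of_nonneg (by linarith)]
      have : 0 ≤ 4 * Φ * (g q - G q) := mul_nonneg (by linarith) (by linarith)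
      linarith
    · rcases (hB.rm.nonneg q).eq_or_lt with h0 | h0
      · have : g q = G q := le_antisymm h (by rw [← h0]; exact hg.nonneg q)
        rw [this]; simp
      · have hkq : kin q ≤ 2 * Φ := by
          have := (hB.lev (G q / 2) q.1 q.2.1 q.2.2 (by linarith) hq.1 hq.2).1 (by show G q / 2 < G q; linarith)
          have := hB.E2 (G q / 2, q.1)
          have := hB.e0
          simp only [kin]; linarith
        rw [abs_of_nonpos (by linarith)]
        nlinarith [mul_nonneg (sub_nonneg.2 hkq) (sub_nonneg.2 h)]
  linarith
end


lemma limsup_ev {u : ℕ → ℝ} {h : ℝ} (h0 : h < 0) (hl : limsup u atTop ≤ h) (ε : ℝ) (hε : 0 < ε) :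
    ∀ᶠ n in atTop, u n ≤ h + ε := by
  by_contra hcon
  rw [limsup_eq] at hl
  have hb : ∀ a ∈ {a | ∀ᶠ n in atTop, u n ≤ a}, h + ε ≤ a := by
    intro a ha
    by_contra hlt
    have ha' : ∀ᶠ n in atTop, u n ≤ a := ha
    exact hcon (ha'.mono fun n hn => by linarith)
  rcases Set.eq_empty_or_nonempty {a | ∀ᶠ n in atTop, u n ≤ a} with he | hne
  · rw [he, Real.sInf_empty] at hl; linarith
  · have := le_csInf hne hb; linarith

lemma fin_lim {G : T3 → ℝ} {ρ : ℝ → ℝ} {E : T2 → ℝ} {e₀ Φ R : ℝ} (hB : BG G ρ E e₀ Φ R)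
    {g : ℕ → T3 → ℝ} {M : ℝ} (hg : ∀ n, RM (g n) M)
    (hH : ∀ ε > 0, ∀ᶠ n in atTop, Hm (g n) ≤ Hm G + ε) {d : ℕ → ℝ} (hd : ∀ n, 0 ≤ d n)
    (hD : ∀ n, DD G (g n) = ofReal (d n)) (hdt : Tendsto d atTop (𝓝 0))
    (hx : ∀ η > 0, ∀ᶠ n in atTop, x2 (g n) G < η) :
    Tendsto (fun n => ∫ q, |g n q - G q| ∂KM) atTop (𝓝 0) ∧
      Tendsto (fun n => ∫ q, kin q * |g n q - G q| ∂KM) atTop (𝓝 0) := by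
  have hΦ : 0 ≤ Φ := by have := hB.UΦ 0 le_rfl; simpa [UF] using this
  have hW : ∀ ε > 0, ∀ᶠ n in atTop, (∫ q, eU G q * g n q ∂KM) - ∫ q, eU G q * G q ∂KM ≤ ε := by
    intro ε hε
    filter_upwards [hx (ε / (4 * π)) (by positivity), hH (ε / 2) (by positivity)] with n h1 h2
    rw [H_id2 (hg n) hB.rm]
    have h3 : 2 * π * x2 (g n) G ≤ 2 * π * (ε / (4 * π)) := mul_le_mul_of_nonneg_left h1.le (by positivity)
    have h4 : 2 * π * (ε / (4 * π)) = ε / 2 := by field_simp; ring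
    linarith
  have n1 : ∀ n, 0 ≤ ∫ q, |g n q - G q| ∂KM := fun n => integral_nonneg fun q => abs_nonneg _
  have n2 : ∀ n, 0 ≤ ∫ q, kin q * |g n q - G q| ∂KM := fun n => by
    refine integral_nonneg_of_ae ?_
    filter_upwards [KM_pos] with q hq
    exact mul_nonneg (kin_nonneg hq.1) (abs_nonneg _)
  have L1 : ∀ ε > 0, ∀ᶠ n in atTop, ∫ q, |g n q - G q| ∂KM < ε := by
    intro ε hε
    have hz := (ZZ_tend hB (max M R)).eventually (gt_mem_nhds (show (0:ℝ≥0∞) < ofReal (ε / 2) by simpa using hε))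
    obtain ⟨η, h1, h2⟩ := (hz.and self_mem_nhdsWithin).exists
    have h2 : 0 < η := h2
    have hdd : ∀ᶠ n in atTop, Φ * d n < η * ε / 4 := by
      have : Tendsto (fun n => Φ * d n) atTop (𝓝 0) := by simpa using hdt.const_mul Φ
      exact this.eventually (gt_mem_nhds (by positivity))
    filter_upwards [hdd, hW (η * ε / 4) (by positivity)] with n h3 h4
    have h5 := l1_est hB (hg n) (hd n) (hD n) h2
    have h6 : ofReal η⁻¹ *
      (ofReal (Φ * d n) + ofReal ((∫ q, eU G q * g n q ∂KM) - ∫ q, eU G q * G q ∂KM)) ≤ ofReal (ε / 2) := by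
      refine (mul_le_mul_right (add_le_add (ofReal_le_ofReal h3.le) (ofReal_le_ofReal h4)) _).trans ?_
      rw [← ofReal_add (by positivity) (by positivity), ← ofReal_mul (by positivity)]
      refine ofReal_le_ofReal (le_of_eq ?_)
      field_simp; ring
    have h7 : ofReal (∫ q, |g n q - G q| ∂KM) < ofReal ε := by
      refine lt_of_le_of_lt (h5.trans (add_le_add le_rfl h6)) ?_
      refine lt_of_lt_of_eq (ENNReal.add_lt_add_right ofReal_ne_top h1) ?_
      rw [← ofReal_add (by positivity) (by positivity), add_halves]
    exact (ENNReal.ofReal_lt_ofReal_iff hε).1 h7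
  refine ⟨?_, ?_⟩
  · rw [Metric.tendsto_nhds]
    intro ε hε
    filter_upwards [L1 ε hε] with n hn
    rw [Real.dist_eq, sub_zero, abs_of_nonneg (n1 n)]; exact hn
  · rw [Metric.tendsto_nhds]
    intro ε hε
    filter_upwards [L1 (ε / (2 * (6 * Φ + 1))) (by positivity), hW (ε / 8) (by positivity)] with n h1 h2
    rw [Real.dist_eq, sub_zero, abs_of_nonneg (n2 n)]
    have h3 := v2_est hB (hg n)
    have h4 : 6 * Φ * ∫ q, |g n q - G q| ∂KM ≤ (6 * Φ + 1) * (ε / (2 * (6 * Φ + 1))) :=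
      mul_le_mul (by linarith) h1.le (n1 n) (by linarith)
    have h5 : (6 * Φ + 1) * (ε / (2 * (6 * Φ + 1))) = ε / 2 := by
      have : 6 * Φ + 1 ≠ 0 := by positivity
      field_simp
    linarith

/-- Theorem 2: compactness of local minimizing sequences. -/
theorem stmt1 (Q : Phase → ℝ) (F : ℝ → ℝ → ℝ) (e₀ : ℝ) (hQ : AssumptionA Q F e₀) :
    ∃ δ : ℝ, 0 < δ ∧
      ∀ f : ℕ → Phase → ℝ,
        (∀ n, memErad (f n)) →
        (∃ M : ℝ≥0∞, M < ⊤ ∧ ∀ n, eLpNorm (f n) ⊤ volume ≤ M) →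
        (∀ n, fieldDist (f n) Q < δ) →
        Filter.limsup (fun n => Ham (f n)) atTop ≤ Ham Q →
        Tendsto
          (fun n => ∫ p in (Ioi (0:ℝ)) ×ˢ (Ioi (0:ℝ)),
            |schwarz (f n) p.1 p.2 - schwarz Q p.1 p.2|) atTop (nhds 0) →
        (Tendsto (fun n => distL1 (f n) Q) atTop (nhds 0) ∧
          Tendsto (fun n => distL1v (f n) Q) atTop (nhds 0)) := by
  obtain ⟨ρ, E, Φ, R, hB⟩ := exists_BG hQ
  have hQm := Q_mem hQ
  have hneg : Hm (red Q) < 0 := ham_neg hB (Q_pos hQ)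
  obtain ⟨δ, hδ, hsm⟩ := x2_small hB
  refine ⟨δ, hδ, fun f hf hM hfd hls hsch => ?_⟩
  obtain ⟨M, hMt, hM⟩ := hM
  have hrm : ∀ n, RM (red (f n)) M.toReal := fun n =>
    rm_red (hf n) ENNReal.toReal_nonneg (by rw [ENNReal.ofReal_toReal hMt.ne]; exact hM n)
  have hHf : ∀ n, Ham (f n) = Hm (red (f n)) := fun n => ham_eq (hf n) (hrm n)
  have hHQ : Ham Q = Hm (red Q) := ham_eq hQm hB.rm
  simp only [hHf, hHQ] at hls
  have hH := limsup_ev hneg hls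
  have hx : ∀ n, √(x2 (red (f n)) (red Q)) ≤ δ := by
    intro n
    have h1 := hfd n
    rw [fd_eq (hf n) hQm (hrm n) hB.rm] at h1
    refine le_trans (Real.sqrt_le_sqrt ?_) h1.le
    have h2 := x2_nonneg (red (f n)) (red Q)
    have h3 : (1:ℝ) ≤ 4 * π := by linarith [Real.pi_gt_three]
    exact le_mul_of_one_le_left h2 h3
  have hD : ∀ n, DD (red Q) (red (f n)) = ENNReal.ofReal (∫ p in (Ioi (0:ℝ)) ×ˢ (Ioi (0:ℝ)),
            |schwarz (f n) p.1 p.2 - schwarz Q p.1 p.2|) := by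
    intro n
    rw [sch_DD hQm (hf n) hB.rm (hrm n)]
    simp only [abs_sub_comm]
  have hd : ∀ n, 0 ≤ ∫ p in (Ioi (0:ℝ)) ×ˢ (Ioi (0:ℝ)),
            |schwarz (f n) p.1 p.2 - schwarz Q p.1 p.2| := fun n => integral_nonneg fun _ => abs_nonneg _
  have hxs := hsm (fun n => red (f n)) _ hrm hx hH _ hd hD hsch
  have := fin_lim hB hrm hH hd hD hsch hxs
  refine ⟨this.1.congr fun n => (d1_eq (hf n) hQm).1.symm, this.2.congr fun n => (d1_eq (hf n) hQm).2.symm⟩
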